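/- Let α ∈ [1,2), μ ∈ (0,1) with α+μ and α/2+μ not integers, and let c_0, K > 0. Suppose the kernel ρ satisfies Assumption S(c_0), the pair (ρ,G) satisfies Assumption A(K,c_0), each component b̃^k of the drift b̃ : ℝ^d → ℝ^d belongs to C^μ(ℝ^d) with |b̃^k|_μ ≤ K, and |ρ(y) − ρ(z)| ≤ K|y−z|^μ for all |y| = |z| = 1. Then for every f ∈ C^μ(ℝ^d) and every T ∈ [0,1] there exists a unique solution v ∈ C^{α+μ}(H_T) of the backward Kolmogorov equation ∂_t v(t,x) + b̃(x)·∇v(t,x) + Lv(t,x) = f(x) on H_T with v(T,x) = 0 for all x ∈ ℝ^d. Moreover there is a constant C = C(α,μ,d,K,c_0), independent of T, such that |v|_{α+μ} ≤ C|f|_μ, and |v(t,·) − v(s,·)|_{α/2+μ} ≤ C(t−s)^{1/2}|f|_μ for all 0 ≤ s ≤ t ≤ T. -/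

import Mathlib

open MeasureTheory Set
open scoped RealInnerProductSpace ENNReal NNReal

noncomputable section

/-- `ℝ^d` with the Euclidean norm. -/
abbrev Euc (d : ℕ) := EuclideanSpace ℝ (Fin d)

/-- The continuous linear map on `ℝ^d` induced by a `d × d` real matrix. -/
noncomputable def matCLM {d : ℕ} (A : Matrix (Fin d) (Fin d) ℝ) :
    Euc d →L[ℝ] Euc d :=
  Matrix.toEuclideanCLM (𝕜 := ℝ) A

/-- The Hölder norm `|u|_β` of a function `u : ℝ^d → ℝ`: the sum of the sup-norms of the
derivatives of order `≤ ⌊β⌋` plus the `{β}`-Hölder seminorm of the derivatives of order `⌊β⌋`. -/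
noncomputable def hNorm (d : ℕ) (β : ℝ) (u : Euc d → ℝ) : ℝ≥0∞ :=
  (∑ n ∈ Finset.range (⌊β⌋₊ + 1), ⨆ x : Euc d, (‖iteratedFDeriv ℝ n u x‖₊ : ℝ≥0∞)) +
    ⨆ (x : Euc d) (y : Euc d),
      (‖iteratedFDeriv ℝ ⌊β⌋₊ u x - iteratedFDeriv ℝ ⌊β⌋₊ u y‖₊ : ℝ≥0∞) /
        (‖x - y‖₊ : ℝ≥0∞) ^ (β - (⌊β⌋₊ : ℝ))

/-- Membership in the Hölder space `C^β(ℝ^d)`. -/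
def InHolder (d : ℕ) (β : ℝ) (u : Euc d → ℝ) : Prop :=
  ContDiff ℝ (⌊β⌋₊ : ℕ∞) u ∧ hNorm d β u ≠ ⊤

/-- The Hölder norm `|u|_β` on `H_T = [0,T] × ℝ^d` (all norms taken in `x`, uniformly in `t`). -/
noncomputable def hNormT (d : ℕ) (β T : ℝ) (u : ℝ → Euc d → ℝ) : ℝ≥0∞ :=
  ⨆ t ∈ Icc (0 : ℝ) T, hNorm d β (u t)

/-- Membership in the Hölder space `C^β(H_T)`. -/
def InHolderT (d : ℕ) (β T : ℝ) (u : ℝ → Euc d → ℝ) : Prop :=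
  (∀ t ∈ Icc (0 : ℝ) T, ContDiff ℝ (⌊β⌋₊ : ℕ∞) (u t)) ∧ hNormT d β T u ≠ ⊤

/-- Assumption S(c₀): `ρ ≥ c₀ > 0`, `ρ` is `0`-homogeneous, and `ρ` is even if `α = 1`. -/
def AssumpS (d : ℕ) (α c0 : ℝ) (ρ : Euc d → ℝ) : Prop :=
  (∀ y : Euc d, y ≠ 0 → c0 ≤ ρ y) ∧
  (∀ l : ℝ, 0 < l → ∀ y : Euc d, y ≠ 0 → ρ (l • y) = ρ y) ∧
  (α = 1 → ∀ y : Euc d, y ≠ 0 → ρ (-y) = ρ y)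

/-- Assumption A(K,c₀): S(c₀) holds, `|det G(x)| ≥ c₀`, the operator norms of `G(x)` and
the Lipschitz constant of `G` are bounded by `K`, and `0 ≤ ρ ≤ K`. -/
def AssumpA (d : ℕ) (α K c0 : ℝ) (ρ : Euc d → ℝ)
    (G : Euc d → Matrix (Fin d) (Fin d) ℝ) : Prop :=
  AssumpS d α c0 ρ ∧
  (∀ x : Euc d, c0 ≤ |(G x).det|) ∧
  (∀ x : Euc d, ‖matCLM (G x)‖ ≤ K) ∧
  (∀ x x' : Euc d, ‖matCLM (G x) - matCLM (G x')‖ ≤ K * ‖x - x'‖) ∧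
  (∀ y : Euc d, y ≠ 0 → 0 ≤ ρ y ∧ ρ y ≤ K)

/-- The nonlocal operator
`Lv(x) = ∫_{|y|≤1} [v(x+G(x)y) − v(x) − ∇v(x)·G(x)y] ρ(y) |y|^{−(d+α)} dy`. -/
noncomputable def Lop (d : ℕ) (α : ℝ) (ρ : Euc d → ℝ)
    (G : Euc d → Matrix (Fin d) (Fin d) ℝ) (v : Euc d → ℝ) (x : Euc d) : ℝ :=
  ∫ y in {y : Euc d | ‖y‖ ≤ 1},
    (v (x + matCLM (G x) y) - v x - ⟪gradient v x, matCLM (G x) y⟫) * ρ y *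
      ‖y‖ ^ (-((d : ℝ) + α))


/-- `v` solves the backward Kolmogorov equation
`∂_t v + b̃·∇v + Lv = f` on `H_T = [0,T] × ℝ^d`, `v(T,·) = 0`, in class `C^β(H_T)`. -/
def IsSolutionBwd (d : ℕ) (α β T : ℝ) (ρ : Euc d → ℝ)
    (G : Euc d → Matrix (Fin d) (Fin d) ℝ) (btil : Euc d → Euc d)
    (f : Euc d → ℝ) (v : ℝ → Euc d → ℝ) : Prop :=
  InHolderT d β T v ∧ (∀ x : Euc d, v T x = 0) ∧
  (∀ t ∈ Icc (0 : ℝ) T, ∀ x : Euc d,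
    IntegrableOn
      (fun y => (v t (x + matCLM (G x) y) - v t x -
          ⟪gradient (v t) x, matCLM (G x) y⟫) * ρ y * ‖y‖ ^ (-((d : ℝ) + α)))
      {y : Euc d | ‖y‖ ≤ 1}) ∧
  ∀ t ∈ Icc (0 : ℝ) T, ∀ x : Euc d,
    HasDerivWithinAt (fun s => v s x)
      (f x - ⟪btil x, gradient (v t) x⟫ - Lop d α ρ G (v t) x)
      (Icc (0 : ℝ) T) t


/-! ## Part 1 -/

open scoped BoundedContinuousFunction ContDiff

set_option linter.unusedSectionVars false

abbrev XX (d : ℕ) := Euc d →ᵇ ℝ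

instance (priority := 5000) XX.instACG (d : ℕ) : AddCommGroup (Euc d →ᵇ ℝ) :=
  (inferInstance : NormedAddCommGroup (Euc d →ᵇ ℝ)).toAddCommGroup
instance (priority := 5000) XX.instACM (d : ℕ) : AddCommMonoid (Euc d →ᵇ ℝ) :=
  (XX.instACG d).toAddCommMonoid
instance (priority := 5000) XX.instPM (d : ℕ) : PseudoMetricSpace (Euc d →ᵇ ℝ) :=
  (inferInstance : NormedAddCommGroup (Euc d →ᵇ ℝ)).toSeminormedAddCommGroup.toPseudoMetricSpace
instance (priority := 5000) XX.instTop (d : ℕ) : TopologicalSpace (Euc d →ᵇ ℝ) :=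
  (XX.instPM d).toUniformSpace.toTopologicalSpace
instance (priority := 5000) XX.instMod (d : ℕ) : Module ℝ (Euc d →ᵇ ℝ) :=
  (inferInstance : NormedSpace ℝ (Euc d →ᵇ ℝ)).toModule

section basic
variable {d : ℕ}

def tr (h : Euc d) : XX d →L[ℝ] XX d :=
  BoundedContinuousFunction.compContinuousCLM ℝ ℝ (⟨fun x => x + h, by fun_prop⟩ : C(Euc d, Euc d))

@[simp] lemma tr_apply (h : Euc d) (f : XX d) (x : Euc d) : tr h f x = f (x + h) := rfl

lemma norm_tr_le (h : Euc d) : ‖tr h‖ ≤ 1 := by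
  refine ContinuousLinearMap.opNorm_le_bound _ zero_le_one fun f => ?_
  rw [one_mul]
  exact (BoundedContinuousFunction.norm_le (norm_nonneg _)).2 fun x => f.norm_coe_le_norm _

lemma XX.abs_le (f : XX d) (x : Euc d) : |f x| ≤ ‖f‖ := f.norm_coe_le_norm x

lemma XX.norm_le_of {f : XX d} {C : ℝ} (h : ∀ x, |f x| ≤ C) : ‖f‖ ≤ C :=
  (BoundedContinuousFunction.norm_le ((abs_nonneg _).trans (h 0))).2 h

lemma XX.clm_norm_le {T : XX d →L[ℝ] XX d} {C : ℝ} (hC : 0 ≤ C)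
    (h : ∀ f x, |T f x| ≤ C * ‖f‖) : ‖T‖ ≤ C :=
  T.opNorm_le_bound hC fun f => XX.norm_le_of (h f)

/-- build a CLM from a formula -/
def XX.mkOp (φ : XX d → Euc d → ℝ) (C : ℝ) (hc : ∀ f, Continuous (φ f))
    (hadd : ∀ f g x, φ (f + g) x = φ f x + φ g x) (hsmul : ∀ (c : ℝ) f x, φ (c • f) x = c * φ f x)
    (hb : ∀ f x, |φ f x| ≤ C * ‖f‖) : XX d →L[ℝ] XX d :=
  LinearMap.mkContinuous
    { toFun := fun f => BoundedContinuousFunction.ofNormedAddCommGroup (φ f) (hc f) (C * ‖f‖) (hb f)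
      map_add' := fun f g => by ext x; exact hadd f g x
      map_smul' := fun c f => by ext x; exact hsmul c f x }
    C (fun f => XX.norm_le_of (hb f))

@[simp] lemma XX.mkOp_apply (φ : XX d → Euc d → ℝ) (C : ℝ) (hc hadd hsmul hb) (f : XX d) (x : Euc d) :
    XX.mkOp φ C hc hadd hsmul hb f x = φ f x := rfl

lemma XX.integrable_comp (ν : Measure (Euc d)) [IsFiniteMeasure ν] (f : XX d) (x : Euc d) :
    Integrable (fun z => f (x + z)) ν := by
  refine Integrable.of_bound (C := ‖f‖) ?_ (Filter.Eventually.of_forall fun z => f.norm_coe_le_norm _)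
  exact (f.continuous.comp (by fun_prop : Continuous fun z => x + z)).aestronglyMeasurable

def conv (ν : Measure (Euc d)) [IsFiniteMeasure ν] : XX d →L[ℝ] XX d :=
  XX.mkOp (fun f x => ∫ z, f (x + z) ∂ν) (ν.real univ)
    (fun f => by
      refine continuous_of_dominated (bound := fun _ => ‖f‖) ?_ ?_ (integrable_const _) ?_
      · intro x; exact (XX.integrable_comp ν f x).aestronglyMeasurable
      · intro x; exact Filter.Eventually.of_forall fun z => f.norm_coe_le_norm _
      · exact Filter.Eventually.of_forall fun z => f.continuous.comp (by fun_prop))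
    (fun f g x => by
      simpa using integral_add (XX.integrable_comp ν f x) (XX.integrable_comp ν g x))
    (fun c f x => by simpa using integral_const_mul c (fun z => f (x + z)))
    (fun f x => by
      have := norm_integral_le_of_norm_le_const (μ := ν) (f := fun z => f (x+z)) (C := ‖f‖)
        (Filter.Eventually.of_forall fun z => f.norm_coe_le_norm _)
      rw [mul_comm]; simpa using this)

lemma conv_apply (ν : Measure (Euc d)) [IsFiniteMeasure ν] (f : XX d) (x : Euc d) :
    conv ν f x = ∫ z, f (x + z) ∂ν := rfl

lemma norm_conv_le (ν : Measure (Euc d)) [IsFiniteMeasure ν] : ‖conv ν‖ ≤ ν.real univ :=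
  XX.clm_norm_le measureReal_nonneg fun f x => by
      have := norm_integral_le_of_norm_le_const (μ := ν) (f := fun z => f (x+z)) (C := ‖f‖)
        (Filter.Eventually.of_forall fun z => f.norm_coe_le_norm _)
      rw [mul_comm, conv_apply]; simpa using this

lemma conv_tr (ν : Measure (Euc d)) [IsFiniteMeasure ν] (h : Euc d) : Commute (conv ν) (tr h) := by
  ext f x
  change conv ν (tr h f) x = tr h (conv ν f) x
  simp only [conv_apply, tr_apply]
  congr 1; ext z; congr 1; abel

lemma conv_comm (ν ν' : Measure (Euc d)) [IsFiniteMeasure ν] [IsFiniteMeasure ν'] :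
    Commute (conv ν) (conv ν') := by
  ext f x
  change conv ν (conv ν' f) x = conv ν' (conv ν f) x
  simp only [conv_apply]
  rw [integral_integral_swap]
  · congr 1; ext z; congr 1; ext w; congr 1; abel
  · refine Integrable.of_bound (C := ‖f‖) ?_ (Filter.Eventually.of_forall fun z => f.norm_coe_le_norm _)
    exact (f.continuous.comp (by fun_prop : Continuous fun p : Euc d × Euc d => x + p.1 + p.2)).aestronglyMeasurable

lemma conv_add (ν ν' : Measure (Euc d)) [IsFiniteMeasure ν] [IsFiniteMeasure ν'] :
    conv (ν + ν') = conv ν + conv ν' := by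
  ext f x
  simp only [conv_apply, _root_.add_apply, BoundedContinuousFunction.coe_add, Pi.add_apply]
  exact integral_add_measure (XX.integrable_comp ν f x) (XX.integrable_comp ν' f x)

lemma conv_smul (ν : Measure (Euc d)) [IsFiniteMeasure ν] (c : ℝ≥0) :
    conv (c • ν) = (c : ℝ) • conv ν := by
  ext f x
  simp only [conv_apply, _root_.smul_apply, BoundedContinuousFunction.coe_smul]
  rw [integral_smul_nnreal_measure]; rfl

lemma conv_one (ν : Measure (Euc d)) [IsFiniteMeasure ν] : conv ν 1 = ν.real univ • (1 : XX d) := by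
  ext x; simp [conv_apply]

/-- bump -/
def eta0 (z : Euc d) : ℝ := (⟨1/8, 3/8, by norm_num, by norm_num⟩ : ContDiffBump (5/8 : ℝ)) (‖z‖^2)

lemma eta0_contDiff : ContDiff ℝ ∞ (eta0 (d := d)) := by
  have h := ContDiffBump.contDiff (n := ⊤) (⟨1/8, 3/8, by norm_num, by norm_num⟩ : ContDiffBump (5/8 : ℝ))
  exact ContDiff.comp h (contDiff_norm_sq (E := Euc d) ℝ)

lemma eta0_nonneg (z : Euc d) : 0 ≤ eta0 z := ContDiffBump.nonneg _

lemma eta0_neg (z : Euc d) : eta0 (-z) = eta0 z := by simp [eta0]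

lemma eta0_supp {z : Euc d} (h : eta0 z ≠ 0) : 1/2 < ‖z‖ ∧ ‖z‖ < 1 := by
  have : (‖z‖^2) ∈ Function.support (⟨1/8, 3/8, by norm_num, by norm_num⟩ : ContDiffBump (5/8 : ℝ)) := h
  rw [ContDiffBump.support_eq, Metric.mem_ball, Real.dist_eq, abs_lt] at this
  have := norm_nonneg z
  constructor <;> nlinarith

lemma eta0_compact : HasCompactSupport (eta0 (d := d)) := by
  refine HasCompactSupport.of_support_subset_isCompact (isCompact_closedBall (0 : Euc d) 1) ?_
  intro z hz
  simpa using (eta0_supp hz).2.le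

lemma eta0_cont : Continuous (eta0 (d := d)) := eta0_contDiff.continuous

lemma eta0_integral_pos [NeZero d] : 0 < ∫ z : Euc d, eta0 z := by
  obtain ⟨z, hz⟩ := exists_norm_eq (E := Euc d) (c := Real.sqrt (5/8)) (Real.sqrt_nonneg _)
  refine eta0_cont.integral_pos_of_hasCompactSupport_nonneg_nonzero eta0_compact (fun x => eta0_nonneg x) (x := z) ?_
  have : eta0 z = 1 := by
    unfold eta0
    rw [hz, Real.sq_sqrt (by norm_num)]
    exact ContDiffBump.one_of_mem_closedBall _ (by simp)
  rw [this]; norm_num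

def eta (z : Euc d) : ℝ := (∫ z : Euc d, eta0 z)⁻¹ * eta0 z

lemma eta_contDiff : ContDiff ℝ ∞ (eta (d := d)) := contDiff_const.mul eta0_contDiff
lemma eta_cont : Continuous (eta (d := d)) := eta_contDiff.continuous
lemma eta_nonneg (z : Euc d) : 0 ≤ eta z :=
  mul_nonneg (inv_nonneg.2 (integral_nonneg eta0_nonneg)) (eta0_nonneg z)
lemma eta_neg (z : Euc d) : eta (-z) = eta z := by simp [eta, eta0_neg]
lemma eta_supp {z : Euc d} (h : eta z ≠ 0) : 1/2 < ‖z‖ ∧ ‖z‖ < 1 :=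
  eta0_supp (right_ne_zero_of_mul h)
lemma eta_compact : HasCompactSupport (eta (d := d)) := eta0_compact.mul_left
lemma eta_integrable : Integrable (eta (d := d)) := eta_cont.integrable_of_hasCompactSupport eta_compact
lemma eta_integral [NeZero d] : ∫ z : Euc d, eta z = 1 := by
  unfold eta; rw [integral_const_mul]; exact inv_mul_cancel₀ eta0_integral_pos.ne'

def etaM (d : ℕ) : Measure (Euc d) := volume.withDensity (fun z => ENNReal.ofReal (eta z))

instance [NeZero d] : IsProbabilityMeasure (etaM d) := by
  constructor
  rw [etaM, withDensity_apply _ MeasurableSet.univ, Measure.restrict_univ,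
    ← ofReal_integral_eq_lintegral_ofReal eta_integrable (Filter.Eventually.of_forall eta_nonneg), eta_integral]
  simp

lemma etaM_integral (f : Euc d → ℝ) : ∫ z, f z ∂(etaM d) = ∫ z, eta z * f z := by
  rw [etaM, integral_withDensity_eq_integral_toReal_smul₀]
  · congr 1; ext z; rw [ENNReal.toReal_ofReal (eta_nonneg z)]; rfl
  · exact (eta_cont.measurable.ennreal_ofReal).aemeasurable
  · exact Filter.Eventually.of_forall fun _ => ENNReal.ofReal_lt_top

lemma etaM_ae : ∀ᵐ z ∂(etaM d), 1/2 < ‖z‖ ∧ ‖z‖ < 1 := by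
  rw [etaM, ae_withDensity_iff (eta_cont.measurable.ennreal_ofReal)]
  refine Filter.Eventually.of_forall fun z hz => eta_supp fun h => hz (by simp [h])

lemma etaM_neg : (etaM d).map (fun z => -z) = etaM d := by
  have hm : MeasurableEmbedding (fun z : Euc d => -z) := (MeasurableEquiv.neg (Euc d)).measurableEmbedding
  ext s hs
  rw [Measure.map_apply measurable_neg hs, etaM, withDensity_apply _ (measurable_neg hs), withDensity_apply _ hs]
  have hp : MeasurePreserving (fun z : Euc d => -z) volume volume := Measure.measurePreserving_neg _
  have := hp.setLIntegral_comp_preimage_emb hm (fun z => ENNReal.ofReal (eta z)) s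
  simpa [eta_neg] using this

variable [NeZero d]

def etaR (d : ℕ) (r : ℝ) : Measure (Euc d) := (etaM d).map (fun z => r • z)

instance (r : ℝ) : IsProbabilityMeasure (etaR d r) :=
  Measure.isProbabilityMeasure_map (by fun_prop)

def J (r : ℝ) : XX d →L[ℝ] XX d := conv (etaR d r)

lemma J_apply (r : ℝ) (f : XX d) (x : Euc d) : J r f x = ∫ z, f (x + r • z) ∂(etaM d) := by
  rw [J, conv_apply, etaR, integral_map (by fun_prop)]
  exact (f.continuous.comp (by fun_prop : Continuous fun z => x + z)).aestronglyMeasurable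

lemma norm_J_le (r : ℝ) : ‖(J r : XX d →L[ℝ] XX d)‖ ≤ 1 := by
  simpa [J] using norm_conv_le (etaR d r)

lemma J_one (r : ℝ) : J r (1 : XX d) = 1 := by
  simpa [J] using conv_one (etaR d r)

lemma J_int (r : ℝ) (f : XX d) (x : Euc d) : Integrable (fun z => f (x + r • z)) (etaM d) := by
  refine Integrable.of_bound (C := ‖f‖) ?_ (Filter.Eventually.of_forall fun z => f.norm_coe_le_norm _)
  exact (f.continuous.comp (by fun_prop : Continuous fun z => x + r • z)).aestronglyMeasurable

lemma J_norm_apply_le (r : ℝ) (f : XX d) : ‖J r f‖ ≤ ‖f‖ := by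
  simpa using (J r).le_of_opNorm_le (norm_J_le r) f

/-- local bound for J -/
lemma J_abs_le {r : ℝ} {f : XX d} {x : Euc d} {q : ℝ} (h : ∀ z, ‖z‖ ≤ |r| → |f (x + z)| ≤ q) :
    |J r f x| ≤ q := by
  rw [J_apply]
  have := norm_integral_le_of_norm_le_const (μ := etaM d) (f := fun z => f (x+ r • z)) (C := q) (by
    filter_upwards [etaM_ae] with z hz
    refine h _ ?_
    rw [norm_smul, Real.norm_eq_abs]
    have := abs_nonneg r
    nlinarith [hz.2])
  simpa using this

lemma etaM_integral_clm (g : Euc d →L[ℝ] ℝ) : ∫ z, g z ∂(etaM d) = 0 := by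
  have h : ∫ z, g z ∂((etaM d).map (fun z => -z)) = ∫ z, g z ∂(etaM d) := by rw [etaM_neg]
  rw [integral_map (by fun_prop) (by fun_prop)] at h
  simp only [map_neg, integral_neg] at h
  linarith

lemma etaM_integrable_clm (g : Euc d →L[ℝ] ℝ) : Integrable (fun z => g z) (etaM d) := by
  refine Integrable.of_bound (C := ‖g‖) (by fun_prop) ?_
  filter_upwards [etaM_ae] with z hz
  have := g.le_opNorm z
  have := norm_nonneg g
  nlinarith [hz.2]

end basic

/-! ## Part 2 -/
open scoped BoundedContinuousFunction ContDiff
set_option linter.unusedSectionVars false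

section smoothing
variable {d : ℕ}
open scoped Convolution

lemma conv_iter_bound (f : XX d) (n : ℕ) : ∀ (F F' : Type) [NormedAddCommGroup F] [NormedSpace ℝ F]
    [NormedAddCommGroup F'] [NormedSpace ℝ F'] (L : ℝ →L[ℝ] F →L[ℝ] F')
    (g : Euc d → F) (_ : ContDiff ℝ ∞ g) (_ : HasCompactSupport g) (x : Euc d),
    ‖iteratedFDeriv ℝ n ((f : Euc d → ℝ) ⋆[L, volume] g) x‖ ≤
      ‖L‖ * ‖f‖ * ∫ z, ‖iteratedFDeriv ℝ n g z‖ := by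
  induction n with
  | zero =>
    intro F F' _ _ _ _ L g hg hc x
    simp only [norm_iteratedFDeriv_zero]
    rw [convolution]
    have hi : Integrable g := hg.continuous.integrable_of_hasCompactSupport hc
    have hi2 : Integrable (fun t => ‖g (x - t)‖) := (hi.comp_sub_left x).norm
    calc ‖∫ t, L (f t) (g (x - t))‖ ≤ ∫ t, ‖L (f t) (g (x - t))‖ := norm_integral_le_integral_norm _
      _ ≤ ∫ t, (‖L‖ * ‖f‖) * ‖g (x - t)‖ := by
          refine integral_mono_of_nonneg (Filter.Eventually.of_forall fun t => norm_nonneg _)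
            (hi2.const_mul _) (Filter.Eventually.of_forall fun t => ?_)
          refine (L.le_opNorm₂ _ _).trans ?_
          have := f.norm_coe_le_norm t
          exact mul_le_mul_of_nonneg_right (mul_le_mul_of_nonneg_left this (ContinuousLinearMap.opNorm_nonneg L)) (norm_nonneg _)
      _ = _ := by
          rw [integral_const_mul]
          congr 1
          exact integral_sub_left_eq_self (fun t => ‖g t‖) volume x
  | succ n ih =>
    intro F F' _ _ _ _ L g hg hc x
    rw [← norm_iteratedFDeriv_fderiv]
    have hloc : LocallyIntegrable (f : Euc d → ℝ) volume := f.continuous.locallyIntegrable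
    have h1 : fderiv ℝ ((f : Euc d → ℝ) ⋆[L, volume] g) =
        ((f : Euc d → ℝ) ⋆[L.precompR (Euc d), volume] fderiv ℝ g) := by
      ext1 y
      exact (hc.hasFDerivAt_convolution_right L hloc (hg.of_le (by exact_mod_cast le_top)) y).fderiv
    rw [h1]
    refine (ih _ _ (L.precompR (Euc d)) (fderiv ℝ g) (hg.fderiv_right (by simp)) (hc.fderiv ℝ) x).trans ?_
    simp only [norm_iteratedFDeriv_fderiv]
    have := ContinuousLinearMap.norm_precompR_le (Euc d) L
    have h2 : 0 ≤ ∫ z, ‖iteratedFDeriv ℝ (n+1) g z‖ := integral_nonneg fun _ => norm_nonneg _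
    gcongr

/-- smooth at scale r -/
def SmN (n : ℕ) (a r : ℝ) (u : Euc d → ℝ) : Prop :=
  ContDiff ℝ n u ∧ ∀ k ≤ n, ∀ x, ‖iteratedFDeriv ℝ k u x‖ ≤ a / r ^ k

lemma SmN.mono {n m : ℕ} {a b r : ℝ} {u : Euc d → ℝ} (h : SmN n a r u) (hm : m ≤ n) (hab : a ≤ b)
    (hr : 0 < r) : SmN m b r u :=
  ⟨h.1.of_le (by exact_mod_cast hm), fun k hk x => (h.2 k (hk.trans hm) x).trans (by gcongr)⟩

variable [NeZero d]

lemma J_eq_convolution {r : ℝ} (hr : 0 < r) (f : XX d) (x : Euc d) :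
    J r f x = ((f.compContinuous ⟨fun y : Euc d => r • y, by fun_prop⟩ : XX d) ⋆[ContinuousLinearMap.lsmul ℝ ℝ, volume] (eta : Euc d → ℝ)) (r⁻¹ • x) := by
  rw [J_apply, etaM_integral, convolution]
  symm
  rw [← integral_add_left_eq_self (μ := (volume : Measure (Euc d))) _ (r⁻¹ • x)]
  congr 1; ext z
  have h1 : r • r⁻¹ • x = x := by rw [smul_smul, mul_inv_cancel₀ hr.ne', one_smul]
  have h2 : (r⁻¹ • x - (r⁻¹ • x + z)) = - z := by abel
  simp only [BoundedContinuousFunction.compContinuous_apply, ContinuousMap.coe_mk, h2, eta_neg,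
    smul_add, h1, ContinuousLinearMap.lsmul_apply, smul_eq_mul]
  ring

lemma exists_J_smooth (d : ℕ) [NeZero d] : ∃ C : ℝ, 1 ≤ C ∧ ∀ r : ℝ, 0 < r → ∀ f : XX d, SmN 3 (C * ‖f‖) r (J r f) := by
  let c : ℕ → ℝ := fun k => ∫ z : Euc d, ‖iteratedFDeriv ℝ k (eta : Euc d → ℝ) z‖
  have hc : ∀ k, 0 ≤ c k := fun k => integral_nonneg fun _ => norm_nonneg _
  refine ⟨1 + c 0 + c 1 + c 2 + c 3, by linarith [hc 0, hc 1, hc 2, hc 3], fun r hr f => ?_⟩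
  set f' : XX d := f.compContinuous ⟨fun y : Euc d => r • y, by fun_prop⟩ with hf'
  have hf'n : ‖f'‖ ≤ ‖f‖ := f.norm_compContinuous_le _
  set w : Euc d → ℝ := (f' : Euc d → ℝ) ⋆[ContinuousLinearMap.lsmul ℝ ℝ, volume] (eta : Euc d → ℝ) with hw
  have hwc : ContDiff ℝ ∞ w :=
    eta_compact.contDiff_convolution_right (n := ⊤) _ f'.continuous.locallyIntegrable eta_contDiff
  have hJ : (J r f : Euc d → ℝ) = w ∘ (r⁻¹ • ContinuousLinearMap.id ℝ (Euc d)) := by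
    ext x; rw [J_eq_convolution hr]; rfl
  rw [hJ]
  refine ⟨(hwc.comp (ContinuousLinearMap.contDiff _)).of_le (WithTop.coe_le_coe.2 le_top), fun k hk x => ?_⟩
  rw [ContinuousLinearMap.iteratedFDeriv_comp_right _ hwc _ (by exact_mod_cast le_top)]
  refine (ContinuousMultilinearMap.norm_compContinuousLinearMap_le _ _).trans ?_
  have h1 := conv_iter_bound f' k ℝ ℝ (ContinuousLinearMap.lsmul ℝ ℝ) eta eta_contDiff eta_compact
    ((r⁻¹ • ContinuousLinearMap.id ℝ (Euc d)) x)
  have h2 : ‖(ContinuousLinearMap.lsmul ℝ ℝ : ℝ →L[ℝ] ℝ →L[ℝ] ℝ)‖ ≤ 1 := ContinuousLinearMap.opNorm_lsmul_le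
  have h3 : ‖r⁻¹ • ContinuousLinearMap.id ℝ (Euc d)‖ ≤ r⁻¹ := by
    rw [norm_smul, Real.norm_of_nonneg (by positivity)]
    have := ContinuousLinearMap.norm_id_le (𝕜 := ℝ) (E := Euc d)
    have : 0 < r⁻¹ := by positivity
    nlinarith
  have h4 : c k ≤ 1 + c 0 + c 1 + c 2 + c 3 := by
    have := hc 0; have := hc 1; have := hc 2; have := hc 3
    interval_cases k <;> linarith
  simp only [Finset.prod_const, Finset.card_univ, Fintype.card_fin]
  calc _ ≤ (1 * ‖f‖ * c k) * (r⁻¹)^k := by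
        gcongr
        refine h1.trans ?_
        gcongr
    _ ≤ (1 * ‖f‖ * (1 + c 0 + c 1 + c 2 + c 3)) * (r⁻¹)^k := by gcongr
    _ = _ := by rw [inv_pow]; field_simp

end smoothing

/-! ## Part 3 -/
open scoped BoundedContinuousFunction ContDiff
set_option linter.unusedSectionVars false

section blocks
variable {d : ℕ}

lemma SmN.add {n : ℕ} {a b r : ℝ} {u v : Euc d → ℝ} (hu : SmN n a r u) (hv : SmN n b r v) :
    SmN n (a + b) r (fun x => u x + v x) := by
  refine ⟨hu.1.add hv.1, fun k hk x => ?_⟩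
  have : iteratedFDeriv ℝ k (fun x => u x + v x) x = _ :=
    iteratedFDeriv_add_apply (i := k) ((hu.1.of_le (by exact_mod_cast hk)).contDiffAt)
      ((hv.1.of_le (by exact_mod_cast hk)).contDiffAt)
  rw [this, add_div]
  exact (norm_add_le _ _).trans (add_le_add (hu.2 k hk x) (hv.2 k hk x))

lemma SmN.const_mul {n : ℕ} {a r : ℝ} {u : Euc d → ℝ} (hu : SmN n a r u) (c : ℝ) :
    SmN n (|c| * a) r (fun x => c * u x) := by
  refine ⟨contDiff_const.mul hu.1, fun k hk x => ?_⟩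
  have : iteratedFDeriv ℝ k (fun x => c • u x) x = _ :=
    iteratedFDeriv_const_smul_apply (i := k) (a := c) ((hu.1.of_le (by exact_mod_cast hk)).contDiffAt)
  simp only [smul_eq_mul] at this
  rw [this, norm_smul, mul_div_assoc]
  exact mul_le_mul_of_nonneg_left (hu.2 k hk x) (abs_nonneg _)

lemma SmN.mono_r {n : ℕ} {a r r' : ℝ} {u : Euc d → ℝ} (hu : SmN n a r' u) (hr : 0 < r) (h : r ≤ r')
    (ha : 0 ≤ a) : SmN n a r u :=
  ⟨hu.1, fun k hk x => (hu.2 k hk x).trans (by gcongr)⟩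

lemma SmN.diff {n : ℕ} {a r : ℝ} {u : Euc d → ℝ} (hr : 0 < r) (hu : SmN (n+1) a r u) (h : Euc d) :
    SmN n (a * ‖h‖ / r) r (fun x => u (x + h) - u x) := by
  have hc : ContDiff ℝ n u := hu.1.of_le (by exact_mod_cast Nat.le_succ n)
  have hc' : ContDiff ℝ n (fun x => u (x + h)) := hc.comp (by fun_prop)
  refine ⟨hc'.sub hc, fun k hk x => ?_⟩
  have : iteratedFDeriv ℝ k (fun x => u (x + h) - u x) x = _ :=
    iteratedFDeriv_sub_apply (i := k) ((hc'.of_le (by exact_mod_cast hk)).contDiffAt)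
      ((hc.of_le (by exact_mod_cast hk)).contDiffAt)
  rw [this, iteratedFDeriv_comp_add_right]
  have hd : Differentiable ℝ (iteratedFDeriv ℝ k u) :=
    hu.1.differentiable_iteratedFDeriv (by exact_mod_cast Nat.lt_succ_of_le hk)
  have := Convex.norm_image_sub_le_of_norm_fderiv_le (𝕜 := ℝ) (f := iteratedFDeriv ℝ k u)
    (s := univ) (C := a / r^(k+1)) (fun y _ => hd y) (fun y _ => by
      rw [norm_fderiv_iteratedFDeriv]; exact hu.2 (k+1) (by omega) y) convex_univ (mem_univ x) (mem_univ (x+h))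
  refine this.trans (le_of_eq ?_)
  rw [add_sub_cancel_left, pow_succ]
  field_simp

/-- block predicate -/
def Blk (μ a r : ℝ) (u : Euc d → ℝ) (g : Euc d → Euc d →L[ℝ] ℝ) : Prop :=
  (∀ x z, |u (x + z) - u x| ≤ a * (‖z‖ / r) ^ μ) ∧ (∀ x, ‖g x‖ ≤ a / r) ∧
  ∀ x p q, |u (x + p) - u (x + q) - g x (p - q)| ≤ a / r ^ 2 * (‖p‖ + ‖q‖) * ‖p - q‖

lemma SmN.lip {n : ℕ} {a r : ℝ} {u : Euc d → ℝ} (hu : SmN (n+1) a r u) (x y : Euc d) :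
    |u x - u y| ≤ a / r * ‖x - y‖ := by
  refine Convex.norm_image_sub_le_of_norm_fderiv_le (𝕜 := ℝ) (f := u)
    (s := univ) (C := a / r) (fun y _ => (hu.1.differentiable (by simp)) y) (fun y _ => ?_) convex_univ (mem_univ y) (mem_univ x)
  have := hu.2 1 (by omega) y
  rwa [← norm_iteratedFDeriv_fderiv, norm_iteratedFDeriv_zero, pow_one] at this

lemma SmN.abs_le {n : ℕ} {a r : ℝ} {u : Euc d → ℝ} (hu : SmN n a r u) (x : Euc d) : |u x| ≤ a := by
  have := hu.2 0 (by omega) x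
  rwa [norm_iteratedFDeriv_zero, pow_zero, div_one] at this

lemma SmN.taylor2 {a r : ℝ} {u : Euc d → ℝ} (hr : 0 < r) (hu : SmN 2 a r u) (x p q : Euc d) :
    |u (x + p) - u (x + q) - fderiv ℝ u x (p - q)| ≤ a / r ^ 2 * (‖p‖ + ‖q‖) * ‖p - q‖ := by
  have ha : 0 ≤ a := (abs_nonneg _).trans (hu.abs_le 0)
  have hd : Differentiable ℝ u := hu.1.differentiable (by simp)
  have hfd : ∀ y z, ‖fderiv ℝ u y - fderiv ℝ u z‖ ≤ a / r^2 * ‖y - z‖ := by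
    intro y z
    have hdd : Differentiable ℝ (fderiv ℝ u) :=
      (hu.1.fderiv_right (m := 1) (by norm_cast)).differentiable (by simp)
    refine Convex.norm_image_sub_le_of_norm_fderiv_le (𝕜 := ℝ) (f := fderiv ℝ u)
      (s := univ) (C := a / r^2) (fun y _ => hdd y) (fun y _ => ?_) convex_univ (mem_univ z) (mem_univ y)
    have := hu.2 2 le_rfl y
    rwa [← norm_iteratedFDeriv_fderiv, ← norm_iteratedFDeriv_fderiv, norm_iteratedFDeriv_zero] at this
  have := Convex.norm_image_sub_le_of_norm_fderiv_le' (𝕜 := ℝ) (f := u) (φ := fderiv ℝ u x)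
    (s := Metric.closedBall x (‖p‖ + ‖q‖)) (C := a / r^2 * (‖p‖ + ‖q‖)) (x := x + q) (y := x + p)
    (fun y _ => hd y) (fun y hy => ?_) (convex_closedBall _ _) ?_ ?_
  · have e : x + p - (x + q) = p - q := by abel
    rw [e] at this
    exact this
  · refine (hfd y x).trans ?_
    rw [mem_closedBall_iff_norm] at hy
    gcongr
  · rw [mem_closedBall_iff_norm]; simp
  · rw [mem_closedBall_iff_norm]; simp

lemma SmN.blk {μ a r : ℝ} {u : Euc d → ℝ} (hμ : μ ∈ Ioo (0:ℝ) 1) (hr : 0 < r) (hu : SmN 2 a r u) :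
    Blk μ (2 * a) r u (fderiv ℝ u) := by
  have ha : 0 ≤ a := (abs_nonneg _).trans (hu.abs_le 0)
  refine ⟨fun x z => ?_, fun x => ?_, fun x p q => (hu.taylor2 hr x p q).trans ?_⟩
  · have h1 := hu.lip (x + z) x
    rw [add_sub_cancel_left] at h1
    have h2 : |u (x + z) - u x| ≤ 2 * a := by
      have := hu.abs_le (x + z); have := hu.abs_le x
      calc _ ≤ |u (x+z)| + |u x| := abs_sub _ _
        _ ≤ _ := by linarith
    have h3 : a / r * ‖z‖ = a * (‖z‖ / r) := by ring
    rw [h3] at h1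
    have h0 : 0 ≤ ‖z‖ / r := by positivity
    rcases le_total (‖z‖ / r) 1 with h | h
    · have : (‖z‖ / r) ≤ (‖z‖ / r) ^ μ := by
        simpa using Real.rpow_le_rpow_of_exponent_ge_of_imp h0 h hμ.2.le (by intro _; norm_num)
      nlinarith [Real.rpow_nonneg h0 μ]
    · have : 1 ≤ (‖z‖ / r) ^ μ := Real.one_le_rpow h hμ.1.le
      nlinarith
  · have := hu.2 1 (by omega) x
    rw [← norm_iteratedFDeriv_fderiv, norm_iteratedFDeriv_zero, pow_one] at this
    exact this.trans (by gcongr; linarith)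
  · gcongr; linarith

/-! dyadic sum -/
def rj (j : ℕ) : ℝ := (2⁻¹ : ℝ) ^ j
lemma rj_pos (j : ℕ) : 0 < rj j := by unfold rj; positivity
lemma rj_le_one (j : ℕ) : rj j ≤ 1 := pow_le_one₀ (by norm_num) (by norm_num)
lemma rj_succ (j : ℕ) : rj (j+1) = rj j / 2 := by unfold rj; rw [pow_succ]; ring
lemma rj_add (i j : ℕ) : rj (i+j) = rj i * rj j := by unfold rj; rw [pow_add]
lemma rj_zero : rj 0 = 1 := by simp [rj]
lemma rj_rpow (j : ℕ) (s : ℝ) : rj j ^ s = ((2⁻¹:ℝ)^s)^j := by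
  unfold rj
  rw [← Real.rpow_natCast, ← Real.rpow_mul (by norm_num), mul_comm, Real.rpow_mul (by norm_num), Real.rpow_natCast]

lemma geom_two_sided {q D : ℝ} (hq : 0 ≤ q) (hq1 : q < 1) (hD : 0 ≤ D) {f : ℕ → ℝ} (hf : ∀ j, 0 ≤ f j) (J : ℕ)
    (h1 : ∀ j < J, f j ≤ D * q ^ (J - j)) (h2 : ∀ i, f (J + i) ≤ D * q ^ i) (n : ℕ) :
    ∑ j ∈ Finset.range n, f j ≤ 2 * D / (1 - q) := by
  have hg : ∀ m, ∑ i ∈ Finset.range m, q ^ i ≤ 1 / (1 - q) := fun m => by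
    rw [← tsum_geometric_of_lt_one hq hq1 |>.trans (one_div _).symm]
    exact (summable_geometric_of_lt_one hq hq1).sum_le_tsum _ (fun i _ => by positivity)
  have hle : ∑ j ∈ Finset.range n, f j ≤ ∑ j ∈ Finset.range (J + n), f j :=
    Finset.sum_le_sum_of_subset_of_nonneg (Finset.range_mono (by omega)) (fun _ _ _ => hf _)
  refine hle.trans ?_
  rw [Finset.sum_range_add]
  have e1 : ∑ j ∈ Finset.range J, f j ≤ D * (1 / (1 - q)) := by
    calc _ ≤ ∑ j ∈ Finset.range J, D * q ^ (J - 1 - j) := by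
          refine Finset.sum_le_sum fun j hj => ?_
          have hj' := Finset.mem_range.1 hj
          refine (h1 j hj').trans ?_
          gcongr D * ?_
          exact pow_le_pow_of_le_one hq hq1.le (by omega)
      _ = D * ∑ j ∈ Finset.range J, q ^ j := by
          rw [← Finset.mul_sum, Finset.sum_range_reflect]
      _ ≤ _ := by gcongr; exact hg J
  have e2 : ∑ i ∈ Finset.range n, f (J + i) ≤ D * (1 / (1 - q)) := by
    calc _ ≤ ∑ i ∈ Finset.range n, D * q ^ i := Finset.sum_le_sum fun i _ => h2 i
      _ = D * ∑ j ∈ Finset.range n, q ^ j := by rw [← Finset.mul_sum]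
      _ ≤ _ := by gcongr; exact hg n
  have : 2 * D / (1 - q) = D * (1 / (1 - q)) + D * (1 / (1 - q)) := by ring
  linarith

lemma dyadic_sum {s : ℝ} (hs : s ∈ Ioo (0:ℝ) 1) : ∃ C : ℝ, 0 < C ∧ ∀ t : ℝ, 0 < t → ∀ n : ℕ,
    ∑ j ∈ Finset.range n, min (rj j ^ s) (t * rj j ^ (s - 1)) ≤ C * t ^ s := by
  obtain ⟨hs0, hs1⟩ := hs
  set q : ℝ := max ((2⁻¹:ℝ)^s) ((2⁻¹:ℝ)^(1-s)) with hq
  have hq0 : 0 ≤ q := le_max_of_le_left (by positivity)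
  have hq1 : q < 1 := max_lt (Real.rpow_lt_one (by norm_num) (by norm_num) hs0)
    (Real.rpow_lt_one (by norm_num) (by norm_num) (by linarith))
  refine ⟨2 * 2 / (1 - q), by have : 0 < 1 - q := by linarith
                              positivity, fun t ht n => ?_⟩
  have hex : ∃ J, rj J ≤ t := by
    obtain ⟨J, hJ⟩ := exists_pow_lt_of_lt_one ht (by norm_num : (2⁻¹:ℝ) < 1)
    exact ⟨J, hJ.le⟩
  classical
  set J := Nat.find hex with hJ
  have hJt : rj J ≤ t := Nat.find_spec hex
  have hts : 0 < t ^ s := by positivity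
  have := geom_two_sided hq0 hq1 (D := 2 * t^s) (by positivity)
    (f := fun j => min (rj j ^ s) (t * rj j ^ (s - 1))) (fun j => by
      have := rj_pos j; positivity) J ?_ ?_ n
  · refine this.trans (le_of_eq (by ring))
  · intro j hj
    have hp : t < 2 * rj J := by
      have h1 : J - 1 < J := by omega
      have h2 := Nat.find_min hex h1
      have h3 : rj J = rj (J-1) / 2 := by rw [← rj_succ]; congr 1; omega
      rw [h3]; push Not at h2; linarith
    refine (min_le_right _ _).trans ?_
    have e : rj J = rj j * rj (J - j) := by rw [← rj_add]; congr 1; omega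
    have e2 : rj j ^ (s-1) = rj J ^ (s-1) * rj (J-j) ^ (1-s) := by
      rw [e, Real.mul_rpow (rj_pos _).le (rj_pos _).le, mul_assoc, ← Real.rpow_add (rj_pos _)]
      simp
    have e3 : rj J ^ (s-1) ≤ (t/2)^(s-1) :=
      Real.rpow_le_rpow_of_nonpos (by positivity) (by linarith) (by linarith)
    have e4 : t * (t/2)^(s-1) ≤ 2 * t^s := by
      rw [Real.div_rpow ht.le (by norm_num), Real.rpow_sub_one ht.ne', Real.rpow_sub_one (by norm_num)]
      have : (1:ℝ) ≤ 2 ^ s := Real.one_le_rpow (by norm_num) hs0.le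
      have h5 : t * (t^s / t / (2^s/2)) = 2 * t^s / 2^s := by field_simp
      rw [h5]
      exact div_le_self (by positivity) this
    have e5 : rj (J-j) ^ (1-s) ≤ q ^ (J-j) := by
      rw [rj_rpow]; gcongr; exact le_max_right _ _
    rw [e2]
    calc t * (rj J ^ (s-1) * rj (J-j) ^ (1-s)) = (t * rj J ^ (s-1)) * rj (J-j) ^ (1-s) := by ring
      _ ≤ (t * (t/2)^(s-1)) * q ^ (J-j) := by
          have := rj_pos (J - j); gcongr
      _ ≤ _ := by gcongr
  · intro i
    refine (min_le_left _ _).trans ?_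
    rw [rj_add, Real.mul_rpow (rj_pos _).le (rj_pos _).le, rj_rpow i]
    have : rj J ^ s ≤ t ^ s := by have := rj_pos J; gcongr
    calc _ ≤ t ^ s * q ^ i := by gcongr; exact le_max_left _ _
      _ ≤ _ := by have : 0 ≤ q ^ i := by positivity
                  nlinarith
end blocks

/-! ## Part 4 -/
open scoped BoundedContinuousFunction ContDiff
set_option linter.unusedSectionVars false

section zyg
variable {d : ℕ}

def D3 (h : Euc d) : XX d →L[ℝ] XX d := (tr h - 1) ^ 3

lemma D3_apply (h : Euc d) (w : XX d) (x : Euc d) :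
    D3 h w x = w (x + (3:ℝ) • h) - 3 * w (x + (2:ℝ) • h) + 3 * w (x + h) - w x := by
  have e3 : x + (3:ℝ) • h = x + h + h + h := by module
  have e2 : x + (2:ℝ) • h = x + h + h := by module
  rw [e3, e2]
  have e1 : ∀ (u : XX d) y, (tr h - 1) u y = u (y + h) - u y := fun u y => rfl
  have e : D3 h w x = (tr h - 1) ((tr h - 1) ((tr h - 1) w)) x := rfl
  rw [e]
  simp only [e1]
  ring

lemma D3_norm_le (h : Euc d) (w : XX d) : ‖D3 h w‖ ≤ 8 * ‖w‖ := by
  refine XX.norm_le_of fun x => ?_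
  rw [D3_apply]
  have h1 := abs_le.1 (w.abs_le (x + (3:ℝ) • h))
  have h2 := abs_le.1 (w.abs_le (x + (2:ℝ) • h))
  have h3 := abs_le.1 (w.abs_le (x + h))
  have h4 := abs_le.1 (w.abs_le x)
  rw [abs_le]; constructor <;> linarith

/-- truncated Zygmund class -/
def Zyg (β ϱ M : ℝ) (w : XX d) : Prop := ‖w‖ ≤ M ∧ ∀ h : Euc d, ϱ ≤ ‖h‖ → ‖D3 h w‖ ≤ M * ‖h‖ ^ β

lemma Zyg.nonneg {β ϱ M : ℝ} {w : XX d} (h : Zyg β ϱ M w) : 0 ≤ M := (norm_nonneg _).trans h.1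

variable [NeZero d]

def TT (r : ℝ) : XX d →L[ℝ] XX d := (3:ℝ) • J r - (3:ℝ) • J (2*r) + J (3*r)

lemma TT_norm_le (r : ℝ) (w : XX d) : ‖TT r w‖ ≤ 7 * ‖w‖ := by
  have e : TT r w = (3:ℝ) • J r w - (3:ℝ) • J (2*r) w + J (3*r) w := rfl
  rw [e]
  refine (norm_add_le _ _).trans ?_
  have := norm_sub_le ((3:ℝ) • J r w) ((3:ℝ) • J (2*r) w)
  rw [norm_smul, norm_smul] at this
  have h1 := J_norm_apply_le r w
  have h2 := J_norm_apply_le (2*r) w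
  have h3 := J_norm_apply_le (3*r) w
  norm_num at this
  linarith

lemma J_comm (r s : ℝ) : Commute (J r : XX d →L[ℝ] XX d) (J s) := conv_comm _ _

lemma TT_comm (r s : ℝ) : Commute (TT r : XX d →L[ℝ] XX d) (TT s) := by
  have h0 : ∀ a b, ∀ w : XX d, J a (J b w) = J b (J a w) := fun a b w =>
    congrArg (fun T : XX d →L[ℝ] XX d => T w) (J_comm a b).eq
  have e : ∀ r, ∀ w : XX d, TT r w = (3:ℝ) • J r w - (3:ℝ) • J (2*r) w + J (3*r) w := fun _ _ => rfl
  refine ContinuousLinearMap.ext fun w => ?_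
  change TT r (TT s w) = TT s (TT r w)
  simp only [e, map_add, map_sub, map_smul, h0 _ s, h0 _ (2*s), h0 _ (3*s)]
  module

lemma TT_sub_apply (r : ℝ) (w : XX d) (x : Euc d) : TT r w x - w x = ∫ z, D3 (r • z) w x ∂(etaM d) := by
  have e : TT r w x = 3 * J r w x - 3 * J (2*r) w x + J (3*r) w x := rfl
  rw [e]
  simp only [D3_apply, smul_smul, J_apply]
  rw [integral_sub, integral_add, integral_sub, integral_const_mul, integral_const_mul]
  · simp; ring
  all_goals have i1 := J_int r w x
  all_goals have i2 := (J_int (2*r) w x).const_mul 3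
  all_goals have i3 := J_int (3*r) w x
  · exact i3
  · exact i2
  · exact i3.sub i2
  · exact i1.const_mul 3
  · exact (i3.sub i2).add (i1.const_mul 3)
  · exact integrable_const _

lemma TT_sub_norm {β ϱ M r : ℝ} {w : XX d} (hβ : 0 < β) (h : Zyg β ϱ M w) (hr : 0 < r) (hr2 : 2 * ϱ ≤ r) :
    ‖TT r w - w‖ ≤ M * r ^ β := by
  refine XX.norm_le_of fun x => ?_
  change |TT r w x - w x| ≤ _
  rw [TT_sub_apply]
  have hM := h.nonneg
  have key : ∀ᵐ z ∂(etaM d), ‖D3 (r • z) w x‖ ≤ M * r ^ β := ?_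
  · have := norm_integral_le_of_norm_le_const key
    rwa [probReal_univ, mul_one] at this
  filter_upwards [etaM_ae] with z hz
  have hn : ‖r • z‖ = r * ‖z‖ := by rw [norm_smul, Real.norm_of_nonneg hr.le]
  refine ((D3 (r • z) w).abs_le x).trans ((h.2 _ ?_).trans ?_)
  · rw [hn]; nlinarith
  · gcongr
    rw [hn]; nlinarith

def Qb : ℕ → XX d →L[ℝ] XX d
  | 0 => TT (rj 0) * TT (rj 0)
  | j+1 => (TT (rj (j+1)) + TT (rj j)) * (TT (rj (j+1)) - TT (rj j))

lemma sum_Qb (n : ℕ) : ∑ j ∈ Finset.range (n+1), (Qb j : XX d →L[ℝ] XX d) = TT (rj n) * TT (rj n) := by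
  induction n with
  | zero => simp [Qb]
  | succ n ih =>
    rw [Finset.sum_range_succ, ih, Qb]
    have h := (TT_comm (d := d) (rj n) (rj (n+1))).eq
    refine ContinuousLinearMap.ext fun w => ?_
    have h' : TT (rj n) (TT (rj (n+1)) w) = TT (rj (n+1)) (TT (rj n) w) := congrArg (fun T : XX d →L[ℝ] XX d => T w) h
    change TT (rj n) (TT (rj n) w) + (TT (rj (n+1)) (TT (rj (n+1)) w - TT (rj n) w) + TT (rj n) (TT (rj (n+1)) w - TT (rj n) w)) = TT (rj (n+1)) (TT (rj (n+1)) w)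
    rw [map_sub, map_sub, h']; abel

lemma exists_TT_smooth (d : ℕ) [NeZero d] : ∃ C : ℝ, 1 ≤ C ∧ ∀ r : ℝ, 0 < r → ∀ f : XX d,
    SmN 3 (C * ‖f‖) r (TT r f) := by
  obtain ⟨C, hC, h⟩ := exists_J_smooth d
  refine ⟨7 * C, by linarith, fun r hr f => ?_⟩
  have hf := norm_nonneg f
  have e : (TT r f : Euc d → ℝ) = fun x => (3 * J r f x + (-3) * J (2*r) f x) + J (3*r) f x := by
    ext x
    have e : TT r f x = 3 * J r f x - 3 * J (2*r) f x + J (3*r) f x := rfl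
    rw [e]; ring
  rw [e]
  refine (((h r hr f).const_mul 3).add (((h (2*r) (by positivity) f).mono_r hr (by linarith) (by positivity)).const_mul (-3)) |>.add ((h (3*r) (by positivity) f).mono_r hr (by linarith) (by positivity))).mono le_rfl ?_ hr
  norm_num
  apply le_of_eq; ring

lemma exists_blocks (d : ℕ) [NeZero d] : ∃ C : ℝ, 1 ≤ C ∧ ∀ β ϱ M : ℝ, β ∈ Ioo (0:ℝ) 3 → ∀ w : XX d,
    Zyg β ϱ M w → ∀ j, 2 * ϱ ≤ rj j →
      SmN 3 (C * min ‖w‖ (M * rj j ^ β)) (rj j) (Qb j w) ∧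
      ‖w - TT (rj j) (TT (rj j) w)‖ ≤ C * min ‖w‖ (M * rj j ^ β) ∧
      ‖Qb j w‖ ≤ C * min ‖w‖ (M * rj j ^ β) := by
  obtain ⟨C, hC, h⟩ := exists_TT_smooth d
  refine ⟨224 * C, by linarith, fun β ϱ M hβ w hw j hj => ?_⟩
  have hM := hw.nonneg
  have hw0 := norm_nonneg w
  have hT : ∀ i ≤ j, ‖TT (rj i) w - w‖ ≤ 8 * min ‖w‖ (M * rj i ^ β) := by
    intro i hi
    have hij : rj j ≤ rj i := pow_le_pow_of_le_one (by norm_num) (by norm_num) hi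
    rw [mul_min_of_nonneg _ _ (by norm_num), le_min_iff]
    have hp : 0 ≤ M * rj i ^ β := by have := rj_pos i; positivity
    constructor
    · have := norm_sub_le (TT (rj i) w) w
      have := TT_norm_le (rj i) w
      linarith
    · have := TT_sub_norm hβ.1 hw (rj_pos i) (hj.trans hij)
      linarith
  have hm0 : 0 ≤ min ‖w‖ (M * rj j ^ β) := by have := rj_pos j; positivity
  have hS : SmN 3 (224 * C * min ‖w‖ (M * rj j ^ β)) (rj j) (Qb j w) := by
    cases j with
    | zero =>
      have e : min ‖w‖ (M * rj 0 ^ β) = ‖w‖ := by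
        rw [rj_zero, Real.one_rpow, mul_one]; exact min_eq_left hw.1
      rw [e]
      refine (h _ (rj_pos 0) (TT (rj 0) w)).mono le_rfl ?_ (rj_pos 0)
      have := TT_norm_le (rj 0) w
      nlinarith
    | succ j =>
      set m := min ‖w‖ (M * rj (j+1) ^ β) with hm
      set g := TT (rj (j+1)) w - TT (rj j) w with hg
      have h2 : min ‖w‖ (M * rj j ^ β) ≤ 8 * m := by
        rw [hm, mul_min_of_nonneg _ _ (by norm_num)]
        refine min_le_min (by linarith) ?_
        have e : rj j = 2 * rj (j+1) := by rw [rj_succ]; ring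
        rw [e, Real.mul_rpow (by norm_num) (rj_pos _).le]
        have : (2:ℝ)^β ≤ 8 := by
          calc (2:ℝ)^β ≤ 2^(3:ℝ) := Real.rpow_le_rpow_of_exponent_le (by norm_num) hβ.2.le
            _ = 8 := by norm_num
        have hp : 0 ≤ M * rj (j+1) ^ β := by have := rj_pos (j+1); positivity
        nlinarith
      have hgn : ‖g‖ ≤ 112 * m := by
        have e : g = (TT (rj (j+1)) w - w) - (TT (rj j) w - w) := by rw [hg]; abel
        rw [e]
        refine (norm_sub_le _ _).trans ?_
        have := hT (j+1) le_rfl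
        have := hT j (by omega)
        linarith
      have e : (Qb (j+1) w : Euc d → ℝ) = fun x => TT (rj (j+1)) g x + TT (rj j) g x := rfl
      rw [e]
      refine ((h _ (rj_pos (j+1)) g).add ((h _ (rj_pos j) g).mono_r (rj_pos _) ?_ (by positivity))).mono le_rfl ?_ (rj_pos _)
      · rw [rj_succ]; have := rj_pos j; linarith
      · have := norm_nonneg g
        nlinarith
  refine ⟨hS, ?_, XX.norm_le_of hS.abs_le⟩
  have e : w - TT (rj j) (TT (rj j) w) = -((TT (rj j) w - w) + TT (rj j) (TT (rj j) w - w)) := by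
    rw [map_sub]; abel
  rw [e, norm_neg]
  refine (norm_add_le _ _).trans ?_
  have := TT_norm_le (rj j) (TT (rj j) w - w)
  have := hT j le_rfl
  nlinarith

lemma rj_tendsto (s : ℝ) (hs : 0 < s) : Filter.Tendsto (fun j => rj j ^ s) Filter.atTop (nhds 0) := by
  simp_rw [rj_rpow]
  exact tendsto_pow_atTop_nhds_zero_of_lt_one (by positivity) (Real.rpow_lt_one (by norm_num) (by norm_num) hs)

lemma rj_summable (s : ℝ) (hs : 0 < s) : Summable (fun j => rj j ^ s) := by
  simp_rw [rj_rpow]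
  exact summable_geometric_of_lt_one (by positivity) (Real.rpow_lt_one (by norm_num) (by norm_num) hs)

/-- Lemma Z -/
lemma zyg_holder (d : ℕ) [NeZero d] {β : ℝ} (hβ : β ∈ Ioo (0:ℝ) 3) (hn : ∀ n : ℤ, β ≠ n) :
    ∃ C : ℝ, 1 ≤ C ∧ ∀ M, ∀ w : XX d, Zyg β 0 M w →
      ContDiff ℝ (⌊β⌋₊ : ℕ∞) (w : Euc d → ℝ) ∧ hNorm d β w ≤ ENNReal.ofReal (C * M) := by
  obtain ⟨C, hC, hB⟩ := exists_blocks d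
  set n := ⌊β⌋₊ with hndef
  have hn1 : (n:ℝ) ≤ β := Nat.floor_le hβ.1.le
  have hn2 : β < n + 1 := Nat.lt_floor_add_one β
  have hn3 : (n:ℝ) < β := lt_of_le_of_ne hn1 (fun h => hn n (by exact_mod_cast h.symm))
  have hn4 : n + 1 ≤ 3 := by
    have : (n:ℝ) < 3 := hn1.trans_lt hβ.2
    have : n < 3 := by exact_mod_cast this
    omega
  obtain ⟨D, hD, hdy⟩ := dyadic_sum (s := β - n) ⟨by linarith, by linarith⟩
  set Sg : ℕ → ℝ := fun k => ∑' j, rj j ^ (β - k) with hSg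
  have hsum : ∀ k ≤ n, Summable (fun j => rj j ^ (β - k)) := fun k hk => rj_summable _ (by
    have : (k:ℝ) ≤ n := by exact_mod_cast hk
    linarith)
  have hSg0 : ∀ k, 0 ≤ Sg k := fun k => tsum_nonneg fun j => by have := rj_pos j; positivity
  refine ⟨1 + C * (∑ k ∈ Finset.range (n+1), Sg k) + 2 * C * D, ?_, fun M w hw => ?_⟩
  · have : 0 ≤ ∑ k ∈ Finset.range (n+1), Sg k := Finset.sum_nonneg fun k _ => hSg0 k
    have : 0 ≤ C * (∑ k ∈ Finset.range (n+1), Sg k) := by positivity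
    nlinarith
  have hM := hw.nonneg
  have hblk : ∀ j, SmN 3 (C * M * rj j ^ β) (rj j) (Qb j w) := fun j => by
    have := (hB β 0 M hβ w hw j (by have := rj_pos j; linarith)).1
    refine this.mono le_rfl ?_ (rj_pos j)
    rw [mul_assoc]; gcongr; exact min_le_right _ _
  have hrk : ∀ j (k:ℕ), C * M * rj j ^ β / rj j ^ k = C * M * rj j ^ (β - k) := fun j k => by
    rw [Real.rpow_sub (rj_pos j), Real.rpow_natCast, mul_div_assoc]
  have hbd : ∀ k ≤ 3, ∀ j x, ‖iteratedFDeriv ℝ k (Qb j w) x‖ ≤ C * M * rj j ^ (β - k) := fun k hk j x => by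
    rw [← hrk]; exact (hblk j).2 k hk x
  have hw_eq : (w : Euc d → ℝ) = fun x => ∑' j, Qb j w x := by
    ext x
    symm
    apply HasSum.tsum_eq
    have hs : Summable (fun j => Qb j w x) := by
      refine Summable.of_norm_bounded ((rj_summable β hβ.1).mul_left (C*M)) fun j => ?_
      exact (hblk j).abs_le x
    rw [hs.hasSum_iff_tendsto_nat]
    rw [← Filter.tendsto_add_atTop_iff_nat 1]
    have e : ∀ m, ∑ j ∈ Finset.range (m+1), Qb j w x = TT (rj m) (TT (rj m) w) x := fun m => by
      have := congrArg (fun T : XX d →L[ℝ] XX d => T w x) (sum_Qb (d := d) m)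
      simpa [_root_.sum_apply] using this
    simp_rw [e]
    rw [tendsto_iff_norm_sub_tendsto_zero]
    refine squeeze_zero (fun _ => norm_nonneg _) (g := fun j => C * M * rj j ^ β) (fun j => ?_) ?_
    · have := (hB β 0 M hβ w hw j (by have := rj_pos j; linarith)).2.1
      rw [norm_sub_rev]
      refine ((w - TT (rj j) (TT (rj j) w)).abs_le x).trans (this.trans ?_)
      rw [mul_assoc]; gcongr; exact min_le_right _ _
    · simpa using (rj_tendsto β hβ.1).const_mul (C*M)
  have hcd : ∀ j, ContDiff ℝ ((n:ℕ∞)) (Qb j w : Euc d → ℝ) := fun j => (hblk j).1.of_le (by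
    have : n ≤ 3 := by omega
    exact WithTop.coe_le_coe.2 (by exact_mod_cast this))
  have hsv : ∀ k : ℕ, (k : ℕ∞) ≤ (n : ℕ∞) → Summable (fun j => C * M * rj j ^ (β - k)) := fun k hk =>
    (hsum k (by exact_mod_cast hk)).mul_left _
  have hb' : ∀ (k : ℕ) (j : ℕ) (x : Euc d), (k : ℕ∞) ≤ (n:ℕ∞) → ‖iteratedFDeriv ℝ k (Qb j w) x‖ ≤ C * M * rj j ^ (β - k) :=
    fun k j x hk => hbd k (by have : k ≤ n := by exact_mod_cast hk
                              omega) j x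
  have hit : ∀ k ≤ n, ∀ x, iteratedFDeriv ℝ k (w : Euc d → ℝ) x = ∑' j, iteratedFDeriv ℝ k (Qb j w) x := by
    intro k hk x
    rw [hw_eq]
    exact iteratedFDeriv_tsum_apply (fun j => hcd j) hsv hb' (by exact_mod_cast hk) x
  refine ⟨by rw [hw_eq]; exact contDiff_tsum hcd hsv hb', ?_⟩
  have hs1 : ∀ k ≤ n, ∀ x, Summable (fun j => ‖iteratedFDeriv ℝ k (Qb j w) x‖) := fun k hk x =>
    Summable.of_nonneg_of_le (fun _ => norm_nonneg _) (fun j => hbd k (by omega) j x) ((hsum k hk).mul_left _)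
  have hder : ∀ k ≤ n, ∀ x, ‖iteratedFDeriv ℝ k (w : Euc d → ℝ) x‖ ≤ C * M * Sg k := fun k hk x => by
    rw [hit k hk x]
    refine (norm_tsum_le_tsum_norm (hs1 k hk x)).trans ?_
    rw [hSg, ← tsum_mul_left]
    exact (hs1 k hk x).tsum_le_tsum (fun j => hbd k (by omega) j x) ((hsum k hk).mul_left _)
  have hhol : ∀ x y, ‖iteratedFDeriv ℝ n (w : Euc d → ℝ) x - iteratedFDeriv ℝ n (w : Euc d → ℝ) y‖ ≤ 2 * C * D * M * ‖x - y‖ ^ (β - n) := by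
    intro x y
    rcases eq_or_ne x y with rfl | hxy
    · have : 0 < β - n := by linarith
      simp [Real.zero_rpow this.ne']
    have ht : 0 < ‖x - y‖ := norm_pos_iff.2 (sub_ne_zero.2 hxy)
    rw [hit n le_rfl, hit n le_rfl, ← ((hs1 n le_rfl x).of_norm).tsum_sub ((hs1 n le_rfl y).of_norm)]
    have hle : ∀ j, ‖iteratedFDeriv ℝ n (Qb j w) x - iteratedFDeriv ℝ n (Qb j w) y‖ ≤ 2 * C * M * min (rj j ^ (β - n)) (‖x-y‖ * rj j ^ (β - n - 1)) := by
      intro j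
      have hp := rj_pos j
      rw [mul_min_of_nonneg _ _ (by positivity), le_min_iff]
      constructor
      · refine (norm_sub_le _ _).trans ?_
        have := hbd n (by omega) j x
        have := hbd n (by omega) j y
        linarith
      · have hd : Differentiable ℝ (iteratedFDeriv ℝ n (Qb j w)) :=
          (hblk j).1.differentiable_iteratedFDeriv (by exact_mod_cast hn4)
        have := Convex.norm_image_sub_le_of_norm_fderiv_le (𝕜 := ℝ) (f := iteratedFDeriv ℝ n (Qb j w))
          (s := univ) (C := C * M * rj j ^ (β - ((n+1:ℕ):ℝ))) (fun y _ => hd y) (fun y _ => by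
            rw [norm_fderiv_iteratedFDeriv]; exact hbd (n+1) hn4 j y) convex_univ (mem_univ y) (mem_univ x)
        refine this.trans ?_
        push_cast
        rw [← sub_sub]
        have : 0 ≤ C * M * rj j ^ (β - n - 1) * ‖x - y‖ := by positivity
        linarith
    have hsm : Summable (fun j => ‖iteratedFDeriv ℝ n (Qb j w) x - iteratedFDeriv ℝ n (Qb j w) y‖) :=
      Summable.of_nonneg_of_le (fun _ => norm_nonneg _) (fun j => norm_sub_le _ _) ((hs1 n le_rfl x).add (hs1 n le_rfl y))
    refine (norm_tsum_le_tsum_norm hsm).trans ?_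
    refine hsm.tsum_le_of_sum_range_le fun m => ?_
    calc _ ≤ ∑ j ∈ Finset.range m, 2 * C * M * min (rj j ^ (β - n)) (‖x-y‖ * rj j ^ (β - n - 1)) := Finset.sum_le_sum fun j _ => hle j
      _ = 2 * C * M * ∑ j ∈ Finset.range m, min (rj j ^ (β - n)) (‖x-y‖ * rj j ^ (β - n - 1)) := by rw [Finset.mul_sum]
      _ ≤ 2 * C * M * (D * ‖x - y‖ ^ (β - n)) := by gcongr; exact hdy _ ht m
      _ = _ := by ring
  unfold hNorm
  have hSn : 0 ≤ ∑ k ∈ Finset.range (n+1), Sg k := Finset.sum_nonneg fun k _ => hSg0 k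
  calc _ ≤ (∑ k ∈ Finset.range (n+1), ENNReal.ofReal (C * M * Sg k)) + ENNReal.ofReal (2 * C * D * M) := by
        refine add_le_add (Finset.sum_le_sum fun k hk => iSup_le fun x => ?_) (iSup_le fun x => iSup_le fun y => ?_)
        · have := hder k (by have := Finset.mem_range.1 hk; omega) x
          rw [← enorm_eq_nnnorm, ← ofReal_norm]
          exact ENNReal.ofReal_le_ofReal this
        · rcases eq_or_ne x y with rfl | hxy
          · simp
          have ht : 0 < ‖x - y‖ := norm_pos_iff.2 (sub_ne_zero.2 hxy)
          refine ENNReal.div_le_of_le_mul ?_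
          rw [← enorm_eq_nnnorm, ← enorm_eq_nnnorm, ← ofReal_norm, ← ofReal_norm, ENNReal.ofReal_rpow_of_pos ht, ← ENNReal.ofReal_mul (by positivity)]
          exact ENNReal.ofReal_le_ofReal (hhol x y)
    _ = ENNReal.ofReal (C * M * (∑ k ∈ Finset.range (n+1), Sg k) + 2 * C * D * M) := by
        rw [← ENNReal.ofReal_sum_of_nonneg (fun k _ => by have := hSg0 k; positivity), ← ENNReal.ofReal_add (Finset.sum_nonneg fun k _ => by have := hSg0 k; positivity) (by positivity), Finset.mul_sum]
    _ ≤ _ := ENNReal.ofReal_le_ofReal (by nlinarith)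

end zyg

/-! ## Part 5 -/
open scoped BoundedContinuousFunction ContDiff
set_option linter.unusedSectionVars false

section gen
variable {d : ℕ}
open NormedSpace

abbrev Op (d : ℕ) := XX d →L[ℝ] XX d

def IsGen (L : Op d) (m : ℝ) : Prop := L 1 = 0 ∧ ‖L + m • (1 : Op d)‖ ≤ m

lemma IsGen.nonneg {L : Op d} {m : ℝ} (h : IsGen L m) : 0 ≤ m := (ContinuousLinearMap.opNorm_nonneg _).trans h.2

lemma IsGen.norm_apply_le {L : Op d} {m : ℝ} (h : IsGen L m) (u : XX d) : ‖L u‖ ≤ 2 * m * ‖u‖ := by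
  have e : L u = (L + m • (1 : Op d)) u - m • u := by
    change L u = (L u + m • u) - m • u
    abel
  rw [e]
  refine (norm_sub_le _ _).trans ?_
  have := ContinuousLinearMap.le_of_opNorm_le _ h.2 u
  rw [norm_smul, Real.norm_of_nonneg h.nonneg]
  linarith

lemma op_norm_one_le : ‖(1 : Op d)‖ ≤ 1 := ContinuousLinearMap.norm_id_le

lemma exp_norm_le' (A : Op d) : ‖exp A‖ ≤ Real.exp ‖A‖ := by
  rw [exp_eq_tsum ℝ]
  have hs := NormedSpace.norm_expSeries_summable' (𝕂 := ℝ) A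
  refine (norm_tsum_le_tsum_norm hs).trans ?_
  rw [Real.exp_eq_exp_ℝ, exp_eq_tsum ℝ]
  refine hs.tsum_le_tsum (fun n => ?_) (NormedSpace.expSeries_summable' (𝕂 := ℝ) ‖A‖)
  rw [norm_smul, Real.norm_of_nonneg (by positivity), smul_eq_mul]
  gcongr
  rcases Nat.eq_zero_or_pos n with rfl | hn
  · rw [pow_zero, pow_zero]; exact op_norm_one_le
  · exact norm_pow_le' _ hn

/-- Markov operators -/
def Mk (P : Op d) : Prop := ‖P‖ ≤ 1 ∧ P 1 = 1

lemma Mk.norm_le {P : Op d} (h : Mk P) (u : XX d) : ‖P u‖ ≤ ‖u‖ := by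
  have := ContinuousLinearMap.le_of_opNorm_le _ h.1 u
  linarith

lemma Mk.pos {P : Op d} (h : Mk P) {u : XX d} (hu : ∀ x, 0 ≤ u x) (x : Euc d) : 0 ≤ P u x := by
  have h1 : ‖‖u‖ • (1 : XX d) - u‖ ≤ ‖u‖ := XX.norm_le_of fun y => by
    have e : (‖u‖ • (1 : XX d) - u) y = ‖u‖ - u y := by simp
    rw [e, abs_le]
    have := (abs_le.1 (u.abs_le y)).2
    have := hu y
    constructor <;> linarith [norm_nonneg u]
  have h2 := (h.norm_le (‖u‖ • (1 : XX d) - u)).trans h1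
  rw [map_sub, map_smul, h.2] at h2
  have h3 := (abs_le.1 ((XX.abs_le _ x).trans h2)).2
  have e : (‖u‖ • (1 : XX d) - P u) x = ‖u‖ - P u x := by simp
  rw [e] at h3
  linarith

lemma Mk.mono {P : Op d} (h : Mk P) {u v : XX d} (huv : ∀ x, u x ≤ v x) (x : Euc d) : P u x ≤ P v x := by
  have := h.pos (u := v - u) (fun y => by have := huv y; simp only [BoundedContinuousFunction.sub_apply]; linarith) x
  rw [map_sub, BoundedContinuousFunction.sub_apply] at this
  linarith

lemma Mk.abs_le {P : Op d} (h : Mk P) {u v : XX d} (huv : ∀ x, |u x| ≤ v x) (x : Euc d) : |P u x| ≤ P v x := by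
  rw [_root_.abs_le]
  constructor
  · have := h.mono (u := -v) (v := u) (fun y => by simpa using (_root_.abs_le.1 (huv y)).1) x
    rw [map_neg] at this; simpa using this
  · exact h.mono (fun y => (_root_.abs_le.1 (huv y)).2) x

lemma Mk_J [NeZero d] (r : ℝ) : Mk (J r : Op d) := ⟨norm_J_le r, J_one r⟩
lemma Mk.mul {P Q : Op d} (hP : Mk P) (hQ : Mk Q) : Mk (P * Q) :=
  ⟨(ContinuousLinearMap.opNorm_comp_le P Q).trans (mul_le_one₀ hP.1 (ContinuousLinearMap.opNorm_nonneg _) hQ.1), by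
    change P (Q 1) = 1
    rw [hQ.2, hP.2]⟩

lemma Mk.isGen {P : Op d} (h : Mk P) : IsGen (P - 1) 1 := by
  refine ⟨by change P 1 - 1 = 0
             rw [h.2, sub_self], ?_⟩
  rw [one_smul, sub_add_cancel]; exact h.1

lemma exp_deriv (L : Op d) (u : XX d) (t : ℝ) :
    HasDerivAt (fun t : ℝ => exp (t • L) u) (exp (t • L) (L u)) t := by
  have := hasDerivAt_exp_smul_const (𝕂 := ℝ) L t
  exact (ContinuousLinearMap.apply ℝ (XX d) u).hasFDerivAt.comp_hasDerivAt t this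

lemma exp_comm_apply {L B : Op d} (h : Commute L B) (t : ℝ) (u : XX d) :
    exp (t • L) (B u) = B (exp (t • L) u) := by
  have : Commute (exp (t • L)) B := (h.smul_left t).exp_left
  exact congrArg (fun T : Op d => T u) this.eq

lemma apply_deriv {F : ℝ → XX d} {F' : XX d} {t : ℝ} (h : HasDerivAt F F' t) (x : Euc d) :
    HasDerivAt (fun t => F t x) (F' x) t :=
  ((BoundedContinuousFunction.evalCLM ℝ x : XX d →L[ℝ] ℝ).hasFDerivAt (x := F t)).comp_hasDerivAt t h

lemma exp_one_of {L : Op d} (hL : L 1 = 0) (t : ℝ) : exp (t • L) 1 = 1 := by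
  have hd : ∀ s, HasDerivAt (fun t : ℝ => exp (t • L) (1 : XX d)) 0 s := fun s => by
    have := exp_deriv L 1 s
    rwa [hL, map_zero] at this
  have := is_const_of_deriv_eq_zero (fun s => (hd s).differentiableAt) (fun s => (hd s).deriv) t 0
  rw [this]; simp

lemma IsGen.mk {L : Op d} {m : ℝ} (h : IsGen L m) {t : ℝ} (ht : 0 ≤ t) : Mk (exp (t • L)) := by
  refine ⟨?_, exp_one_of h.1 t⟩
  have e : t • L = (-(t * m)) • (1 : Op d) + t • (L + m • (1 : Op d)) := by module
  have hc : Commute ((-(t * m)) • (1 : Op d)) (t • (L + m • (1 : Op d))) :=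
    (Commute.one_left _).smul_left _
  let +nondep : NormedAlgebra ℚ (Op d) := .restrictScalars ℚ ℝ (Op d)
  rw [e, exp_add_of_commute hc]
  have h1 : exp ((-(t * m)) • (1 : Op d)) = Real.exp (-(t*m)) • (1 : Op d) := by
    have := NormedSpace.algebraMap_exp_comm (𝕂 := ℝ) (𝔸 := Op d) (-(t*m))
    rw [Algebra.algebraMap_eq_smul_one, Algebra.algebraMap_eq_smul_one] at this
    rw [← this, Real.exp_eq_exp_ℝ]
  rw [h1, smul_mul_assoc, one_mul, norm_smul, Real.norm_of_nonneg (Real.exp_pos _).le]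
  have h2 : ‖exp (t • (L + m • (1 : Op d)))‖ ≤ Real.exp (t * m) := by
    refine (exp_norm_le' _).trans (Real.exp_le_exp.2 ?_)
    rw [norm_smul, Real.norm_of_nonneg ht]
    exact mul_le_mul_of_nonneg_left h.2 ht
  calc _ ≤ Real.exp (-(t*m)) * Real.exp (t*m) := mul_le_mul_of_nonneg_left h2 (Real.exp_pos _).le
    _ = 1 := by rw [← Real.exp_add]; simp

/-- `exp(tL) om ≤ om + t c` when `L om ≤ c`. -/
lemma IsGen.exp_le {L : Op d} {m : ℝ} (h : IsGen L m) {om : XX d} {c : ℝ} (hc : ∀ x, L om x ≤ c) {t : ℝ}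
    (ht : 0 ≤ t) (x : Euc d) : exp (t • L) om x ≤ om x + t * c := by
  have hd : ∀ s, HasDerivAt (fun s => exp (s • L) om x) (exp (s • L) (L om) x) s := fun s => apply_deriv (exp_deriv L om s) x
  have := (convex_Ici (0:ℝ)).image_sub_le_mul_sub_of_deriv_le (f := fun s => exp (s • L) om x) (C := c)
    (fun s _ => (hd s).continuousAt.continuousWithinAt) (fun s _ => (hd s).differentiableAt.differentiableWithinAt)
    (fun s hs => ?_) 0 (mem_Ici.2 le_rfl) t (mem_Ici.2 ht) ht
  · simp only [zero_smul, exp_zero] at this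
    have e : (1 : Op d) om x = om x := rfl
    rw [e] at this
    linarith
  · rw [interior_Ici] at hs
    rw [(hd s).deriv]
    have := (h.mk (le_of_lt hs)).mono (u := L om) (v := c • (1 : XX d)) (fun y => by simpa using hc y) x
    rw [map_smul, (h.mk (le_of_lt hs)).2] at this
    simpa using this

lemma IsGen.euler {L : Op d} {m h : ℝ} (hg : IsGen L m) (h0 : 0 ≤ h) (hm : h * m ≤ 1) (u : XX d) :
    ‖u + h • L u‖ ≤ ‖u‖ := by
  have e : u + h • L u = (1 - h * m) • u + h • (L + m • (1 : Op d)) u := by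
    change _ = (1 - h * m) • u + h • (L u + m • u)
    module
  rw [e]
  refine (norm_add_le _ _).trans ?_
  rw [norm_smul, norm_smul, Real.norm_of_nonneg h0, Real.norm_of_nonneg (by linarith)]
  have := ContinuousLinearMap.le_of_opNorm_le _ hg.2 u
  nlinarith

/-- maximum-principle lemma -/
lemma IsGen.maxPrin {L : Op d} {m : ℝ} (hg : IsGen L m) {T Λ ε : ℝ} {w : ℝ → XX d}
    (hΛ : 0 ≤ Λ)
    (h0 : w 0 = 0) (hlip : ∀ s ∈ Icc 0 T, ∀ s' ∈ Icc 0 T, ‖w s - w s'‖ ≤ Λ * |s - s'|)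
    (hder : ∀ s ∈ Icc 0 T, ∀ x, ∃ D : ℝ, HasDerivWithinAt (fun s => w s x) D (Icc 0 T) s ∧ |D - L (w s) x| ≤ ε)
    {t : ℝ} (ht : t ∈ Icc 0 T) : ‖w t‖ ≤ t * ε := by
  have hm := hg.nonneg
  -- one step
  have step : ∀ s ∈ Icc 0 T, ∀ h, 0 ≤ h → h * m ≤ 1 → s + h ∈ Icc 0 T →
      ‖w (s + h)‖ ≤ ‖w s‖ + h * (ε + 2 * m * Λ * h) := by
    intro s hs h hh hhm hsh
    have key : ‖w (s + h) - (w s + h • L (w s))‖ ≤ h * (ε + 2 * m * Λ * h) := by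
      refine XX.norm_le_of fun x => ?_
      choose! D hD using fun s hs => hder s hs x
      have hsub : Icc s (s+h) ⊆ Icc 0 T := Icc_subset_Icc hs.1 hsh.2
      have := Convex.norm_image_sub_le_of_norm_hasDerivWithin_le (𝕜 := ℝ)
        (f := fun σ => w σ x - σ * L (w s) x) (f' := fun σ => D σ - 1 * L (w s) x)
        (s := Icc s (s+h)) (C := ε + 2 * m * Λ * h) (x := s) (y := s + h)
        (fun σ hσ => (((hD σ (hsub hσ)).1.mono hsub).sub ((hasDerivWithinAt_id σ _).mul_const _))) (fun σ hσ => ?_)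
        (convex_Icc _ _) (left_mem_Icc.2 (by linarith)) (right_mem_Icc.2 (by linarith))
      · have e : (w (s + h) - (w s + h • L (w s))) x = w (s+h) x - (s + h) * L (w s) x - (w s x - s * L (w s) x) := by
          simp; ring
        rw [e]
        refine this.trans (le_of_eq ?_)
        rw [add_sub_cancel_left, Real.norm_of_nonneg hh]; ring
      · have h1 := (hD σ (hsub hσ)).2
        have h2 : |L (w σ) x - L (w s) x| ≤ 2 * m * (Λ * h) := by
          have e : L (w σ) x - L (w s) x = L (w σ - w s) x := by rw [map_sub]; rfl
          rw [e]
          refine (XX.abs_le _ x).trans ((hg.norm_apply_le _).trans ?_)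
          have := hlip σ (hsub hσ) s hs
          have h3 : |σ - s| ≤ h := by rw [abs_le]; constructor <;> linarith [hσ.1, hσ.2]
          gcongr
          exact this.trans (by gcongr)
        rw [one_mul, Real.norm_eq_abs]
        have := abs_sub_le (D σ) (L (w σ) x) (L (w s) x)
        linarith
    have h1 := hg.euler hh hhm (w s)
    have h2 := norm_add_le (w (s + h) - (w s + h • L (w s))) (w s + h • L (w s))
    rw [sub_add_cancel] at h2
    linarith
  have main : ∀ n : ℕ, 0 < n → t / n * m ≤ 1 → ‖w t‖ ≤ t * ε + 2 * m * Λ * t^2 / n := by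
    intro n hn hnm
    have hn' : (0:ℝ) < n := by exact_mod_cast hn
    have ind : ∀ k : ℕ, k ≤ n → ‖w (k * (t/n))‖ ≤ k * (t/n * (ε + 2 * m * Λ * (t/n))) := by
      intro k
      induction k with
      | zero => intro _; simp [h0]
      | succ k ih =>
        intro hk
        have hk' : (k:ℝ) + 1 ≤ n := by exact_mod_cast hk
        have htn : 0 ≤ t / n := div_nonneg ht.1 hn'.le
        have hle : ((k:ℝ) + 1) * (t/n) ≤ T := by
          calc _ ≤ n * (t/n) := by gcongr
            _ = t := by field_simp
            _ ≤ T := ht.2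
        have := step (k * (t/n)) ⟨by positivity, by nlinarith⟩ (t/n) htn hnm
          ⟨by positivity, by nlinarith⟩
        have e : ((k+1:ℕ):ℝ) * (t/n) = k * (t/n) + t/n := by push_cast; ring
        rw [e]
        refine this.trans ?_
        have := ih (by omega)
        push_cast
        nlinarith
    have := ind n le_rfl
    have e : (n:ℝ) * (t/n) = t := by field_simp
    rw [e] at this
    refine this.trans (le_of_eq ?_)
    field_simp
  have hlim : Filter.Tendsto (fun n : ℕ => t * ε + 2 * m * Λ * t^2 / n) Filter.atTop (nhds (t * ε + 0)) :=
    tendsto_const_nhds.add (tendsto_const_div_atTop_nhds_zero_nat _)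
  rw [add_zero] at hlim
  refine ge_of_tendsto hlim ?_
  have hlim2 : Filter.Tendsto (fun n : ℕ => t * m / n) Filter.atTop (nhds 0) := tendsto_const_div_atTop_nhds_zero_nat _
  filter_upwards [hlim2.eventually (ge_mem_nhds (show (0:ℝ) < 1 by norm_num)), Filter.eventually_gt_atTop 0] with n hn hn0
  exact main n hn0 (by rw [div_mul_eq_mul_div]; exact hn)

/-- solution of the linear ODE `V' = L V + f`, `V 0 = 0` -/
def solV (L : Op d) (f : XX d) (s : ℝ) : XX d := ∫ σ in (0:ℝ)..s, exp (σ • L) f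

lemma exp_cont (L : Op d) (u : XX d) : Continuous (fun t : ℝ => exp (t • L) u) :=
  continuous_iff_continuousAt.2 fun t => (exp_deriv L u t).continuousAt

lemma solV_zero (L : Op d) (f : XX d) : solV L f 0 = 0 := intervalIntegral.integral_same

lemma solV_deriv' (L : Op d) (f : XX d) (s : ℝ) : HasDerivAt (solV L f) (exp (s • L) f) s :=
  intervalIntegral.integral_hasDerivAt_right ((exp_cont L f).intervalIntegrable _ _)
    ((exp_cont L f).stronglyMeasurableAtFilter _ _) (exp_cont L f).continuousAt

lemma solV_eq (L : Op d) (f : XX d) (s : ℝ) : exp (s • L) f = L (solV L f s) + f := by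
  have hd : ∀ s, HasDerivAt (fun s => exp (s • L) f - L (solV L f s)) 0 s := fun s => by
    have h1 := exp_deriv L f s
    have h2 := L.hasFDerivAt.comp_hasDerivAt s (solV_deriv' L f s)
    have h3 := h1.sub h2
    rwa [exp_comm_apply (Commute.refl L), sub_self] at h3
  have := is_const_of_deriv_eq_zero (fun s => (hd s).differentiableAt) (fun s => (hd s).deriv) s 0
  simp only [solV_zero, zero_smul, exp_zero, map_zero, sub_zero] at this
  have e : (1 : Op d) f = f := rfl
  rw [e, sub_eq_iff_eq_add] at this
  rw [this, add_comm]

lemma solV_deriv (L : Op d) (f : XX d) (s : ℝ) : HasDerivAt (solV L f) (L (solV L f s) + f) s := by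
  rw [← solV_eq]; exact solV_deriv' L f s

lemma IsGen.solV_lip {L : Op d} {m : ℝ} (h : IsGen L m) (f : XX d) {s s' : ℝ} (hs : 0 ≤ s) (hs' : 0 ≤ s') :
    ‖solV L f s - solV L f s'‖ ≤ ‖f‖ * |s - s'| :=
  Convex.norm_image_sub_le_of_norm_hasDerivWithin_le (𝕜 := ℝ) (s := Ici (0:ℝ))
    (fun σ _ => (solV_deriv' L f σ).hasDerivWithinAt) (fun _ hσ => (h.mk hσ).norm_le f) (convex_Ici _) hs' hs

lemma IsGen.solV_norm {L : Op d} {m : ℝ} (h : IsGen L m) (f : XX d) {s : ℝ} (hs : 0 ≤ s) :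
    ‖solV L f s‖ ≤ s * ‖f‖ := by
  have := h.solV_lip f hs le_rfl
  rw [solV_zero, sub_zero, sub_zero, abs_of_nonneg hs] at this
  linarith

/-- Duhamel derivative -/
lemma duhamel_deriv (L : Op d) {V : ℝ → XX d} {V' : XX d} {σ τ : ℝ} (hV : HasDerivAt V V' σ) :
    HasDerivAt (fun σ => exp ((τ - σ) • L) (V σ)) (exp ((τ - σ) • L) (V' - L (V σ))) σ := by
  have h1 : HasDerivAt (fun σ : ℝ => exp ((τ - σ) • L)) ((-1:ℝ) • (exp ((τ - σ) • L) * L)) σ := by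
    have h := hasDerivAt_exp_smul_const (𝕂 := ℝ) L (τ - σ)
    have h2 : HasDerivAt (fun σ : ℝ => τ - σ) (-1) σ := by simpa using (hasDerivAt_id σ).const_sub τ
    exact h.scomp σ h2
  have h3 := h1.clm_apply hV
  have e : ((-1:ℝ) • (exp ((τ - σ) • L) * L)) (V σ) + (exp ((τ - σ) • L)) V' = exp ((τ - σ) • L) (V' - L (V σ)) := by
    rw [map_sub]
    change (-1:ℝ) • (exp ((τ - σ) • L) (L (V σ))) + _ = _
    module
  rw [← e]
  exact h3

end gen

/-! ## Part 6 -/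
open scoped BoundedContinuousFunction ContDiff
set_option linter.unusedSectionVars false

section weights
variable {d : ℕ}
open NormedSpace

lemma abs_rpow_sub_le {a b μ : ℝ} (ha : 0 ≤ a) (hb : 0 ≤ b) (hμ : μ ∈ Ioo (0:ℝ) 1) :
    |a ^ μ - b ^ μ| ≤ |a - b| ^ μ := by
  wlog h : b ≤ a generalizing a b
  · rw [abs_sub_comm, abs_sub_comm a b]; exact this hb ha (le_of_not_ge h)
  have h1 := Real.rpow_add_le_add_rpow hb (sub_nonneg.2 h) hμ.1.le hμ.2.le
  rw [add_sub_cancel] at h1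
  have h2 : b ^ μ ≤ a ^ μ := Real.rpow_le_rpow hb h hμ.1.le
  rw [abs_of_nonneg (by linarith), abs_of_nonneg (by linarith)]
  linarith

def wf (μ : ℝ) (x : Euc d) : ℝ := min (‖x‖ ^ μ) 1

lemma wf_nonneg {μ : ℝ} (x : Euc d) : 0 ≤ wf μ x := le_min (by positivity) (by norm_num)
lemma wf_le_one {μ : ℝ} (x : Euc d) : wf μ x ≤ 1 := min_le_right _ _
lemma wf_le {μ : ℝ} (x : Euc d) : wf μ x ≤ ‖x‖ ^ μ := min_le_left _ _
lemma wf_zero {μ : ℝ} (hμ : 0 < μ) : wf μ (0 : Euc d) = 0 := by simp [wf, Real.zero_rpow hμ.ne']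
lemma wf_hol {μ : ℝ} (hμ : μ ∈ Ioo (0:ℝ) 1) (x y : Euc d) : |wf μ x - wf μ y| ≤ ‖x - y‖ ^ μ := by
  unfold wf
  have h1 := abs_min_sub_min_le_max (‖x‖ ^ μ) 1 (‖y‖ ^ μ) 1
  refine h1.trans (max_le ?_ (by simp; positivity))
  refine (abs_rpow_sub_le (norm_nonneg _) (norm_nonneg _) hμ).trans ?_
  exact Real.rpow_le_rpow (abs_nonneg _) (abs_norm_sub_norm_le x y) hμ.1.le
lemma wf_cont {μ : ℝ} (hμ : 0 < μ) : Continuous (wf μ : Euc d → ℝ) :=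
  (continuous_norm.rpow_const (fun _ => Or.inr hμ.le)).min continuous_const

def WX (μ : ℝ) (hμ : 0 < μ) (x0 : Euc d) : XX d :=
  BoundedContinuousFunction.ofNormedAddCommGroup (fun x => wf μ (x - x0))
    ((wf_cont hμ).comp (continuous_id.sub continuous_const)) 1 (fun x => by
      rw [Real.norm_of_nonneg (wf_nonneg _)]; exact wf_le_one _)

lemma WX_apply {μ : ℝ} (hμ : 0 < μ) (x0 x : Euc d) : WX μ hμ x0 x = wf μ (x - x0) := rfl

lemma hol_zyg {μ ϱ A : ℝ} {w : XX d} (h : ∀ x k, ϱ ≤ ‖k‖ → |w (x + k) - w x| ≤ A * ‖k‖ ^ μ) (hw : ‖w‖ ≤ 4 * A) :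
    Zyg μ ϱ (4 * A) w := by
  refine ⟨hw, fun k hk => XX.norm_le_of fun x => ?_⟩
  rw [D3_apply]
  have e3 : x + (3:ℝ) • k = x + k + k + k := by module
  have e2 : x + (2:ℝ) • k = x + k + k := by module
  rw [e3, e2]
  have h1 := abs_le.1 (h x k hk)
  have h2 := abs_le.1 (h (x + k) k hk)
  have h3 := abs_le.1 (h (x + k + k) k hk)
  rw [abs_le]; constructor <;> linarith

lemma WX_zyg {μ : ℝ} (hμ : μ ∈ Ioo (0:ℝ) 1) (x0 : Euc d) : Zyg μ 0 4 (WX μ hμ.1 x0) := by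
  have := hol_zyg (μ := μ) (ϱ := 0) (A := 1) (w := WX μ hμ.1 x0) (fun x k _ => ?_) ?_
  · simpa using this
  · rw [WX_apply, WX_apply, one_mul]
    have := wf_hol hμ (x + k - x0) (x - x0)
    have e : x + k - x0 - (x - x0) = k := by abel
    rwa [e] at this
  · refine XX.norm_le_of fun x => ?_
    rw [WX_apply, abs_of_nonneg (wf_nonneg _)]
    linarith [wf_le_one (μ := μ) (x - x0)]

/-- reference weight -/
def wh (μ R : ℝ) (x0 x : Euc d) : ℝ := 1 + wf μ (x - x0) / R ^ μ

lemma wh_ge_one {μ R : ℝ} (hR : 0 < R) (x0 x : Euc d) : 1 ≤ wh μ R x0 x := by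
  unfold wh
  have := wf_nonneg (μ := μ) (x - x0)
  have : 0 ≤ wf μ (x - x0) / R ^ μ := by positivity
  linarith

lemma wh_self {μ R : ℝ} (hμ : 0 < μ) (x0 : Euc d) : wh μ R x0 x0 = 1 := by
  unfold wh; rw [sub_self, wf_zero hμ]; simp

lemma wh_slow {μ R : ℝ} (hμ : μ ∈ Ioo (0:ℝ) 1) (hR : 0 < R) (x0 x z : Euc d) (hz : ‖z‖ ≤ 2 * R) :
    wh μ R x0 (x + z) ≤ 3 * wh μ R x0 x := by
  have h1 := (abs_le.1 (wf_hol hμ (x + z - x0) (x - x0))).2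
  have e : x + z - x0 - (x - x0) = z := by abel
  rw [e] at h1
  have h2 : ‖z‖ ^ μ ≤ 2 * R ^ μ := by
    calc ‖z‖ ^ μ ≤ (2 * R) ^ μ := Real.rpow_le_rpow (norm_nonneg _) hz hμ.1.le
      _ = 2 ^ μ * R ^ μ := Real.mul_rpow (by norm_num) hR.le
      _ ≤ 2 * R ^ μ := by
        gcongr
        calc (2:ℝ) ^ μ ≤ 2 ^ (1:ℝ) := Real.rpow_le_rpow_of_exponent_le (by norm_num) hμ.2.le
          _ = 2 := Real.rpow_one _
  have hp : 0 < R ^ μ := by positivity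
  have h3 : wf μ (x + z - x0) / R ^ μ ≤ wf μ (x - x0) / R ^ μ + 2 := by
    rw [div_add' _ _ _ hp.ne', div_le_div_iff_of_pos_right hp]; linarith
  have h4 : 0 ≤ wf μ (x - x0) / R ^ μ := div_nonneg (wf_nonneg _) hp.le
  unfold wh
  linarith

def Wt (μ R : ℝ) (x0 : Euc d) (c : ℝ) (F : XX d) : Prop := ∀ x, |F x| ≤ c * wh μ R x0 x

lemma Wt.nonneg {μ R c : ℝ} {x0 : Euc d} {F : XX d} (hμ : 0 < μ) (h : Wt μ R x0 c F) : 0 ≤ c := by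
  have := (abs_nonneg _).trans (h x0)
  rwa [wh_self hμ, mul_one] at this

lemma Wt.mono {μ R c c' : ℝ} {x0 : Euc d} {F : XX d} (hR : 0 < R) (h : Wt μ R x0 c F) (hc : c ≤ c') : Wt μ R x0 c' F :=
  fun x => (h x).trans (mul_le_mul_of_nonneg_right hc (by linarith [wh_ge_one (μ := μ) hR x0 x]))

variable [NeZero d]

lemma Wt.J {μ R c s : ℝ} {x0 : Euc d} {F : XX d} (hμ : μ ∈ Ioo (0:ℝ) 1) (hR : 0 < R) (hs : 0 ≤ s) (hsR : s ≤ 2 * R)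
    (h : Wt μ R x0 c F) : Wt μ R x0 (3 * c) (J s F) := fun x => by
  have hc := h.nonneg hμ.1
  refine J_abs_le fun z hz => (h _).trans ?_
  rw [abs_of_nonneg hs] at hz
  have := wh_slow hμ hR x0 x z (hz.trans hsR)
  nlinarith

lemma Wt.diff {μ R c : ℝ} {x0 : Euc d} {F : XX d} {h : Euc d} (hμ : μ ∈ Ioo (0:ℝ) 1) (hR : 0 < R) (hh : ‖h‖ ≤ 2 * R)
    (hF : Wt μ R x0 c F) : Wt μ R x0 (4 * c) ((tr h - 1) F) := fun x => by
  have hc := hF.nonneg hμ.1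
  change |F (x + h) - F x| ≤ _
  refine (abs_sub _ _).trans ?_
  have := wh_slow hμ hR x0 x h hh
  have := hF (x + h)
  have := hF x
  nlinarith

/-- clamp -/
def clampX (q : ℝ) (F : XX d) : XX d :=
  BoundedContinuousFunction.ofNormedAddCommGroup (fun x => max (-|q|) (min |q| (F x)))
    (by fun_prop) |q| (fun x => by
      rw [Real.norm_eq_abs, abs_le]
      exact ⟨le_max_left _ _, max_le (by linarith [abs_nonneg q]) (min_le_left _ _)⟩)

lemma exists_clampJ (d : ℕ) [NeZero d] : ∃ C : ℝ, 1 ≤ C ∧ ∀ (s : ℝ), 0 < s → ∀ (F : XX d) (x h : Euc d) (q : ℝ),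
    (∀ z, ‖z‖ ≤ ‖h‖ + s → |F (x + z)| ≤ q) → |J s F (x + h) - J s F x| ≤ C * q * ‖h‖ / s := by
  obtain ⟨C, hC, hJ⟩ := exists_J_smooth d
  refine ⟨C, hC, fun s hs F x h q hq => ?_⟩
  have hq0 : 0 ≤ q := (abs_nonneg _).trans (hq 0 (by simp; positivity))
  set F' := clampX q F with hF'
  have hn : ‖F'‖ ≤ q := by
    have : ‖F'‖ ≤ |q| := BoundedContinuousFunction.norm_ofNormedAddCommGroup_le _ (abs_nonneg q) _
    rwa [abs_of_nonneg hq0] at this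
  have heq : ∀ z, ‖z‖ ≤ ‖h‖ + s → F' (x + z) = F (x + z) := fun z hz => by
    change max (-|q|) (min |q| (F (x + z))) = F (x + z)
    have := abs_le.1 (hq z hz)
    rw [abs_of_nonneg hq0, min_eq_right this.2, max_eq_right this.1]
  have hJe : ∀ k, ‖k‖ ≤ ‖h‖ → J s F (x + k) = J s F' (x + k) := fun k hk => by
    have : |J s (F - F') (x + k)| ≤ 0 := J_abs_le fun z hz => by
      rw [abs_of_pos hs] at hz
      have e := heq (k + z) ((norm_add_le _ _).trans (by linarith))
      rw [← add_assoc] at e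
      rw [BoundedContinuousFunction.sub_apply, e, sub_self, abs_zero]
    have h0 := abs_nonpos_iff.1 this
    rw [map_sub, BoundedContinuousFunction.sub_apply] at h0
    linarith
  have e0 := hJe 0 (by simp)
  rw [add_zero] at e0
  rw [hJe h le_rfl, e0]
  have := (hJ s hs F').lip (x + h) x
  rw [add_sub_cancel_left] at this
  refine this.trans ?_
  rw [div_mul_eq_mul_div]
  gcongr

lemma J_sub_one_le {a r s : ℝ} {u : XX d} (hr : 0 < r) (hs : 0 ≤ s) (hu : SmN 2 a r u) :
    ‖J s u - u‖ ≤ a * s ^ 2 / r ^ 2 := by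
  have ha : 0 ≤ a := (abs_nonneg _).trans (hu.abs_le 0)
  refine XX.norm_le_of fun x => ?_
  change |J s u x - u x| ≤ _
  have e : J s u x - u x = ∫ z, (u (x + s • z) - u x - fderiv ℝ u x (s • z)) ∂(etaM d) := by
    rw [integral_sub, integral_sub, J_apply]
    · simp only [map_smul, smul_eq_mul]
      rw [integral_const_mul, etaM_integral_clm]; simp
    · exact J_int s u x
    · exact integrable_const _
    · exact (J_int s u x).sub (integrable_const _)
    · simp only [map_smul, smul_eq_mul]
      exact (etaM_integrable_clm _).const_mul _
  rw [e]
  have key : ∀ᵐ z ∂(etaM d), ‖u (x + s • z) - u x - fderiv ℝ u x (s • z)‖ ≤ a * s ^ 2 / r ^ 2 := by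
    filter_upwards [etaM_ae] with z hz
    have h1 := hu.taylor2 hr x (s • z) 0
    rw [sub_zero, add_zero, norm_zero, add_zero, norm_smul, Real.norm_of_nonneg hs] at h1
    refine h1.trans ?_
    have : ‖z‖ ^ 2 ≤ 1 := by nlinarith [norm_nonneg z]
    calc a / r^2 * (s * ‖z‖) * (s * ‖z‖) = (a * s^2 / r^2) * ‖z‖^2 := by ring
      _ ≤ (a * s^2 / r^2) * 1 := by gcongr
      _ = _ := mul_one _
  have := norm_integral_le_of_norm_le_const key
  rwa [probReal_univ, mul_one] at this

lemma exists_scale {R : ℝ} (hR : 0 < R) (hR1 : R ≤ 1) : ∃ n, R ≤ rj n ∧ rj n ≤ 2 * R := by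
  classical
  have hex : ∃ J, rj J ≤ 2 * R := by
    obtain ⟨J, hJ⟩ := exists_pow_lt_of_lt_one (show 0 < 2 * R by linarith) (by norm_num : (2⁻¹:ℝ) < 1)
    exact ⟨J, hJ.le⟩
  refine ⟨Nat.find hex, ?_, Nat.find_spec hex⟩
  rcases Nat.eq_zero_or_pos (Nat.find hex) with h | h
  · rw [h, rj_zero]; exact hR1
  · have h2 := Nat.find_min hex (show Nat.find hex - 1 < Nat.find hex by omega)
    have h3 : rj (Nat.find hex) = rj (Nat.find hex - 1) / 2 := by rw [← rj_succ]; congr 1; omega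
    push Not at h2
    rw [h3]; linarith

lemma geom_neg {s0 s : ℝ} (hs0 : 0 < s0) (hs : s0 ≤ s) (n : ℕ) :
    ∑ j ∈ Finset.range (n+1), rj j ^ (-s) ≤ (1 / (1 - (2⁻¹:ℝ)^s0)) * rj n ^ (-s) := by
  have hq1 : (2⁻¹:ℝ)^s0 < 1 := Real.rpow_lt_one (by norm_num) (by norm_num) hs0
  have hq0 : 0 ≤ (2⁻¹:ℝ)^s0 := by positivity
  have : ∀ j ∈ Finset.range (n+1), rj j ^ (-s) ≤ rj n ^ (-s) * ((2⁻¹:ℝ)^s0)^(n - j) := by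
    intro j hj
    have hj' : j ≤ n := by have := Finset.mem_range.1 hj; omega
    have e : rj n = rj j * rj (n - j) := by rw [← rj_add]; congr 1; omega
    rw [e, Real.mul_rpow (rj_pos _).le (rj_pos _).le, mul_assoc, ← rj_rpow, ← Real.rpow_add (rj_pos _)]
    have h1 : 1 ≤ rj (n - j) ^ (-s + s0) := Real.one_le_rpow_of_pos_of_le_one_of_nonpos (rj_pos _) (rj_le_one _) (by linarith)
    have h2 : 0 ≤ rj j ^ (-s) := by have := rj_pos j; positivity
    nlinarith
  refine (Finset.sum_le_sum this).trans ?_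
  rw [← Finset.mul_sum, mul_comm]
  have hp : 0 ≤ rj n ^ (-s) := by have := rj_pos n; positivity
  refine mul_le_mul_of_nonneg_right ?_ hp
  have h3 := Finset.sum_range_reflect (fun i => ((2⁻¹:ℝ)^s0)^i) (n+1)
  simp only [Nat.add_sub_cancel] at h3
  rw [h3, ← tsum_geometric_of_lt_one hq0 hq1 |>.trans (one_div _).symm]
  exact (summable_geometric_of_lt_one hq0 hq1).sum_le_tsum _ (fun i _ => by positivity)

lemma exists_wt_gen (d : ℕ) [NeZero d] {μ : ℝ} (hμ : μ ∈ Ioo (0:ℝ) 1) : ∃ C : ℝ, 1 ≤ C ∧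
    ∀ (A : Op d) (m N R s : ℝ), IsGen A m → 0 ≤ N → 0 < R → R ≤ 2 → 1 ≤ s → s ≤ 2 →
    (∀ j, min R 1 ≤ rj j → ∀ (u : XX d) (a : ℝ), SmN 3 a (rj j) u → ‖A u‖ ≤ N * a * rj j ^ (-s)) →
    ∀ (x0 : Euc d) (c : ℝ) (F : XX d) (t : ℝ), 0 ≤ t → Wt μ R x0 c F →
      Wt μ R x0 (C * (1 + t * N * R ^ (-s)) * c) (exp (t • A) F) := by
  obtain ⟨C0, hC0, hB⟩ := exists_blocks d
  set D := 1 / (1 - (2⁻¹:ℝ)^(1-μ)) with hD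
  have hq1 : (2⁻¹:ℝ)^(1-μ) < 1 := Real.rpow_lt_one (by norm_num) (by norm_num) (by linarith [hμ.2])
  have hD0 : 0 < D := by rw [hD]; have : 0 < 1 - (2⁻¹:ℝ)^(1-μ) := by linarith
                         positivity
  refine ⟨1 + 16 * C0 + 16 * C0 * D, by nlinarith, fun A m N R s hA hN hR hR2 hs1 hs2 hblk x0 c F t ht hF => ?_⟩
  have hc := hF.nonneg hμ.1
  obtain ⟨n, hn1, hn2⟩ := exists_scale (R := min R 1) (by positivity) (min_le_right _ _)
  have hrn := rj_pos n
  have hn3 : rj n ≤ 2 * R := hn2.trans (by linarith [min_le_left R 1])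
  have hn4 : R / 2 ≤ rj n := le_trans (le_min (by linarith) (by linarith)) hn1
  set W := WX μ hμ.1 x0 with hW
  have hZ := WX_zyg hμ x0
  have hμ3 : μ ∈ Ioo (0:ℝ) 3 := ⟨hμ.1, by linarith [hμ.2]⟩
  have hRμ : 0 < R ^ μ := by positivity
  set U : XX d := TT (rj n) (TT (rj n) W) with hU
  have hWU : ‖W - U‖ ≤ 8 * C0 * R ^ μ := by
    have h1 := (hB μ 0 4 hμ3 W hZ n (by linarith)).2.1
    refine h1.trans ?_
    have h2 : rj n ^ μ ≤ 2 * R ^ μ := by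
      calc rj n ^ μ ≤ (2 * R) ^ μ := Real.rpow_le_rpow hrn.le hn3 hμ.1.le
        _ = 2 ^ μ * R ^ μ := Real.mul_rpow (by norm_num) hR.le
        _ ≤ 2 * R ^ μ := by
          gcongr
          calc (2:ℝ) ^ μ ≤ 2 ^ (1:ℝ) := Real.rpow_le_rpow_of_exponent_le (by norm_num) hμ.2.le
            _ = 2 := Real.rpow_one _
    calc _ ≤ C0 * (4 * rj n ^ μ) := by gcongr; exact min_le_right _ _
      _ ≤ C0 * (4 * (2 * R^μ)) := by gcongr
      _ = _ := by ring
  have hAU : ‖A U‖ ≤ 16 * C0 * D * N * R ^ (μ - s) := by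
    have e : U = ∑ j ∈ Finset.range (n+1), Qb j W := by
      have := congrArg (fun T : Op d => T W) (sum_Qb (d := d) n)
      rw [hU]
      change (∑ j ∈ Finset.range (n+1), (Qb j : Op d)) W = _ at this
      rw [_root_.sum_apply] at this
      exact this.symm
    rw [e, map_sum]
    refine (norm_sum_le _ _).trans ?_
    calc _ ≤ ∑ j ∈ Finset.range (n+1), 4 * C0 * N * rj j ^ (-(s - μ)) := by
          refine Finset.sum_le_sum fun j hj => ?_
          have hj' : j ≤ n := by have := Finset.mem_range.1 hj; omega
          have hjn : rj n ≤ rj j := pow_le_pow_of_le_one (by norm_num) (by norm_num) hj'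
          have hp := rj_pos j
          have h1 := (hB μ 0 4 hμ3 W hZ j (by linarith)).1
          have h2 := hblk j (hn1.trans hjn) (Qb j W) _ h1
          refine h2.trans ?_
          have e1 : rj j ^ (-(s - μ)) = rj j ^ μ * rj j ^ (-s) := by rw [← Real.rpow_add hp]; ring_nf
          rw [e1]
          calc _ ≤ N * (C0 * (4 * rj j ^ μ)) * rj j ^ (-s) := by gcongr; exact min_le_right _ _
            _ = _ := by ring
      _ ≤ 4 * C0 * N * (D * rj n ^ (-(s - μ))) := by
          rw [← Finset.mul_sum]
          gcongr
          exact geom_neg (by linarith [hμ.2]) (by linarith) n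
      _ ≤ 4 * C0 * N * (D * (4 * R ^ (μ - s))) := by
          gcongr
          have : rj n ^ (-(s - μ)) ≤ (R/2) ^ (-(s-μ)) := Real.rpow_le_rpow_of_nonpos (by positivity) hn4 (by linarith [hμ.2])
          refine this.trans ?_
          rw [Real.div_rpow hR.le (by norm_num), neg_sub, div_eq_mul_inv, ← Real.rpow_neg (by norm_num), mul_comm]
          gcongr
          calc (2:ℝ) ^ (-(μ-s)) ≤ 2 ^ (2:ℝ) := Real.rpow_le_rpow_of_exponent_le (by norm_num) (by linarith [hμ.1])
            _ = 4 := by norm_num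
      _ = _ := by ring
  set om : XX d := (1 + 8 * C0) • (1 : XX d) + (R ^ μ)⁻¹ • U with hom
  have homa : ∀ x, om x = 1 + 8 * C0 + (R^μ)⁻¹ * U x := fun x => by simp [hom]
  have hlow : ∀ x, wh μ R x0 x ≤ om x := fun x => by
    rw [homa]
    have h1 := (abs_le.1 (((W - U).abs_le x).trans hWU)).2
    change W x - U x ≤ _ at h1
    have h2 : (R^μ)⁻¹ * W x ≤ (R^μ)⁻¹ * (U x + 8 * C0 * R^μ) := by gcongr; linarith
    have h3 : (R^μ)⁻¹ * (U x + 8 * C0 * R^μ) = (R^μ)⁻¹ * U x + 8 * C0 := by field_simp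
    have e : wh μ R x0 x = 1 + (R^μ)⁻¹ * W x := by rw [wh, hW, WX_apply, div_eq_inv_mul]
    rw [e]; linarith
  have hup : ∀ x, om x ≤ (1 + 16 * C0) * wh μ R x0 x := fun x => by
    rw [homa]
    have h1 := (abs_le.1 (((W - U).abs_le x).trans hWU)).1
    change _ ≤ W x - U x at h1
    have h2 : (R^μ)⁻¹ * U x ≤ (R^μ)⁻¹ * (W x + 8 * C0 * R^μ) := by gcongr; linarith
    have h3 : (R^μ)⁻¹ * (W x + 8 * C0 * R^μ) = (R^μ)⁻¹ * W x + 8 * C0 := by field_simp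
    have e : wh μ R x0 x = 1 + (R^μ)⁻¹ * W x := by rw [wh, hW, WX_apply, div_eq_inv_mul]
    have h4 := wh_ge_one (μ := μ) hR x0 x
    nlinarith
  have hAom : ∀ x, A om x ≤ 16 * C0 * D * N * R ^ (-s) := fun x => by
    have e : A om = (R^μ)⁻¹ • A U := by rw [hom, map_add, map_smul, map_smul, hA.1, smul_zero, zero_add]
    rw [e]
    have h1 := (abs_le.1 ((A U).abs_le x)).2.trans hAU
    change (R^μ)⁻¹ * (A U x) ≤ _
    calc _ ≤ (R^μ)⁻¹ * (16 * C0 * D * N * R ^ (μ - s)) := by gcongr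
      _ = _ := by rw [Real.rpow_sub hR, Real.rpow_neg hR.le]; field_simp
  intro x
  have hmk := hA.mk ht
  have h1 : |exp (t • A) F x| ≤ exp (t • A) (c • om) x := hmk.abs_le (fun y => (hF y).trans (by
    change _ ≤ c * om y
    exact mul_le_mul_of_nonneg_left (hlow y) hc)) x
  rw [map_smul] at h1
  change _ ≤ c * (exp (t • A) om x) at h1
  have h2 := hA.exp_le hAom ht x
  have h3 := hup x
  have h4 := wh_ge_one (μ := μ) hR x0 x
  refine h1.trans ?_
  have h5 : exp (t • A) om x ≤ (1 + 16 * C0 + 16 * C0 * D) * (1 + t * N * R ^ (-s)) * wh μ R x0 x := by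
    have h6 : 0 ≤ t * N * R ^ (-s) := by positivity
    calc _ ≤ (1 + 16 * C0) * wh μ R x0 x + 16 * C0 * D * (t * N * R ^ (-s)) := by linarith
      _ ≤ (1 + 16 * C0) * wh μ R x0 x + 16 * C0 * D * (t * N * R ^ (-s)) * wh μ R x0 x := by
          have : 0 ≤ 16 * C0 * D * (t * N * R ^ (-s)) := by positivity
          nlinarith
      _ ≤ _ := by
          have a1 : 0 ≤ 16 * C0 * D * wh μ R x0 x := by positivity
          have a2 : 0 ≤ (1 + 16 * C0) * (t * N * R ^ (-s)) * wh μ R x0 x := by positivity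
          nlinarith
  calc _ ≤ c * ((1 + 16 * C0 + 16 * C0 * D) * (1 + t * N * R ^ (-s)) * wh μ R x0 x) := by gcongr
    _ = _ := by ring

end weights

/-! ## Part 7 -/
open scoped BoundedContinuousFunction ContDiff
set_option linter.unusedSectionVars false

section frozen
variable {d : ℕ}
open NormedSpace

structure Frz [NeZero d] (α Λ κ r0 ϱ : ℝ) (𝓛 : Op d) : Prop where
  gen : ∃ m, IsGen 𝓛 m
  ctr : ∀ h, Commute 𝓛 (tr h)
  cJ : ∀ s, Commute 𝓛 (J s)
  blk : ∀ r, ϱ ≤ r → r ≤ 1 → ∀ (u : XX d) (a : ℝ), SmN 2 a r u → ‖𝓛 u‖ ≤ Λ * a * r ^ (-α)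
  low : ∀ r, ϱ ≤ r → r ≤ 2 → ∃ ϱ0, 0 ≤ ϱ0 ∧ ϱ0 ≤ ϱ ∧
    ∃ m', IsGen (𝓛 - (κ * r ^ (-α)) • (J (r0 * r) * J ϱ0 - 1)) m'

variable [NeZero d]

lemma J_tr (s : ℝ) (h : Euc d) : Commute (J s : Op d) (tr h) := conv_tr _ h

lemma JJ_sub_one {a r s s' : ℝ} {u : XX d} (hr : 0 < r) (hs : 0 ≤ s) (hs' : 0 ≤ s') {b : ℝ} (hb : s ≤ b) (hb' : s' ≤ b)
    (hu : SmN 2 a r u) : ‖(J s * J s' - 1 : Op d) u‖ ≤ 2 * b ^ 2 * a / r ^ 2 := by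
  have ha : 0 ≤ a := (abs_nonneg _).trans (hu.abs_le 0)
  have e : (J s * J s' - 1 : Op d) u = J s (J s' u - u) + (J s u - u) := by
    rw [map_sub]; change J s (J s' u) - u = _; abel
  rw [e]
  have h1 := J_sub_one_le hr hs hu
  have h2 := J_sub_one_le hr hs' hu
  have h3 := J_norm_apply_le s (J s' u - u)
  have h4 : a * s ^ 2 / r ^ 2 ≤ a * b ^ 2 / r ^ 2 := by gcongr
  have h5 : a * s' ^ 2 / r ^ 2 ≤ a * b ^ 2 / r ^ 2 := by gcongr
  have h6 : 2 * b ^ 2 * a / r ^ 2 = a * b ^ 2 / r ^ 2 + a * b ^ 2 / r ^ 2 := by ring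
  refine (norm_add_le _ _).trans ?_
  linarith

lemma exp_split {𝓛 B : Op d} (h : Commute 𝓛 B) (t c : ℝ) :
    exp (t • 𝓛) = exp (t • (𝓛 - c • B)) * exp ((t * c) • B) := by
  have hc : Commute (t • (𝓛 - c • B)) ((t * c) • B) := by
    refine (Commute.smul_right (Commute.smul_left ?_ _) _)
    exact h.sub_left ((Commute.refl B).smul_left c)
  let +nondep : NormedAlgebra ℚ (Op d) := .restrictScalars ℚ ℝ (Op d)
  rw [← exp_add_of_commute hc]
  congr 1
  module

/-- differences of `exp (a (S-1)) F` -/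
lemma exp_S_diff {S : Op d} {F : XX d} {h x : Euc d} {a Q : ℝ} (ha : 0 ≤ a) (hcm : Commute S (tr h))
    (hb : ∀ u ∈ Icc 0 a, |(tr h - 1) (S (exp (u • (S - 1)) F)) x| ≤ Q) :
    |(tr h - 1) (exp (a • (S - 1)) F) x| ≤ Real.exp (-a) * |(tr h - 1) F x| + Q := by
  have hQ : 0 ≤ Q := (abs_nonneg _).trans (hb 0 ⟨le_rfl, ha⟩)
  set ψ : ℝ → ℝ := fun u => Real.exp u * (tr h - 1 : Op d) (exp (u • (S - 1)) F) x with hψ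
  have hd : ∀ u, HasDerivAt ψ (Real.exp u * (tr h - 1 : Op d) (S (exp (u • (S - 1)) F)) x) u := fun u => by
    have h1 := exp_deriv (S - 1) F u
    rw [exp_comm_apply (Commute.refl _)] at h1
    have h2 := apply_deriv ((tr h - 1 : Op d).hasFDerivAt.comp_hasDerivAt u h1) x
    have h3 := (Real.hasDerivAt_exp u).mul h2
    refine HasDerivAt.congr_deriv h3 ?_
    have e : (S - 1 : Op d) (exp (u • (S - 1)) F) = S (exp (u • (S - 1)) F) - exp (u • (S - 1)) F := rfl
    rw [e, map_sub, BoundedContinuousFunction.sub_apply]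
    change Real.exp u * ((tr h - 1 : Op d) (exp (u • (S - 1)) F)) x + _ = _
    ring
  -- compare with Q e^u
  have hm : ‖ψ a‖ ≤ |ψ 0| + Q * (Real.exp a - 1) := by
    refine image_norm_le_of_norm_deriv_right_le_deriv_boundary' (f := ψ) (a := 0) (b := a)
      (B := fun u => |ψ 0| + Q * (Real.exp u - 1)) (B' := fun u => Q * Real.exp u)
      (f' := fun u => Real.exp u * (tr h - 1 : Op d) (S (exp (u • (S - 1)) F)) x)
      (fun u _ => (hd u).continuousAt.continuousWithinAt)
      (fun u _ => (hd u).hasDerivWithinAt) ?_ (by fun_prop) ?_ ?_ ⟨ha, le_rfl⟩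
    · simp
    · intro u _
      have := ((Real.hasDerivAt_exp u).sub_const 1 |>.const_mul Q).const_add |ψ 0|
      exact this.hasDerivWithinAt
    · intro u hu
      rw [Real.norm_eq_abs, abs_mul, Real.abs_exp, mul_comm]
      exact mul_le_mul_of_nonneg_right (hb u ⟨hu.1, hu.2.le⟩) (Real.exp_pos _).le
  have e0 : ψ 0 = (tr h - 1 : Op d) F x := by simp [hψ]
  rw [e0, Real.norm_eq_abs, hψ] at hm
  simp only at hm
  rw [abs_mul, Real.abs_exp] at hm
  have hp := Real.exp_pos a
  have : |(tr h - 1 : Op d) (exp (a • (S - 1)) F) x| ≤ Real.exp (-a) * (|(tr h - 1 : Op d) F x| + Q * (Real.exp a - 1)) := by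
    rw [Real.exp_neg, inv_mul_eq_div, le_div_iff₀ hp, mul_comm]; exact hm
  refine this.trans ?_
  have e2 : Real.exp (-a) * Real.exp a = 1 := by rw [← Real.exp_add]; simp
  have := Real.exp_pos (-a)
  nlinarith

lemma exists_dstep (d : ℕ) [NeZero d] {μ α Λ κ r0 : ℝ} (hμ : μ ∈ Ioo (0:ℝ) 1) (hα : α ∈ Ico (1:ℝ) 2) (hΛ : 0 ≤ Λ)
    (hκ : 0 < κ) (hr0 : 0 < r0) (hr01 : r0 ≤ 1) : ∃ C : ℝ, 1 ≤ C ∧ ∀ (ϱ : ℝ) (𝓛 : Op d), Frz α Λ κ r0 ϱ 𝓛 → ϱ ≤ 1 →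
    ∀ (r R t : ℝ) (h : Euc d), 0 < r → ϱ ≤ r → r ≤ R → R ≤ 2 → ‖h‖ ≤ r → 0 ≤ t → t ≤ R ^ α →
    ∀ (x0 : Euc d) (c : ℝ) (F : XX d), Wt μ R x0 c F →
      Wt μ R x0 (C * (Real.exp (-(κ * t * r ^ (-α))) + ‖h‖ / r) * c) ((tr h - 1) (exp (t • 𝓛) F)) ∧
      Wt μ R x0 (C * c) (exp (t • 𝓛) F) := by
  obtain ⟨Cw, hCw, hW⟩ := exists_wt_gen d hμ
  obtain ⟨Cc, hCc, hcl⟩ := exists_clampJ d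
  set C1 := Cw * (1 + 2 * κ) with hC1
  set C2 := Cw * (1 + (Λ + 4 * κ)) with hC2
  have hC11 : 1 ≤ C1 := by nlinarith
  have hC21 : 1 ≤ C2 := by nlinarith
  set C3 := 4 + 9 * Cc * C1 / r0 with hC3
  have h9 : 0 ≤ 9 * Cc * C1 / r0 := by positivity
  have hC31 : 1 ≤ C3 := by rw [hC3]; linarith
  refine ⟨C2 * C3, by nlinarith, fun ϱ 𝓛 hF hϱ1 r R t h hr hϱ hrR hR2 hh ht htR x0 c F hWt => ?_⟩
  have hR : 0 < R := hr.trans_le hrR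
  have hc := hWt.nonneg hμ.1
  have hRα : R ^ α * R ^ (-α) = 1 := by rw [← Real.rpow_add hR]; simp
  have hmin : ∀ j, min R 1 ≤ rj j → ϱ ≤ rj j := fun j hj => (le_min (hϱ.trans hrR) hϱ1).trans hj
  obtain ⟨ϱ0, hϱ0, hϱ0', m', hm'⟩ := hF.low r hϱ (hrR.trans hR2)
  obtain ⟨m, hm⟩ := hF.gen
  have htN : ∀ N, 0 ≤ N → t * N * R ^ (-α) ≤ N := fun N hN => by
    have : 0 ≤ R ^ (-α) := by positivity
    calc t * N * R ^ (-α) ≤ R ^ α * N * R ^ (-α) := by gcongr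
      _ = N * (R ^ α * R ^ (-α)) := by ring
      _ = N := by rw [hRα, mul_one]
  have hsecond : Wt μ R x0 (C2 * C3 * c) (exp (t • 𝓛) F) := by
    have := hW 𝓛 m Λ R α hm hΛ hR hR2 hα.1 hα.2.le (fun j hj u a hu => hF.blk _ (hmin j hj) (rj_le_one j) u a
      (hu.mono (by norm_num) le_rfl (rj_pos j))) x0 c F t ht hWt
    refine this.mono hR (mul_le_mul_of_nonneg_right ?_ hc)
    have h1 := htN Λ hΛ
    have h2 : Cw * (1 + t * Λ * R ^ (-α)) ≤ C2 := by
      rw [hC2]; refine mul_le_mul_of_nonneg_left ?_ (by linarith); linarith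
    nlinarith
  refine ⟨?_, hsecond⟩
  set S : Op d := J (r0 * r) * J ϱ0 with hS
  have hr0r : 0 < r0 * r := by positivity
  have hr0r' : r0 * r ≤ r := by nlinarith
  have hrhoLe : ϱ0 ≤ r := hϱ0'.trans hϱ
  have hMkS : Mk S := (Mk_J _).mul (Mk_J _)
  have hcS : Commute 𝓛 S := (hF.cJ _).mul_right (hF.cJ _)
  have hcStr : Commute S (tr h) := (J_tr _ h).mul_left (J_tr _ h)
  have hcS1 : Commute (S - 1) (tr h) := hcStr.sub_left (Commute.one_left _)
  set a := κ * t * r ^ (-α) with ha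
  have ha0 : 0 ≤ a := by positivity
  -- weighted bound for exp (u (S-1)) F
  have hSb : ∀ j (u : XX d) (b : ℝ), SmN 3 b (rj j) u → ‖(S - 1) u‖ ≤ 2 * r ^ 2 * b * rj j ^ (-(2:ℝ)) := fun j u b hu => by
    have h1 := JJ_sub_one (rj_pos j) hr0r.le hϱ0 hr0r' hrhoLe (hu.mono (by norm_num : 2 ≤ 3) le_rfl (rj_pos j))
    have e : rj j ^ (-(2:ℝ)) = (rj j ^ 2)⁻¹ := by
      rw [Real.rpow_neg (rj_pos j).le]; norm_num
    rwa [e, ← div_eq_mul_inv]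
  have hw1 : ∀ u ∈ Icc 0 a, Wt μ R x0 (C1 * c) (exp (u • (S - 1)) F) := fun u hu => by
    have := hW (S - 1) 1 (2 * r ^ 2) R 2 hMkS.isGen (by positivity) hR hR2 (by norm_num) le_rfl
      (fun j _ v b hv => hSb j v b hv) x0 c F u hu.1 hWt
    refine this.mono hR (mul_le_mul_of_nonneg_right ?_ hc)
    refine mul_le_mul_of_nonneg_left ?_ (by linarith)
    have h1 : u ≤ κ * R ^ α * r ^ (-α) := hu.2.trans (by rw [ha]; gcongr)
    have h2 : u * (2 * r ^ 2) * R ^ (-(2:ℝ)) ≤ 2 * κ := by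
      have e1 : r ^ 2 = r ^ (2:ℝ) := by norm_num
      have e2 : r ^ (-α) * r ^ (2:ℝ) = r ^ (2 - α) := by rw [← Real.rpow_add hr]; ring_nf
      have e3 : R ^ α * R ^ (-(2:ℝ)) = R ^ (-(2 - α)) := by rw [← Real.rpow_add hR]; ring_nf
      have e4 : r ^ (2 - α) * R ^ (-(2 - α)) ≤ 1 := by
        have : r ^ (2 - α) ≤ R ^ (2 - α) := Real.rpow_le_rpow hr.le hrR (by linarith [hα.2])
        calc r ^ (2 - α) * R ^ (-(2 - α)) ≤ R ^ (2 - α) * R ^ (-(2 - α)) := by gcongr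
          _ = 1 := by rw [← Real.rpow_add hR]; simp
      calc u * (2 * r ^ 2) * R ^ (-(2:ℝ)) ≤ (κ * R ^ α * r ^ (-α)) * (2 * r ^ 2) * R ^ (-(2:ℝ)) := by gcongr
        _ = 2 * κ * ((r ^ (-α) * r ^ (2:ℝ)) * (R ^ α * R ^ (-(2:ℝ)))) := by rw [e1]; ring
        _ = 2 * κ * (r ^ (2 - α) * R ^ (-(2 - α))) := by rw [e2, e3]
        _ ≤ 2 * κ * 1 := by gcongr
        _ = _ := mul_one _
    linarith
  -- difference bound
  have hw2 : Wt μ R x0 (C3 * (Real.exp (-a) + ‖h‖ / r) * c) ((tr h - 1) (exp (a • (S - 1)) F)) := fun x => by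
    have hwx := wh_ge_one (μ := μ) hR x0 x
    have hd := exp_S_diff (S := S) (F := F) (h := h) (x := x) (a := a) (Q := 9 * Cc * C1 / r0 * (‖h‖ / r) * c * wh μ R x0 x)
      ha0 hcStr (fun u hu => by
        have hG := (hw1 u hu).J hμ hR hϱ0 (by linarith : ϱ0 ≤ 2 * R)
        set G := J ϱ0 (exp (u • (S - 1)) F) with hGd
        have e : (tr h - 1 : Op d) (S (exp (u • (S - 1)) F)) x = J (r0 * r) G (x + h) - J (r0 * r) G x := rfl
        rw [e]
        have := hcl (r0 * r) hr0r G x h (3 * (C1 * c) * (3 * wh μ R x0 x)) (fun z hz => by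
          refine (hG _).trans ?_
          refine mul_le_mul_of_nonneg_left ?_ (by positivity)
          exact wh_slow hμ hR x0 x z (by linarith))
        refine this.trans (le_of_eq ?_)
        field_simp
        try ring)
    have h0 := (hWt.diff hμ hR (h := h) (by linarith)) x
    have hE := Real.exp_pos (-a)
    have hq : 0 ≤ ‖h‖ / r := by positivity
    have hcw : 0 ≤ c * wh μ R x0 x := by positivity
    calc _ ≤ _ := hd
      _ ≤ Real.exp (-a) * (4 * c * wh μ R x0 x) + 9 * Cc * C1 / r0 * (‖h‖ / r) * c * wh μ R x0 x := by gcongr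
      _ = (4 * Real.exp (-a) + 9 * Cc * C1 / r0 * (‖h‖ / r)) * (c * wh μ R x0 x) := by ring
      _ ≤ (C3 * (Real.exp (-a) + ‖h‖ / r)) * (c * wh μ R x0 x) := by
        refine mul_le_mul_of_nonneg_right ?_ hcw
        rw [hC3]; nlinarith [mul_nonneg h9 hE.le]
      _ = _ := by ring
  -- apply the remaining part
  have hcB : Commute 𝓛 (S - 1) := hcS.sub_right (Commute.one_right _)
  have hsplit := exp_split hcB t (κ * r ^ (-α))
  have eta' : t * (κ * r ^ (-α)) = a := by rw [ha]; ring
  rw [eta'] at hsplit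
  have hc1 : Commute (𝓛 - (κ * r ^ (-α)) • (S - 1)) (tr h - 1) :=
    ((hF.ctr h).sub_left (hcS1.smul_left _)).sub_right (Commute.one_right _)
  have e1 : (tr h - 1 : Op d) (exp (t • 𝓛) F) =
      exp (t • (𝓛 - (κ * r ^ (-α)) • (S - 1))) ((tr h - 1 : Op d) (exp (a • (S - 1)) F)) := by
    rw [exp_comm_apply hc1, hsplit]; rfl
  rw [e1]
  have := hW (𝓛 - (κ * r ^ (-α)) • (S - 1)) m' (Λ + 4 * κ) R α hm' (by positivity) hR hR2 hα.1 hα.2.le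
    (fun j hj u b hu => by
      have hb : 0 ≤ b := (abs_nonneg _).trans (hu.abs_le 0)
      have hrj := rj_pos j
      have h1 := hF.blk _ (hmin j hj) (rj_le_one j) u b (hu.mono (by norm_num) le_rfl (rj_pos j))
      have h2 := hSb j u b hu
      have e : (𝓛 - (κ * r ^ (-α)) • (S - 1)) u = 𝓛 u - (κ * r ^ (-α)) • ((S - 1) u) := rfl
      rw [e]
      refine (norm_sub_le _ _).trans ?_
      rw [norm_smul, Real.norm_of_nonneg (by positivity)]
      have hr2 : r ≤ 2 * rj j := by
        rcases min_le_iff.1 hj with h | h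
        · linarith
        · linarith
      have h3 : κ * r ^ (-α) * (2 * r ^ 2 * b * rj j ^ (-(2:ℝ))) ≤ 4 * κ * b * rj j ^ (-α) := by
        have e1 : r ^ 2 = r ^ (2:ℝ) := by norm_num
        have e2 : r ^ (-α) * r ^ (2:ℝ) = r ^ (2 - α) := by rw [← Real.rpow_add hr]; ring_nf
        have e3 : r ^ (2 - α) ≤ 2 * rj j ^ (2 - α) := by
          calc r ^ (2 - α) ≤ (2 * rj j) ^ (2 - α) := Real.rpow_le_rpow hr.le hr2 (by linarith [hα.2])
            _ = 2 ^ (2 - α) * rj j ^ (2 - α) := Real.mul_rpow (by norm_num) hrj.le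
            _ ≤ 2 ^ (1:ℝ) * rj j ^ (2 - α) := by
              gcongr
              · norm_num
              · linarith [hα.1]
            _ = _ := by norm_num
        have e4 : rj j ^ (2 - α) * rj j ^ (-(2:ℝ)) = rj j ^ (-α) := by rw [← Real.rpow_add hrj]; ring_nf
        calc κ * r ^ (-α) * (2 * r ^ 2 * b * rj j ^ (-(2:ℝ))) = 2 * κ * b * ((r ^ (-α) * r ^ (2:ℝ)) * rj j ^ (-(2:ℝ))) := by rw [e1]; ring
          _ = 2 * κ * b * (r ^ (2 - α) * rj j ^ (-(2:ℝ))) := by rw [e2]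
          _ ≤ 2 * κ * b * (2 * rj j ^ (2 - α) * rj j ^ (-(2:ℝ))) := by gcongr
          _ = 4 * κ * b * (rj j ^ (2 - α) * rj j ^ (-(2:ℝ))) := by ring
          _ = _ := by rw [e4]
      have h4 : κ * r ^ (-α) * ‖(S - 1) u‖ ≤ 4 * κ * b * rj j ^ (-α) := le_trans (by gcongr) h3
      calc _ ≤ Λ * b * rj j ^ (-α) + 4 * κ * b * rj j ^ (-α) := add_le_add h1 h4
        _ = _ := by ring)
    x0 _ _ t ht hw2
  refine this.mono hR ?_
  have hE := Real.exp_pos (-a)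
  have hq : 0 ≤ ‖h‖ / r := by positivity
  have h1 := htN (Λ + 4 * κ) (by positivity)
  calc _ ≤ Cw * (1 + (Λ + 4 * κ)) * (C3 * (Real.exp (-a) + ‖h‖ / r) * c) := by gcongr
    _ = _ := by rw [hC2]; ring

lemma exp_decay {κ s δ : ℝ} (hκ : 0 < κ) (hs : 0 < s) (hδ : 0 < δ) : ∃ C : ℝ, 1 ≤ C ∧ ∀ X : ℝ, 1 ≤ X →
    Real.exp (-(κ * (X ^ s - 1))) ≤ C * X ^ (-δ) := by
  obtain ⟨n, hn⟩ := exists_nat_ge (δ / s)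
  have hn' : δ ≤ s * n := by rwa [div_le_iff₀ hs, mul_comm] at hn
  refine ⟨1 + Real.exp κ * (n.factorial / κ ^ n), by
    have := Real.exp_pos κ
    have : 0 ≤ Real.exp κ * (n.factorial / κ ^ n) := by positivity
    linarith, fun X hX => ?_⟩
  have hX0 : 0 < X := by linarith
  have h1 := Real.pow_div_factorial_le_exp (κ * X ^ s) (by positivity) n
  have hf : (0:ℝ) < n.factorial := by exact_mod_cast n.factorial_pos
  have e1 : (κ * X ^ s) ^ n = κ ^ n * X ^ (s * n) := by
    rw [mul_pow, ← Real.rpow_natCast (X ^ s), ← Real.rpow_mul hX0.le]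
  rw [e1] at h1
  have h2 : Real.exp (-(κ * X ^ s)) ≤ n.factorial / κ ^ n * X ^ (-(s * n)) := by
    rw [Real.exp_neg, Real.rpow_neg hX0.le]
    have : (Real.exp (κ * X ^ s))⁻¹ ≤ (κ ^ n * X ^ (s * n) / n.factorial)⁻¹ := by
      apply inv_anti₀ _ h1; positivity
    refine this.trans (le_of_eq ?_)
    field_simp
  have h3 : X ^ (-(s * n)) ≤ X ^ (-δ) := Real.rpow_le_rpow_of_exponent_le hX (by linarith)
  have e2 : Real.exp (-(κ * (X ^ s - 1))) = Real.exp κ * Real.exp (-(κ * X ^ s)) := by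
    rw [← Real.exp_add]; ring_nf
  rw [e2]
  have hXd : 0 ≤ X ^ (-δ) := by positivity
  calc _ ≤ Real.exp κ * (n.factorial / κ ^ n * X ^ (-(s * n))) := by gcongr
    _ ≤ Real.exp κ * (n.factorial / κ ^ n * X ^ (-δ)) := by gcongr
    _ ≤ _ := by nlinarith

lemma exp_third (𝓛 : Op d) (t : ℝ) : exp (t • 𝓛) = exp ((t/3) • 𝓛) * (exp ((t/3) • 𝓛) * exp ((t/3) • 𝓛)) := by
  let +nondep : NormedAlgebra ℚ (Op d) := .restrictScalars ℚ ℝ (Op d)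
  rw [← exp_add_of_commute (Commute.refl _), ← exp_add_of_commute]
  · congr 1; module
  · exact (((Commute.refl 𝓛).smul_left _).smul_right _).add_right (((Commute.refl 𝓛).smul_left _).smul_right _)

lemma exists_key (d : ℕ) [NeZero d] {μ α Λ κ r0 : ℝ} (hμ : μ ∈ Ioo (0:ℝ) 1) (hα : α ∈ Ico (1:ℝ) 2) (hΛ : 0 ≤ Λ)
    (hκ : 0 < κ) (hr0 : 0 < r0) (hr01 : r0 ≤ 1) : ∃ C p : ℝ, 1 ≤ C ∧ 1 < p ∧ ∀ (ϱ : ℝ) (𝓛 : Op d), Frz α Λ κ r0 ϱ 𝓛 → ϱ ≤ 1 →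
    ∀ (t : ℝ) (h : Euc d), 0 ≤ t → t ≤ 1 → h ≠ 0 → ϱ ≤ ‖h‖ → ‖h‖ ≤ 1 →
    ∀ (x0 : Euc d) (A N : ℝ) (f F : XX d), (∀ x, |f (x + h) - f x| ≤ A * ‖h‖ ^ μ) →
      0 ≤ N → (∀ x, |F x| ≤ N * wf μ (x - x0)) →
      |D3 h (exp (t • 𝓛) (f + F)) x0| ≤ C * (A + N) * ‖h‖ ^ μ * (‖h‖ ^ α / (t + ‖h‖ ^ α)) ^ p := by
  obtain ⟨Cd, hCd, hds⟩ := exists_dstep d hμ hα hΛ hκ hr0 hr01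
  obtain ⟨hα1, hα2⟩ := hα
  set δ := (1 + max (α / 2) μ) / 2 with hδ
  have hmx : max (α/2) μ < 1 := max_lt (by linarith) hμ.2
  have hδα : α / 2 < δ := by have := le_max_left (α/2) μ; rw [hδ]; linarith
  have hδμ : μ ≤ δ := by have := le_max_right (α/2) μ; rw [hδ]; linarith
  have hδ1 : δ < 1 := by rw [hδ]; linarith
  have hδ0 : 0 < δ := by linarith
  obtain ⟨Ce, hCe, hed⟩ := exp_decay (κ := κ / 3) (s := α * (1 - δ)) (δ := δ) (by positivity)
    (mul_pos (by linarith) (by linarith)) hδ0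
  refine ⟨Cd ^ 3 * (Ce + 1) ^ 3, 2 * δ / α, ?_, ?_, ?_⟩
  · have h1 : 1 ≤ Cd ^ 3 := one_le_pow₀ hCd
    have h2 : 1 ≤ (Ce + 1) ^ 3 := one_le_pow₀ (by linarith)
    nlinarith
  · rw [lt_div_iff₀ (by linarith)]; linarith
  intro ϱ 𝓛 hF hϱ1 t h ht ht1 hh0 hϱh hh1 x0 A N f F hf hN hFN
  have hh : 0 < ‖h‖ := norm_pos_iff.2 hh0
  have hα0 : 0 < α := by linarith
  set R := (t + ‖h‖ ^ α) ^ (α⁻¹) with hRdef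
  have hhα : 0 < ‖h‖ ^ α := by positivity
  have hRα : R ^ α = t + ‖h‖ ^ α := by rw [hRdef, Real.rpow_inv_rpow (by positivity) hα0.ne']
  have hR : 0 < R := by positivity
  have hhR : ‖h‖ ≤ R := by
    rw [← Real.rpow_le_rpow_iff hh.le hR.le hα0, hRα]; linarith
  have hR2 : R ≤ 2 := by
    rw [← Real.rpow_le_rpow_iff hR.le (by norm_num) hα0, hRα]
    have h1 : ‖h‖ ^ α ≤ 1 := Real.rpow_le_one hh.le hh1 hα0.le
    have h2 : (2:ℝ) ^ (1:ℝ) ≤ 2 ^ α := Real.rpow_le_rpow_of_exponent_le (by norm_num) hα1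
    rw [Real.rpow_one] at h2
    linarith
  set X := R / ‖h‖ with hX
  have hX1 : 1 ≤ X := by rw [hX, le_div_iff₀ hh]; linarith
  have hX0 : 0 < X := by linarith
  have hRX : R = X * ‖h‖ := by rw [hX]; field_simp
  set r := X ^ δ * ‖h‖ with hr
  have hr0 : 0 < r := by positivity
  have hXδ : 1 ≤ X ^ δ := Real.one_le_rpow hX1 hδ0.le
  have hhr : ‖h‖ ≤ r := by rw [hr]; nlinarith
  have hXδ' : X ^ δ ≤ X := by
    calc X ^ δ ≤ X ^ (1:ℝ) := Real.rpow_le_rpow_of_exponent_le hX1 hδ1.le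
      _ = X := Real.rpow_one _
  have hrR : r ≤ R := by rw [hr, hRX]; gcongr
  have hhr' : ‖h‖ / r = X ^ (-δ) := by rw [hr, Real.rpow_neg hX0.le]; field_simp
  have htα : t * r ^ (-α) ≥ X ^ (α * (1 - δ)) - 1 := by
    have e1 : t = R ^ α - ‖h‖ ^ α := by rw [hRα]; ring
    have e2 : R ^ α * r ^ (-α) = X ^ (α * (1 - δ)) := by
      rw [hRX, hr, Real.mul_rpow hX0.le hh.le, Real.mul_rpow (by positivity) hh.le, ← Real.rpow_mul hX0.le]
      have : ‖h‖ ^ α * ‖h‖ ^ (-α) = 1 := by rw [← Real.rpow_add hh]; simp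
      calc X ^ α * ‖h‖ ^ α * (X ^ (δ * -α) * ‖h‖ ^ (-α)) = X ^ α * X ^ (δ * -α) * (‖h‖ ^ α * ‖h‖ ^ (-α)) := by ring
        _ = _ := by rw [this, mul_one, ← Real.rpow_add hX0]; ring_nf
    have e3 : ‖h‖ ^ α * r ^ (-α) ≤ 1 := by
      calc ‖h‖ ^ α * r ^ (-α) ≤ r ^ α * r ^ (-α) := by gcongr
        _ = 1 := by rw [← Real.rpow_add hr0]; simp
    rw [e1, sub_mul, e2]; linarith
  set q := Real.exp (-(κ * (t/3) * r ^ (-α))) + ‖h‖ / r with hq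
  have hq0 : 0 ≤ q := by have := Real.exp_pos (-(κ * (t/3) * r ^ (-α))); positivity
  have hqX : q ≤ (Ce + 1) * X ^ (-δ) := by
    rw [hq, hhr']
    have h1 : Real.exp (-(κ * (t/3) * r ^ (-α))) ≤ Real.exp (-(κ / 3 * (X ^ (α * (1 - δ)) - 1))) := by
      rw [Real.exp_le_exp]
      have : κ / 3 * (X ^ (α * (1 - δ)) - 1) ≤ κ / 3 * (t * r ^ (-α)) := by gcongr
      linarith
    linarith [hed X hX1]
  have ht3 : t / 3 ≤ R ^ α := by rw [hRα]; linarith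
  have step := hds ϱ 𝓛 hF hϱ1 r R (t/3) h hr0 (hϱh.trans hhr) hrR hR2 hhr (by linarith) ht3 x0
  set P := exp ((t/3) • 𝓛) with hP
  have hcP : ∀ w : XX d, P ((tr h - 1) w) = (tr h - 1) (P w) := fun w =>
    exp_comm_apply ((hF.ctr h).sub_right (Commute.one_right _)) _ w
  have hD : ∀ w : XX d, D3 h (exp (t • 𝓛) w) = (tr h - 1) (P ((tr h - 1) (P ((tr h - 1) (P w))))) := fun w => by
    rw [exp_third]
    change (tr h - 1) ((tr h - 1) ((tr h - 1) (P (P (P w))))) = _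
    simp only [hcP]
  have hA0 : 0 ≤ A := by
    have := (abs_nonneg _).trans (hf 0)
    exact nonneg_of_mul_nonneg_left this (by positivity)
  have b1 : |D3 h (exp (t • 𝓛) f) x0| ≤ Cd * q * (Cd * q * (Cd * (A * ‖h‖ ^ μ))) := by
    have w0 : Wt μ R x0 (A * ‖h‖ ^ μ) ((tr h - 1) f) := fun x => by
      refine (hf x).trans ?_
      have := wh_ge_one (μ := μ) hR x0 x
      have : 0 ≤ A * ‖h‖ ^ μ := by positivity
      nlinarith
    have w1 := (step _ _ w0).2
    rw [hcP] at w1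
    have w2 := (step _ _ w1).1
    have w3 := (step _ _ w2).1 x0
    rw [wh_self hμ.1, mul_one] at w3
    rw [hD]; exact w3
  have b2 : |D3 h (exp (t • 𝓛) F) x0| ≤ Cd * q * (Cd * q * (Cd * q * (N * R ^ μ))) := by
    have w0 : Wt μ R x0 (N * R ^ μ) F := fun x => by
      refine (hFN x).trans ?_
      unfold wh
      have hRμ : 0 < R ^ μ := by positivity
      have : N * R ^ μ * (1 + wf μ (x - x0) / R ^ μ) = N * R ^ μ + N * wf μ (x - x0) := by field_simp
      rw [this]
      have : 0 ≤ N * R ^ μ := by positivity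
      linarith
    have w1 := (step _ _ w0).1
    have w2 := (step _ _ w1).1
    have w3 := (step _ _ w2).1 x0
    rw [wh_self hμ.1, mul_one] at w3
    rw [hD]; exact w3
  have hYp : (‖h‖ ^ α / (t + ‖h‖ ^ α)) ^ (2 * δ / α) = X ^ (-δ) * X ^ (-δ) := by
    rw [← hRα, ← Real.div_rpow hh.le hR.le, ← Real.rpow_mul (by positivity), ← Real.rpow_add hX0]
    have : ‖h‖ / R = X⁻¹ := by rw [hX, inv_div]
    rw [this, Real.inv_rpow hX0.le, ← Real.rpow_neg hX0.le]
    congr 1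
    field_simp
    ring
  rw [hYp, map_add, map_add, BoundedContinuousFunction.add_apply]
  have hXn : 0 ≤ X ^ (-δ) := by positivity
  have hC0 : 0 < Ce + 1 := by linarith
  have b1' : Cd * q * (Cd * q * (Cd * (A * ‖h‖ ^ μ))) ≤ Cd ^ 3 * (Ce + 1) ^ 3 * A * ‖h‖ ^ μ * (X ^ (-δ) * X ^ (-δ)) := by
    calc Cd * q * (Cd * q * (Cd * (A * ‖h‖ ^ μ))) = Cd ^ 3 * A * ‖h‖ ^ μ * (q * q) := by ring
      _ ≤ Cd ^ 3 * A * ‖h‖ ^ μ * (((Ce + 1) * X ^ (-δ)) * ((Ce + 1) * X ^ (-δ))) := by gcongr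
      _ = (Ce + 1) ^ 2 * (Cd ^ 3 * A * ‖h‖ ^ μ * (X ^ (-δ) * X ^ (-δ))) := by ring
      _ ≤ (Ce + 1) ^ 3 * (Cd ^ 3 * A * ‖h‖ ^ μ * (X ^ (-δ) * X ^ (-δ))) := by
        gcongr
        · linarith
        · norm_num
      _ = _ := by ring
  have b2' : Cd * q * (Cd * q * (Cd * q * (N * R ^ μ))) ≤ Cd ^ 3 * (Ce + 1) ^ 3 * N * ‖h‖ ^ μ * (X ^ (-δ) * X ^ (-δ)) := by
    have e1 : R ^ μ = X ^ μ * ‖h‖ ^ μ := by rw [hRX, Real.mul_rpow hX0.le hh.le]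
    have e2 : X ^ (-δ) * X ^ μ ≤ 1 := by
      rw [← Real.rpow_add hX0]; exact Real.rpow_le_one_of_one_le_of_nonpos hX1 (by linarith)
    calc Cd * q * (Cd * q * (Cd * q * (N * R ^ μ))) = Cd ^ 3 * N * (X ^ μ * ‖h‖ ^ μ) * (q * q * q) := by rw [e1]; ring
      _ ≤ Cd ^ 3 * N * (X ^ μ * ‖h‖ ^ μ) * (((Ce + 1) * X ^ (-δ)) * ((Ce + 1) * X ^ (-δ)) * ((Ce + 1) * X ^ (-δ))) := by gcongr
      _ = Cd ^ 3 * (Ce + 1) ^ 3 * N * ‖h‖ ^ μ * (X ^ (-δ) * X ^ (-δ)) * (X ^ (-δ) * X ^ μ) := by ring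
      _ ≤ Cd ^ 3 * (Ce + 1) ^ 3 * N * ‖h‖ ^ μ * (X ^ (-δ) * X ^ (-δ)) * 1 := by gcongr
      _ = _ := by ring
  refine (abs_add_le _ _).trans ?_
  calc _ ≤ _ := add_le_add (b1.trans b1') (b2.trans b2')
    _ = _ := by ring

end frozen

/-! ## Part 8 -/
open scoped BoundedContinuousFunction ContDiff
set_option linter.unusedSectionVars false
set_option linter.unusedVariables false

section apriori
variable {d : ℕ}
open NormedSpace

structure Fam [NeZero d] (μ α Λ κ r0 ϱ m : ℝ) (𝓛 : Euc d → Op d) (L : Op d) : Prop where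
  pos : 0 < ϱ
  small : ϱ ≤ 1 / 4
  frz : ∀ x, Frz α Λ κ r0 ϱ (𝓛 x)
  gen : ∀ x, IsGen (𝓛 x) m
  Lgen : IsGen L m
  Leq : ∀ u x, L u x = 𝓛 x u x
  mle : m ≤ Λ * ϱ ^ (-α)
  reg : ∀ x x' r, ϱ ≤ r → r ≤ 1 → ∀ (u : XX d) (a : ℝ), SmN 2 a r u →
    ‖𝓛 x u - 𝓛 x' u‖ ≤ Λ * wf μ (x - x') * a * r ^ (-α)
  reg' : ∀ x x' (u : XX d), ‖𝓛 x u - 𝓛 x' u‖ ≤ Λ * wf μ (x - x') * ϱ ^ (-α) * ‖u‖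

variable [NeZero d]

lemma split_sum {α μ : ℝ} (hμ : 0 < μ) (θ : ℝ) (hθ : 0 < θ) : ∃ Cθ : ℝ, 0 ≤ Cθ ∧
    ∀ (a M : ℝ), 0 ≤ a → 0 ≤ M → ∀ n : ℕ,
    ∑ j ∈ Finset.range n, rj j ^ (-α) * min a (M * rj j ^ (α + μ)) ≤ Cθ * a + θ * M := by
  have hsum := rj_summable (μ/2) (by linarith)
  set T := ∑' j, rj j ^ (μ/2) with hT
  have hT0 : 0 ≤ T := tsum_nonneg fun j => by have := rj_pos j; positivity
  obtain ⟨J, hJ⟩ : ∃ J, rj J ^ (μ/2) * (T + 1) ≤ θ := by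
    have h1 := (rj_tendsto (μ/2) (by linarith)).eventually (ge_mem_nhds (show (0:ℝ) < θ / (T+1) by positivity))
    obtain ⟨J, hJ⟩ := h1.exists
    exact ⟨J, by rwa [le_div_iff₀ (by positivity)] at hJ⟩
  refine ⟨∑ j ∈ Finset.range J, rj j ^ (-α), Finset.sum_nonneg fun j _ => by have := rj_pos j; positivity,
    fun a M ha hM n => ?_⟩
  have key : ∀ j, rj j ^ (-α) * min a (M * rj j ^ (α + μ)) ≤
      (if j < J then rj j ^ (-α) * a else 0) + M * (rj J ^ (μ/2) * rj j ^ (μ/2)) := fun j => by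
    have hp := rj_pos j
    have hpJ := rj_pos J
    split_ifs with hj
    · have : rj j ^ (-α) * min a (M * rj j ^ (α + μ)) ≤ rj j ^ (-α) * a := by gcongr; exact min_le_left _ _
      have : 0 ≤ M * (rj J ^ (μ/2) * rj j ^ (μ/2)) := by positivity
      linarith
    · rw [zero_add]
      have h1 : rj j ≤ rj J := by
        unfold rj; exact pow_le_pow_of_le_one (by norm_num) (by norm_num) (by omega)
      have e1 : rj j ^ (-α) * rj j ^ (α + μ) = rj j ^ (μ/2) * rj j ^ (μ/2) := by
        rw [← Real.rpow_add hp, ← Real.rpow_add hp]; ring_nf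
      calc rj j ^ (-α) * min a (M * rj j ^ (α + μ)) ≤ rj j ^ (-α) * (M * rj j ^ (α + μ)) := by
            gcongr; exact min_le_right _ _
        _ = M * (rj j ^ (-α) * rj j ^ (α + μ)) := by ring
        _ = M * (rj j ^ (μ/2) * rj j ^ (μ/2)) := by rw [e1]
        _ ≤ _ := by gcongr
  refine (Finset.sum_le_sum fun j _ => key j).trans ?_
  rw [Finset.sum_add_distrib, ← Finset.mul_sum, ← Finset.mul_sum]
  refine add_le_add ?_ ?_
  · rw [← Finset.sum_filter, ← Finset.sum_mul]
    refine mul_le_mul_of_nonneg_right ?_ ha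
    refine Finset.sum_le_sum_of_subset_of_nonneg ?_ fun j _ _ => by have := rj_pos j; positivity
    intro j hj
    exact Finset.mem_range.2 (Finset.mem_filter.1 hj).2
  · rw [mul_comm θ M]
    refine mul_le_mul_of_nonneg_left (le_trans ?_ hJ) hM
    have := hsum.sum_le_tsum (Finset.range n) (fun j _ => by have := rj_pos j; positivity)
    have hpJ := rj_pos J
    have : 0 ≤ rj J ^ (μ/2) := by positivity
    gcongr
    linarith

lemma decomp (B : Op d) (w : XX d) (n : ℕ) :
    ‖B w‖ ≤ ∑ j ∈ Finset.range (n+1), ‖B (Qb j w)‖ + ‖B (w - TT (rj n) (TT (rj n) w))‖ := by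
  have e : w = ∑ j ∈ Finset.range (n+1), Qb j w + (w - TT (rj n) (TT (rj n) w)) := by
    have := congrArg (fun T : Op d => T w) (sum_Qb (d := d) n)
    simp only [_root_.sum_apply] at this
    change _ = TT (rj n) (TT (rj n) w) at this
    rw [this]; abel
  conv_lhs => rw [e, map_add, map_sum]
  exact (norm_add_le _ _).trans (add_le_add (norm_sum_le _ _) le_rfl)

lemma scale4 {ϱ : ℝ} (h : 0 < ϱ) (h' : ϱ ≤ 1/4) : ∃ n, 2 * ϱ ≤ rj n ∧ rj n ≤ 4 * ϱ := by
  obtain ⟨n, h1, h2⟩ := exists_scale (R := 2 * ϱ) (by linarith) (by linarith)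
  exact ⟨n, h1, by linarith⟩

lemma rj_anti {i j : ℕ} (h : i ≤ j) : rj j ≤ rj i := pow_le_pow_of_le_one (by norm_num) (by norm_num) h

lemma rho_pow_le {α ϱ r : ℝ} (hα : α ∈ Icc (0:ℝ) 2) (h : 0 < ϱ) (hr : 0 < r) (h4 : r ≤ 4 * ϱ) : ϱ ^ (-α) ≤ 16 * r ^ (-α) := by
  have h1 : r / 4 ≤ ϱ := by linarith
  have h2 : ϱ ^ (-α) ≤ (r/4) ^ (-α) := Real.rpow_le_rpow_of_nonpos (by linarith) h1 (by linarith [hα.1])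
  refine h2.trans ?_
  rw [Real.div_rpow hr.le (by norm_num), div_eq_mul_inv, ← Real.rpow_neg (by norm_num), neg_neg, mul_comm]
  have : (4:ℝ) ^ α ≤ 4 ^ (2:ℝ) := Real.rpow_le_rpow_of_exponent_le (by norm_num) hα.2
  have h3 : (4:ℝ) ^ (2:ℝ) = 16 := by norm_num
  rw [h3] at this
  gcongr

/-- general bound of an operator of order α on a truncated Zygmund function -/
lemma exists_opbound (d : ℕ) [NeZero d] : ∃ C : ℝ, 1 ≤ C ∧ ∀ (α β ϱ : ℝ), α ∈ Icc (0:ℝ) 2 → β ∈ Ioo (0:ℝ) 3 → 0 < ϱ → ϱ ≤ 1/4 →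
    ∃ n : ℕ, ∀ (B : Op d) (N : ℝ), 0 ≤ N →
    (∀ r, ϱ ≤ r → r ≤ 1 → ∀ (u : XX d) (a : ℝ), SmN 2 a r u → ‖B u‖ ≤ N * a * r ^ (-α)) →
    (∀ u : XX d, ‖B u‖ ≤ N * ϱ ^ (-α) * ‖u‖) → ∀ (M : ℝ) (w : XX d), Zyg β ϱ M w →
    ‖B w‖ ≤ C * N * ∑ j ∈ Finset.range n, rj j ^ (-α) * min ‖w‖ (M * rj j ^ β) := by
  obtain ⟨C, hC, hb⟩ := exists_blocks d
  refine ⟨17 * C, by linarith, fun α β ϱ hα hβ hϱ hϱ4 => ?_⟩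
  obtain ⟨n, hn1, hn2⟩ := scale4 hϱ hϱ4
  refine ⟨n + 1, fun B N hN hB hB' M w hw => ?_⟩
  have hM := hw.nonneg
  set F : ℕ → ℝ := fun j => rj j ^ (-α) * min ‖w‖ (M * rj j ^ β) with hF
  have hF0 : ∀ j, 0 ≤ F j := fun j => by
    have := rj_pos j
    have : 0 ≤ min ‖w‖ (M * rj j ^ β) := le_min (norm_nonneg _) (by positivity)
    positivity
  refine (decomp B w n).trans ?_
  have h1 : ∑ j ∈ Finset.range (n+1), ‖B (Qb j w)‖ ≤ C * N * ∑ j ∈ Finset.range (n+1), F j := by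
    rw [Finset.mul_sum]
    refine Finset.sum_le_sum fun j hj => ?_
    have hj' : 2 * ϱ ≤ rj j := hn1.trans (rj_anti (by have := Finset.mem_range.1 hj; omega))
    have := hB (rj j) (by linarith) (rj_le_one j) _ _ ((hb β ϱ M hβ w hw j hj').1.mono (by norm_num) le_rfl (rj_pos j))
    refine this.trans (le_of_eq ?_)
    simp only [hF]; ring
  have h2 : ‖B (w - TT (rj n) (TT (rj n) w))‖ ≤ 16 * C * N * ∑ j ∈ Finset.range (n+1), F j := by
    have h3 := (hb β ϱ M hβ w hw n hn1).2.1
    have h4 := rho_pow_le hα hϱ (rj_pos n) hn2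
    have h5 : F n ≤ ∑ j ∈ Finset.range (n+1), F j :=
      Finset.single_le_sum (fun j _ => hF0 j) (Finset.mem_range.2 (by omega))
    have hmin : 0 ≤ C * min ‖w‖ (M * rj n ^ β) := (norm_nonneg _).trans h3
    have hrn := rj_pos n
    calc _ ≤ N * ϱ ^ (-α) * ‖w - TT (rj n) (TT (rj n) w)‖ := hB' _
      _ ≤ N * (16 * rj n ^ (-α)) * (C * min ‖w‖ (M * rj n ^ β)) := by gcongr
      _ = 16 * C * N * F n := by simp only [hF]; ring
      _ ≤ _ := by gcongr
  linarith

lemma Fam.fz {μ α Λ κ r0 ϱ m : ℝ} {𝓛 : Euc d → Op d} {L : Op d} (h : Fam μ α Λ κ r0 ϱ m 𝓛 L) (w : XX d) (x x0 : Euc d) :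
    (L - 𝓛 x0) w x = (𝓛 x - 𝓛 x0) w x := by
  change L w x - 𝓛 x0 w x = 𝓛 x w x - 𝓛 x0 w x
  rw [h.Leq]

lemma exists_freeze (d : ℕ) [NeZero d] {μ α Λ : ℝ} (hμ : μ ∈ Ioo (0:ℝ) 1) (hα : α ∈ Ico (1:ℝ) 2) (hΛ : 0 ≤ Λ) (θ : ℝ) (hθ : 0 < θ) :
    ∃ Cθ : ℝ, 0 ≤ Cθ ∧ ∀ κ r0 ϱ m (𝓛 : Euc d → Op d) (L : Op d), Fam μ α Λ κ r0 ϱ m 𝓛 L →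
    ∀ (M : ℝ) (w : XX d), Zyg (α + μ) ϱ M w → ∀ x x0, ‖(𝓛 x - 𝓛 x0) w‖ ≤ (Cθ * ‖w‖ + θ * M) * wf μ (x - x0) := by
  obtain ⟨C, hC, hop⟩ := exists_opbound d
  obtain ⟨Cs, hCs, hs⟩ := split_sum (α := α) hμ.1 (θ / (C * (Λ + 1))) (by positivity)
  refine ⟨C * Λ * Cs, by positivity, fun κ r0 ϱ m 𝓛 L h M w hw x x0 => ?_⟩
  obtain ⟨n, hn⟩ := hop α (α + μ) ϱ ⟨by linarith [hα.1], hα.2.le⟩ ⟨by linarith [hα.1, hμ.1], by linarith [hα.2, hμ.2]⟩ h.pos h.small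
  have hwf := wf_nonneg (μ := μ) (x - x0)
  have := hn (𝓛 x - 𝓛 x0) (Λ * wf μ (x - x0)) (by positivity) (fun r hr hr1 u a hu => h.reg x x0 r hr hr1 u a hu)
    (fun u => h.reg' x x0 u) M w hw
  refine this.trans ?_
  have h2 := hs ‖w‖ M (norm_nonneg _) hw.nonneg n
  have hM := hw.nonneg
  have h3 : C * Λ * (θ / (C * (Λ + 1)) * M) ≤ θ * M := by
    have : C * Λ * (θ / (C * (Λ + 1)) * M) = (Λ / (Λ + 1)) * (θ * M) := by field_simp
    rw [this]
    have h4 : Λ / (Λ + 1) ≤ 1 := by rw [div_le_one (by positivity)]; linarith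
    have : 0 ≤ θ * M := by positivity
    nlinarith
  calc _ ≤ C * (Λ * wf μ (x - x0)) * (Cs * ‖w‖ + θ / (C * (Λ + 1)) * M) := by gcongr
    _ = (C * Λ * Cs * ‖w‖ + C * Λ * (θ / (C * (Λ + 1)) * M)) * wf μ (x - x0) := by ring
    _ ≤ _ := by gcongr

/-- Duhamel integral estimate -/
lemma duhamel_int {φ φ' : ℝ → ℝ} {τ K H p : ℝ} (hτ : 0 ≤ τ) (hK : 0 ≤ K) (hH : 0 < H) (hp : 1 < p) (h0 : φ 0 = 0)
    (hd : ∀ σ, HasDerivAt φ (φ' σ) σ) (hb : ∀ σ ∈ Icc 0 τ, |φ' σ| ≤ K * (H / (τ - σ + H)) ^ p) :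
    |φ τ| ≤ K * H / (p - 1) := by
  have hB : ∀ σ ∈ Icc 0 τ, HasDerivAt (fun σ => K * H ^ p / (p - 1) * (τ - σ + H) ^ (1 - p)) (K * (H / (τ - σ + H)) ^ p) σ := fun σ hσ => by
    have hpos : 0 < τ - σ + H := by linarith [hσ.2]
    have h1 : HasDerivAt (fun σ : ℝ => τ - σ + H) (-1) σ := by
      simpa using ((hasDerivAt_id σ).const_sub τ).add_const H
    have h2 := (h1.rpow_const (p := 1 - p) (Or.inl hpos.ne')).const_mul (K * H ^ p / (p - 1))
    refine HasDerivAt.congr_deriv h2 ?_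
    rw [Real.div_rpow hH.le hpos.le, show (1 - p - 1) = -p by ring, Real.rpow_neg hpos.le]
    have : p - 1 ≠ 0 := by linarith
    have : (τ - σ + H) ^ p ≠ 0 := by positivity
    field_simp
    ring
  have hp1 : 0 < p - 1 := by linarith
  have := image_norm_le_of_norm_deriv_right_le_deriv_boundary' (f := φ) (a := 0) (b := τ) (f' := φ')
    (B := fun σ => K * H ^ p / (p - 1) * (τ - σ + H) ^ (1 - p)) (B' := fun σ => K * (H / (τ - σ + H)) ^ p)
    (fun u _ => (hd u).continuousAt.continuousWithinAt) (fun u _ => (hd u).hasDerivWithinAt)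
    (by rw [h0, norm_zero]; positivity) (fun σ hσ => (hB σ hσ).continuousAt.continuousWithinAt)
    (fun σ hσ => (hB σ ⟨hσ.1, hσ.2.le⟩).hasDerivWithinAt) (fun σ hσ => hb σ ⟨hσ.1, hσ.2.le⟩) ⟨hτ, le_rfl⟩
  refine this.trans (le_of_eq ?_)
  rw [sub_self, zero_add]
  have : H ^ p * H ^ (1 - p) = H := by rw [← Real.rpow_add hH]; simp
  calc _ = K / (p - 1) * (H ^ p * H ^ (1 - p)) := by ring
    _ = _ := by rw [this]; ring

def HolX (μ A : ℝ) (f : XX d) : Prop := ‖f‖ ≤ A ∧ ∀ x h, |f (x + h) - f x| ≤ A * ‖h‖ ^ μ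

lemma exists_apriori_step (d : ℕ) [NeZero d] {μ α Λ κ r0 : ℝ} (hμ : μ ∈ Ioo (0:ℝ) 1) (hα : α ∈ Ico (1:ℝ) 2) (hΛ : 0 ≤ Λ)
    (hκ : 0 < κ) (hr0 : 0 < r0) (hr01 : r0 ≤ 1) : ∃ C : ℝ, 1 ≤ C ∧ ∀ ϱ m (𝓛 : Euc d → Op d) (L : Op d), Fam μ α Λ κ r0 ϱ m 𝓛 L →
    ∀ A (f : XX d), HolX μ A f → ∀ M, (∀ τ ∈ Icc (0:ℝ) 1, Zyg (α + μ) ϱ M (solV L f τ)) →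
      ∀ τ ∈ Icc (0:ℝ) 1, Zyg (α + μ) ϱ (C * A + M / 2) (solV L f τ) := by
  obtain ⟨Ck, p, hCk, hp, hkey⟩ := exists_key d hμ hα hΛ hκ hr0 hr01
  set K := Ck / (p - 1) with hK
  have hp1 : 0 < p - 1 := by linarith
  have hK0 : 0 < K := by positivity
  obtain ⟨Cθ, hCθ, hfz⟩ := exists_freeze d hμ hα hΛ (1 / (2 * K)) (by positivity)
  refine ⟨8 + K * (1 + Cθ), by nlinarith, fun ϱ m 𝓛 L h A f hf M hM τ hτ => ?_⟩
  have hA : 0 ≤ A := (norm_nonneg _).trans hf.1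
  have hM0 : 0 ≤ M := (hM τ hτ).nonneg
  have hVA : ∀ σ ∈ Icc (0:ℝ) 1, ‖solV L f σ‖ ≤ A := fun σ hσ => by
    have := h.Lgen.solV_norm f hσ.1
    have h1 := hf.1
    nlinarith [hσ.1, hσ.2, norm_nonneg f]
  have hKC : 0 ≤ K * (1 + Cθ) * A := by positivity
  refine ⟨(hVA τ hτ).trans (by nlinarith), fun k hk => XX.norm_le_of fun x0 => ?_⟩
  have hk0 : 0 < ‖k‖ := h.pos.trans_le hk
  have hkβ : 0 < ‖k‖ ^ (α + μ) := by positivity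
  rcases le_total ‖k‖ 1 with hk1 | hk1
  · set N := Cθ * A + 1 / (2 * K) * M with hN
    have hN0 : 0 ≤ N := by positivity
    have hdu := duhamel_int (φ := fun σ => D3 k (exp ((τ - σ) • 𝓛 x0) (solV L f σ)) x0)
      (φ' := fun σ => D3 k (exp ((τ - σ) • 𝓛 x0) (L (solV L f σ) + f - 𝓛 x0 (solV L f σ))) x0)
      (τ := τ) (K := Ck * (A + N) * ‖k‖ ^ μ) (H := ‖k‖ ^ α) (p := p) hτ.1 (by positivity) (by positivity) hp
      (by simp [solV_zero]) (fun σ => by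
        have h1 := duhamel_deriv (𝓛 x0) (τ := τ) (solV_deriv L f σ)
        exact apply_deriv ((D3 k).hasFDerivAt.comp_hasDerivAt σ h1) x0) (fun σ hσ => by
        have hσ1 : σ ∈ Icc (0:ℝ) 1 := ⟨hσ.1, hσ.2.trans hτ.2⟩
        have e : L (solV L f σ) + f - 𝓛 x0 (solV L f σ) = f + (L - 𝓛 x0) (solV L f σ) := by
          change _ = f + (L (solV L f σ) - 𝓛 x0 (solV L f σ)); abel
        beta_reduce
        rw [e]
        refine hkey ϱ (𝓛 x0) (h.frz x0) (by linarith [h.small]) (τ - σ) k (by linarith [hσ.2]) (by linarith [hσ.1, hτ.2])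
          (norm_pos_iff.1 hk0) hk hk1 x0 A N f _ (fun x => hf.2 x k) hN0 (fun x => ?_)
        rw [h.fz]
        refine ((XX.abs_le _ _).trans (hfz κ r0 ϱ m 𝓛 L h M _ (hM σ hσ1) x x0)).trans ?_
        refine mul_le_mul_of_nonneg_right ?_ (wf_nonneg _)
        have := hVA σ hσ1
        rw [hN]; gcongr)
    simp only [sub_self, zero_smul, exp_zero] at hdu
    change |D3 k (solV L f τ) x0| ≤ _ at hdu
    refine hdu.trans ?_
    have e1 : Ck * (A + N) * ‖k‖ ^ μ * ‖k‖ ^ α / (p - 1) = K * (A + N) * ‖k‖ ^ (α + μ) := by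
      rw [Real.rpow_add hk0, hK]; ring
    rw [e1]
    refine mul_le_mul_of_nonneg_right ?_ hkβ.le
    have e2 : K * (A + N) = K * (1 + Cθ) * A + M / 2 := by rw [hN]; field_simp; ring
    rw [e2]; nlinarith
  · refine ((XX.abs_le _ _).trans (D3_norm_le k _)).trans ?_
    have h1 := hVA τ hτ
    have h2 : 1 ≤ ‖k‖ ^ (α + μ) := Real.one_le_rpow hk1 (by linarith [hα.1, hμ.1])
    have h3 : 8 * A ≤ (8 + K * (1 + Cθ)) * A + M / 2 := by nlinarith
    nlinarith

lemma exists_apriori (d : ℕ) [NeZero d] {μ α Λ κ r0 : ℝ} (hμ : μ ∈ Ioo (0:ℝ) 1) (hα : α ∈ Ico (1:ℝ) 2) (hΛ : 0 ≤ Λ)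
    (hκ : 0 < κ) (hr0 : 0 < r0) (hr01 : r0 ≤ 1) : ∃ C : ℝ, 1 ≤ C ∧ ∀ ϱ m (𝓛 : Euc d → Op d) (L : Op d), Fam μ α Λ κ r0 ϱ m 𝓛 L →
    ∀ A (f : XX d), HolX μ A f → ∀ τ ∈ Icc (0:ℝ) 1, Zyg (α + μ) ϱ (C * A) (solV L f τ) := by
  obtain ⟨C, hC, hstep⟩ := exists_apriori_step d hμ hα hΛ hκ hr0 hr01
  refine ⟨2 * C, by linarith, fun ϱ m 𝓛 L h A f hf => ?_⟩
  have hA : 0 ≤ A := (norm_nonneg _).trans hf.1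
  have hϱ := h.pos
  have hϱβ : 0 < ϱ ^ (α + μ) := by positivity
  set M0 := A + 8 * A / ϱ ^ (α + μ) with hM0
  have hM00 : 0 ≤ M0 := by positivity
  have hCA : 0 ≤ C * A := by positivity
  have base : ∀ τ ∈ Icc (0:ℝ) 1, Zyg (α + μ) ϱ M0 (solV L f τ) := fun τ hτ => by
    have hV : ‖solV L f τ‖ ≤ A := by
      have := h.Lgen.solV_norm f hτ.1
      have h1 := hf.1
      nlinarith [hτ.1, hτ.2, norm_nonneg f]
    refine ⟨hV.trans ?_, fun k hk => ?_⟩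
    · have : 0 ≤ 8 * A / ϱ ^ (α + μ) := by positivity
      linarith
    · refine (D3_norm_le k _).trans ?_
      have h1 : ϱ ^ (α + μ) ≤ ‖k‖ ^ (α + μ) := Real.rpow_le_rpow hϱ.le hk (by linarith [hα.1, hμ.1])
      calc 8 * ‖solV L f τ‖ ≤ 8 * A := by linarith
        _ = 8 * A / ϱ ^ (α + μ) * ϱ ^ (α + μ) := by field_simp
        _ ≤ M0 * ϱ ^ (α + μ) := by gcongr; linarith
        _ ≤ M0 * ‖k‖ ^ (α + μ) := by gcongr
  have iter : ∀ n : ℕ, ∀ τ ∈ Icc (0:ℝ) 1, Zyg (α + μ) ϱ (2 * C * A + M0 * (1/2)^n) (solV L f τ) := by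
    intro n
    induction n with
    | zero =>
      intro τ hτ
      obtain ⟨h1, h2⟩ := base τ hτ
      refine ⟨by rw [pow_zero]; nlinarith, fun k hk => (h2 k hk).trans ?_⟩
      gcongr
      rw [pow_zero]; nlinarith
    | succ n ih =>
      intro τ hτ
      have := hstep ϱ m 𝓛 L h A f hf _ ih τ hτ
      have e : C * A + (2 * C * A + M0 * (1/2)^n) / 2 = 2 * C * A + M0 * (1/2)^(n+1) := by rw [pow_succ]; ring
      rwa [e] at this
  intro τ hτ
  have hlim : Filter.Tendsto (fun n : ℕ => 2 * C * A + M0 * (1/2 : ℝ)^n) Filter.atTop (nhds (2 * C * A)) := by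
    have := (tendsto_pow_atTop_nhds_zero_of_lt_one (r := (1/2:ℝ)) (by norm_num) (by norm_num)).const_mul M0
    simpa using this.const_add (2 * C * A)
  exact ⟨ge_of_tendsto' hlim fun n => (iter n τ hτ).1,
    fun k hk => ge_of_tendsto' (hlim.mul_const _) fun n => (iter n τ hτ).2 k hk⟩

lemma tr_sub_norm (h : Euc d) (u : XX d) : ‖(tr h - 1 : Op d) u‖ ≤ 2 * ‖u‖ := XX.norm_le_of fun x => by
  change |u (x + h) - u x| ≤ _
  have h1 := XX.abs_le u (x + h)
  have h2 := XX.abs_le u x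
  refine (abs_sub _ _).trans (by linarith)

lemma exists_LV (d : ℕ) [NeZero d] {μ α Λ : ℝ} (hμ : μ ∈ Ioo (0:ℝ) 1) (hα : α ∈ Ico (1:ℝ) 2) (hΛ : 0 ≤ Λ) :
    ∃ C : ℝ, 1 ≤ C ∧ ∀ κ r0 ϱ m (𝓛 : Euc d → Op d) (L : Op d), Fam μ α Λ κ r0 ϱ m 𝓛 L →
    ∀ (M : ℝ) (w : XX d), Zyg (α + μ) ϱ M w →
      ‖L w‖ ≤ C * M ∧ ∀ x k, ϱ ≤ ‖k‖ → |L w (x + k) - L w x| ≤ C * M * ‖k‖ ^ μ := by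
  obtain ⟨C, hC, hop⟩ := exists_opbound d
  obtain ⟨Cb, hCb, hb⟩ := exists_blocks d
  obtain ⟨Cs, hCs, hs⟩ := split_sum (α := α) hμ.1 1 one_pos
  obtain ⟨Cf, hCf, hfz⟩ := exists_freeze d hμ hα hΛ 1 one_pos
  obtain ⟨Cd, hCd, hdy⟩ := dyadic_sum hμ
  set C1 := C * (2 * Λ) * (Cs + 1) with hC1
  set C2 := (Cf + 1) + 2 * Λ * Cb * Cd + 256 * Λ * Cb with hC2
  have hC10 : 0 ≤ C1 := by positivity
  have hC20 : 1 ≤ C2 := by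
    have : 0 ≤ 2 * Λ * Cb * Cd + 256 * Λ * Cb := by positivity
    rw [hC2]; linarith
  refine ⟨C1 + C2, by linarith, fun κ r0 ϱ m 𝓛 L h M w hw => ?_⟩
  have hM := hw.nonneg
  have hβ : α + μ ∈ Ioo (0:ℝ) 3 := ⟨by linarith [hα.1, hμ.1], by linarith [hα.2, hμ.2]⟩
  have hα2 : α ∈ Icc (0:ℝ) 2 := ⟨by linarith [hα.1], hα.2.le⟩
  have hϱ := h.pos
  have hϱα : 0 < ϱ ^ (-α) := by positivity
  have hsup : ∀ x, ∀ u : XX d, ‖𝓛 x u‖ ≤ 2 * Λ * ϱ ^ (-α) * ‖u‖ := fun x u => by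
    refine ((h.gen x).norm_apply_le u).trans ?_
    have := h.mle
    have := norm_nonneg u
    nlinarith
  constructor
  · refine XX.norm_le_of fun x => ?_
    rw [h.Leq]
    refine (XX.abs_le _ _).trans ?_
    obtain ⟨n, hn⟩ := hop α (α + μ) ϱ hα2 hβ h.pos h.small
    have h1 := hn (𝓛 x) (2 * Λ) (by positivity) (fun r hr hr1 u a hu => by
      refine ((h.frz x).blk r hr hr1 u a hu).trans ?_
      have ha : 0 ≤ a := (abs_nonneg _).trans (hu.abs_le 0)
      have hr0 : 0 < r := hϱ.trans_le hr
      have : 0 ≤ r ^ (-α) := by positivity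
      gcongr
      linarith) (hsup x) M w hw
    have h2 := hs ‖w‖ M (norm_nonneg _) hM n
    calc _ ≤ _ := h1
      _ ≤ C * (2 * Λ) * (Cs * ‖w‖ + 1 * M) := by gcongr
      _ ≤ C * (2 * Λ) * (Cs * M + 1 * M) := by gcongr; exact hw.1
      _ = C1 * M := by rw [hC1]; ring
      _ ≤ _ := by gcongr; linarith
  · intro x k hk
    have hk0 : 0 < ‖k‖ := hϱ.trans_le hk
    have hkμ : 0 < ‖k‖ ^ μ := by positivity
    rw [h.Leq, h.Leq]
    have e1 : 𝓛 (x + k) w (x + k) - 𝓛 x w x = (𝓛 (x + k) - 𝓛 x) w (x + k) + (𝓛 x * (tr k - 1)) w x := by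
      have : (𝓛 x * (tr k - 1)) w = (tr k - 1) (𝓛 x w) :=
        congrArg (fun T : Op d => T w) (((h.frz x).ctr k).sub_right (Commute.one_right _)).eq
      rw [this]
      change _ = (𝓛 (x + k) w (x + k) - 𝓛 x w (x + k)) + (𝓛 x w (x + k) - 𝓛 x w x)
      ring
    rw [e1]
    have b1 : |(𝓛 (x + k) - 𝓛 x) w (x + k)| ≤ (Cf + 1) * M * ‖k‖ ^ μ := by
      refine ((XX.abs_le _ _).trans (hfz κ r0 ϱ m 𝓛 L h M w hw (x + k) x)).trans ?_
      have h1 := wf_le (μ := μ) (x + k - x)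
      rw [add_sub_cancel_left] at h1 ⊢
      have h2 := hw.1
      have h3 := wf_nonneg (μ := μ) k
      calc (Cf * ‖w‖ + 1 * M) * wf μ k ≤ (Cf * M + 1 * M) * ‖k‖ ^ μ := by
            refine mul_le_mul ?_ h1 h3 (by positivity)
            gcongr
        _ = _ := by ring
    have b2 : |(𝓛 x * (tr k - 1)) w x| ≤ (2 * Λ * Cb * Cd + 256 * Λ * Cb) * M * ‖k‖ ^ μ := by
      refine (XX.abs_le _ _).trans ?_
      have hBc : ∀ u, (𝓛 x * (tr k - 1)) u = (tr k - 1) (𝓛 x u) := fun u =>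
        congrArg (fun T : Op d => T u) (((h.frz x).ctr k).sub_right (Commute.one_right _)).eq
      obtain ⟨n, hn1, hn2⟩ := scale4 hϱ h.small
      refine (decomp (𝓛 x * (tr k - 1)) w n).trans ?_
      have s1 : ∑ j ∈ Finset.range (n+1), ‖(𝓛 x * (tr k - 1)) (Qb j w)‖ ≤ 2 * Λ * Cb * M * (Cd * ‖k‖ ^ μ) := by
        refine le_trans ?_ (mul_le_mul_of_nonneg_left (hdy ‖k‖ hk0 (n+1)) (by positivity))
        rw [Finset.mul_sum]
        refine Finset.sum_le_sum fun j hj => ?_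
        have hrj := rj_pos j
        have hj' : 2 * ϱ ≤ rj j := hn1.trans (rj_anti (by have := Finset.mem_range.1 hj; omega))
        have hsm := (hb (α + μ) ϱ M hβ w hw j hj').1
        set a := Cb * min ‖w‖ (M * rj j ^ (α + μ)) with ha
        have ha' : a ≤ Cb * (M * rj j ^ (α + μ)) := by rw [ha]; gcongr; exact min_le_right _ _
        have er : rj j ^ (α + μ) * rj j ^ (-α) = rj j ^ μ := by rw [← Real.rpow_add hrj]; ring_nf
        rw [mul_min_of_nonneg _ _ (by positivity)]
        refine le_min ?_ ?_
        · rw [hBc]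
          refine (tr_sub_norm k _).trans ?_
          have := (h.frz x).blk (rj j) (by linarith) (rj_le_one j) _ _ (hsm.mono (by norm_num) le_rfl hrj)
          calc _ ≤ 2 * (Λ * a * rj j ^ (-α)) := by linarith
            _ ≤ 2 * (Λ * (Cb * (M * rj j ^ (α + μ))) * rj j ^ (-α)) := by gcongr
            _ = 2 * Λ * Cb * M * (rj j ^ (α + μ) * rj j ^ (-α)) := by ring
            _ = _ := by rw [er]
        · have h3 : SmN 2 (a * ‖k‖ / rj j) (rj j) ((tr k - 1 : Op d) (Qb j w)) := hsm.diff hrj k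
          have := (h.frz x).blk (rj j) (by linarith) (rj_le_one j) _ _ h3
          change ‖𝓛 x ((tr k - 1 : Op d) (Qb j w))‖ ≤ _
          have er2 : rj j ^ (α + μ) * rj j ^ (-α) / rj j = rj j ^ (μ - 1) := by rw [er, Real.rpow_sub hrj, Real.rpow_one]
          calc _ ≤ Λ * (a * ‖k‖ / rj j) * rj j ^ (-α) := this
            _ ≤ Λ * (Cb * (M * rj j ^ (α + μ)) * ‖k‖ / rj j) * rj j ^ (-α) := by gcongr
            _ = 1 * (Λ * Cb * M * (‖k‖ * (rj j ^ (α + μ) * rj j ^ (-α) / rj j))) := by ring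
            _ ≤ 2 * (Λ * Cb * M * (‖k‖ * (rj j ^ (α + μ) * rj j ^ (-α) / rj j))) := by gcongr; norm_num
            _ = _ := by rw [er2]; ring
      have s2 : ‖(𝓛 x * (tr k - 1)) (w - TT (rj n) (TT (rj n) w))‖ ≤ 256 * Λ * Cb * M * ‖k‖ ^ μ := by
        have hrn := rj_pos n
        have h3 := (hb (α + μ) ϱ M hβ w hw n hn1).2.1
        have h3' : ‖w - TT (rj n) (TT (rj n) w)‖ ≤ Cb * (M * rj n ^ (α + μ)) :=
          h3.trans (by gcongr; exact min_le_right _ _)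
        have h4 := rho_pow_le hα2 hϱ hrn hn2
        have er : rj n ^ (α + μ) * rj n ^ (-α) = rj n ^ μ := by rw [← Real.rpow_add hrn]; ring_nf
        have h5 : rj n ^ μ ≤ 4 * ‖k‖ ^ μ := by
          calc rj n ^ μ ≤ (4 * ‖k‖) ^ μ := Real.rpow_le_rpow hrn.le (by linarith) hμ.1.le
            _ = 4 ^ μ * ‖k‖ ^ μ := Real.mul_rpow (by norm_num) hk0.le
            _ ≤ 4 ^ (1:ℝ) * ‖k‖ ^ μ := by
              gcongr
              · norm_num
              · exact hμ.2.le
            _ = _ := by norm_num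
        rw [hBc]
        refine (tr_sub_norm k _).trans ?_
        calc _ ≤ 2 * (2 * Λ * ϱ ^ (-α) * ‖w - TT (rj n) (TT (rj n) w)‖) := by gcongr; exact hsup x _
          _ ≤ 2 * (2 * Λ * (16 * rj n ^ (-α)) * (Cb * (M * rj n ^ (α + μ)))) := by gcongr
          _ = 64 * Λ * Cb * M * (rj n ^ (α + μ) * rj n ^ (-α)) := by ring
          _ = 64 * Λ * Cb * M * rj n ^ μ := by rw [er]
          _ ≤ 64 * Λ * Cb * M * (4 * ‖k‖ ^ μ) := by gcongr
          _ = _ := by ring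
      calc _ ≤ _ := add_le_add s1 s2
        _ = _ := by ring
    refine (abs_add_le _ _).trans ?_
    have : 0 ≤ C1 * M * ‖k‖ ^ μ := by positivity
    calc _ ≤ _ := add_le_add b1 b2
      _ ≤ C1 * M * ‖k‖ ^ μ + C2 * M * ‖k‖ ^ μ := by
        have e : (Cf + 1) * M * ‖k‖ ^ μ + (2 * Λ * Cb * Cd + 256 * Λ * Cb) * M * ‖k‖ ^ μ = C2 * M * ‖k‖ ^ μ := by rw [hC2]; ring
        linarith
      _ = _ := by ring

/-- full a priori estimate at level ϱ -/
lemma exists_apriori_full (d : ℕ) [NeZero d] {μ α Λ κ r0 : ℝ} (hμ : μ ∈ Ioo (0:ℝ) 1) (hα : α ∈ Ico (1:ℝ) 2) (hΛ : 0 ≤ Λ)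
    (hκ : 0 < κ) (hr0 : 0 < r0) (hr01 : r0 ≤ 1) : ∃ C : ℝ, 1 ≤ C ∧ ∀ ϱ m (𝓛 : Euc d → Op d) (L : Op d), Fam μ α Λ κ r0 ϱ m 𝓛 L →
    ∀ A (f : XX d), HolX μ A f →
      (∀ τ ∈ Icc (0:ℝ) 1, Zyg (α + μ) ϱ (C * A) (solV L f τ)) ∧
      (∀ τ ∈ Icc (0:ℝ) 1, ‖L (solV L f τ) + f‖ ≤ C * A) ∧
      (∀ τ ∈ Icc (0:ℝ) 1, Zyg μ ϱ (C * A) (L (solV L f τ) + f)) ∧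
      (∀ s ∈ Icc (0:ℝ) 1, ∀ s' ∈ Icc (0:ℝ) 1, Zyg (α / 2 + μ) ϱ (C * A * |s - s'| ^ (1/2:ℝ)) (solV L f s - solV L f s')) := by
  obtain ⟨C1, hC1, h1⟩ := exists_apriori d hμ hα hΛ hκ hr0 hr01
  obtain ⟨C2, hC2, h2⟩ := exists_LV d hμ hα hΛ
  set C3 := 4 * (C2 * C1 + 1) with hC3
  have hC21 : 1 ≤ C2 * C1 := by nlinarith
  have hC3C1 : 2 * C1 ≤ C3 := by rw [hC3]; nlinarith
  refine ⟨C3, by linarith, fun ϱ m 𝓛 L h A f hf => ?_⟩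
  have hA : 0 ≤ A := (norm_nonneg _).trans hf.1
  have hZ := h1 ϱ m 𝓛 L h A f hf
  have hϱ := h.pos
  have hLn : ∀ τ ∈ Icc (0:ℝ) 1, ‖L (solV L f τ) + f‖ ≤ (C2 * C1 + 1) * A := fun τ hτ => by
    have := (h2 κ r0 ϱ m 𝓛 L h _ _ (hZ τ hτ)).1
    refine (norm_add_le _ _).trans ?_
    have := hf.1
    linarith
  have hLZ : ∀ τ ∈ Icc (0:ℝ) 1, Zyg μ ϱ (C3 * A) (L (solV L f τ) + f) := fun τ hτ => by
    have e : C3 * A = 4 * ((C2 * C1 + 1) * A) := by rw [hC3]; ring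
    rw [e]
    refine hol_zyg (fun x k hk => ?_) ((hLn τ hτ).trans ?_)
    · have a1 := (h2 κ r0 ϱ m 𝓛 L h _ _ (hZ τ hτ)).2 x k hk
      have a2 := hf.2 x k
      rw [BoundedContinuousFunction.add_apply, BoundedContinuousFunction.add_apply]
      have e : L (solV L f τ) (x + k) + f (x + k) - (L (solV L f τ) x + f x) =
        (L (solV L f τ) (x + k) - L (solV L f τ) x) + (f (x + k) - f x) := by ring
      rw [e]
      refine (abs_add_le _ _).trans ?_
      calc _ ≤ _ := add_le_add a1 a2
        _ = _ := by ring
    · have : 0 ≤ (C2 * C1 + 1) * A := by positivity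
      linarith
  refine ⟨fun τ hτ => ?_, fun τ hτ => (hLn τ hτ).trans ?_, hLZ, fun s hs s' hs' => ?_⟩
  · obtain ⟨a1, a2⟩ := hZ τ hτ
    refine ⟨a1.trans ?_, fun k hk => (a2 k hk).trans ?_⟩
    · gcongr; linarith
    · gcongr; linarith
  · gcongr; linarith
  · have hss : |s - s'| ≤ 1 := by rw [abs_le]; constructor <;> linarith [hs.1, hs.2, hs'.1, hs'.2]
    have hroot : |s - s'| ≤ |s - s'| ^ (1/2:ℝ) := by
      rcases (abs_nonneg (s - s')).eq_or_lt with h0 | h0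
      · rw [← h0]; positivity
      · calc |s - s'| = |s - s'| ^ (1:ℝ) := (Real.rpow_one _).symm
          _ ≤ _ := Real.rpow_le_rpow_of_exponent_ge h0 hss (by norm_num)
    have hrn : 0 ≤ |s - s'| ^ (1/2:ℝ) := by positivity
    refine ⟨?_, fun k hk => ?_⟩
    · refine (h.Lgen.solV_lip f hs.1 hs'.1).trans ?_
      have h3 := hf.1
      calc _ ≤ A * |s - s'| ^ (1/2:ℝ) := by
            have := abs_nonneg (s - s'); have := norm_nonneg f; nlinarith
        _ ≤ _ := by gcongr; nlinarith
    · have hk0 : 0 < ‖k‖ := hϱ.trans_le hk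
      have t1 : ‖D3 k (solV L f s - solV L f s')‖ ≤ C3 * A * ‖k‖ ^ (α + μ) := by
        rw [map_sub]
        refine (norm_sub_le _ _).trans ?_
        have a1 := (hZ s hs).2 k hk
        have a2 := (hZ s' hs').2 k hk
        have : 2 * C1 * A * ‖k‖ ^ (α + μ) ≤ C3 * A * ‖k‖ ^ (α + μ) := by gcongr
        linarith
      have t2 : ‖D3 k (solV L f s - solV L f s')‖ ≤ C3 * A * ‖k‖ ^ μ * |s - s'| := by
        rw [map_sub]
        have := Convex.norm_image_sub_le_of_norm_hasDerivWithin_le (𝕜 := ℝ) (s := Icc (0:ℝ) 1) (C := C3 * A * ‖k‖ ^ μ)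
          (f := fun σ => D3 k (solV L f σ)) (f' := fun σ => D3 k (L (solV L f σ) + f)) (x := s') (y := s)
          (fun σ hσ => ((D3 k).hasFDerivAt.comp_hasDerivAt σ (solV_deriv L f σ)).hasDerivWithinAt)
          (fun σ hσ => (hLZ σ hσ).2 k hk) (convex_Icc 0 1) hs' hs
        exact this
      set D := ‖D3 k (solV L f s - solV L f s')‖ with hD
      have hD0 : 0 ≤ D := norm_nonneg _
      have e : (C3 * A * |s - s'| ^ (1/2:ℝ) * ‖k‖ ^ (α / 2 + μ)) ^ 2 = (C3 * A * ‖k‖ ^ (α + μ)) * (C3 * A * ‖k‖ ^ μ * |s - s'|) := by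
        have e1 : (|s - s'| ^ (1/2:ℝ)) ^ 2 = |s - s'| := by
          rw [← Real.sqrt_eq_rpow, Real.sq_sqrt (abs_nonneg _)]
        have e2 : (‖k‖ ^ (α/2 + μ)) ^ 2 = ‖k‖ ^ (α + μ) * ‖k‖ ^ μ := by
          rw [sq, ← Real.rpow_add hk0, ← Real.rpow_add hk0]; ring_nf
        calc _ = (C3 * A) ^ 2 * (|s - s'| ^ (1/2:ℝ)) ^ 2 * (‖k‖ ^ (α/2 + μ)) ^ 2 := by ring
          _ = _ := by rw [e1, e2]; ring
      refine le_of_sq_le_sq ?_ (by positivity)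
      rw [e, sq]
      exact mul_le_mul t1 t2 hD0 (by positivity)

end apriori

/-! ## Part 9 -/
open scoped BoundedContinuousFunction ContDiff
set_option linter.unusedSectionVars false
set_option linter.unusedVariables false

section levy
variable {d : ℕ}

def Sx (d : ℕ) (r : ℝ) : Set (Euc d) := {y | r < ‖y‖}

lemma Sx_meas (r : ℝ) : MeasurableSet (Sx d r) := measurableSet_lt measurable_const measurable_norm

/-- abstract Lévy measure bounds -/
structure Levy (α Cm : ℝ) (P : Measure (Euc d)) : Prop where
  Cpos : 0 ≤ Cm
  supp : ∀ᵐ y ∂P, ‖y‖ ≤ 1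
  fin : ∀ r, 0 < r → P (Sx d r) < ⊤
  mass : ∀ r, 0 < r → r ≤ 1 → P.real (Sx d r) ≤ Cm * r ^ (-α)
  big : ∀ s, 0 ≤ s → s < α → ∀ r, 0 < r → r ≤ 1 →
    ∫ y in Sx d r, ‖y‖ ^ s ∂P ≤ Cm / (α - s) * r ^ (s - α)
  sml : ∀ γ, α < γ → ∀ r, 0 < r → r ≤ 1 → IntegrableOn (fun y => ‖y‖ ^ γ) (Sx d r)ᶜ P ∧
    ∫ y in (Sx d r)ᶜ, ‖y‖ ^ γ ∂P ≤ Cm / (γ - α) * r ^ (γ - α)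
  ctr : ∀ r, 0 < r → r ≤ 1 → ‖∫ y in Sx d r, y ∂P‖ ≤ Cm * r ^ (1 - α)

def cc (P : Measure (Euc d)) (r : ℝ) : Euc d := ∫ y in Sx d r, y ∂P

def Bf (P : Measure (Euc d)) (σ : ℝ) (A : Euc d →L[ℝ] Euc d) (b : Euc d) : Euc d := b - A (cc P σ)

def Nf (P : Measure (Euc d)) (α σ : ℝ) (A : Euc d →L[ℝ] Euc d) (b : Euc d) (u : Euc d → ℝ) (z : Euc d) : ℝ :=
  ∫ y in Sx d σ, u (z + A y) ∂P + σ ^ (-α) * u (z + σ ^ α • Bf P σ A b)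

lemma Levy.finM {α Cm : ℝ} {P : Measure (Euc d)} (h : Levy α Cm P) {r : ℝ} (hr : 0 < r) :
    IsFiniteMeasure (P.restrict (Sx d r)) :=
  ⟨by rw [Measure.restrict_apply_univ]; exact h.fin r hr⟩

lemma Levy.int_comp {α Cm : ℝ} {P : Measure (Euc d)} (h : Levy α Cm P) {r : ℝ} (hr : 0 < r) (u : XX d)
    (z : Euc d) (A : Euc d →L[ℝ] Euc d) : IntegrableOn (fun y => u (z + A y)) (Sx d r) P := by
  have := h.finM hr
  refine Integrable.of_bound (C := ‖u‖) ?_ (Filter.Eventually.of_forall fun z => u.norm_coe_le_norm _)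
  exact (u.continuous.comp (by fun_prop : Continuous fun y => z + A y)).aestronglyMeasurable

lemma Levy.int_id {α Cm : ℝ} {P : Measure (Euc d)} (h : Levy α Cm P) {r : ℝ} (hr : 0 < r) :
    IntegrableOn (fun y => y) (Sx d r) P := by
  have := h.finM hr
  exact Integrable.of_bound (C := 1) (by fun_prop) (ae_restrict_of_ae h.supp)

lemma Levy.int_pow {α Cm : ℝ} {P : Measure (Euc d)} (h : Levy α Cm P) {r : ℝ} (hr : 0 < r) {s : ℝ} (hs : 0 ≤ s) :
    IntegrableOn (fun y => ‖y‖ ^ s) (Sx d r) P := by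
  have := h.finM hr
  refine Integrable.of_bound (C := 1) ?_ (ae_restrict_of_ae (h.supp.mono fun y hy => ?_))
  · exact (continuous_norm.rpow_const (fun _ => Or.inr hs)).aestronglyMeasurable
  · rw [Real.norm_of_nonneg (by positivity)]
    exact Real.rpow_le_one (norm_nonneg _) hy hs

lemma Levy.Bf_le {α Cm : ℝ} (hα : 1 ≤ α) {P : Measure (Euc d)} (h : Levy α Cm P) {σ : ℝ} (hσ : 0 < σ) (hσ1 : σ ≤ 1)
    {A : Euc d →L[ℝ] Euc d} {b : Euc d} {D : ℝ} (hA : ‖A‖ ≤ D) (hb : ‖b‖ ≤ D) :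
    ‖Bf P σ A b‖ ≤ (1 + Cm) * D * σ ^ (1 - α) := by
  have h1 : 1 ≤ σ ^ (1 - α) := Real.one_le_rpow_of_pos_of_le_one_of_nonpos hσ hσ1 (by linarith)
  have hD : 0 ≤ D := (norm_nonneg _).trans hb
  have hC := h.Cpos
  have h2 := h.ctr σ hσ hσ1
  calc ‖Bf P σ A b‖ ≤ ‖b‖ + ‖A (cc P σ)‖ := norm_sub_le _ _
    _ ≤ D * 1 + D * (Cm * σ ^ (1 - α)) := by
        have h3 := A.le_of_opNorm_le hA (cc P σ)
        have h4 : D * ‖cc P σ‖ ≤ D * (Cm * σ ^ (1 - α)) := mul_le_mul_of_nonneg_left h2 hD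
        linarith
    _ ≤ D * σ ^ (1-α) + D * (Cm * σ ^ (1 - α)) := by gcongr
    _ = _ := by ring

lemma Bf_sub (P : Measure (Euc d)) (σ : ℝ) (A A' : Euc d →L[ℝ] Euc d) (b b' : Euc d) :
    Bf P σ A b - Bf P σ A' b' = Bf P σ (A - A') (b - b') := by
  simp only [Bf, _root_.sub_apply]; abel

/-- bound integral over R by moments -/
lemma norm_int_le {P : Measure (Euc d)} {S : Set (Euc d)} (hS : MeasurableSet S) {F : Euc d → ℝ} {c s I : ℝ} (hc : 0 ≤ c)
    (hF : ∀ y ∈ S, |F y| ≤ c * ‖y‖ ^ s) (hi : IntegrableOn (fun y => ‖y‖ ^ s) S P)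
    (hI : ∫ y in S, ‖y‖ ^ s ∂P ≤ I) : |∫ y in S, F y ∂P| ≤ c * I := by
  have := norm_integral_le_of_norm_le (f := F) (μ := P.restrict S) (hi.const_mul c)
    ((ae_restrict_iff' hS).2 (Filter.Eventually.of_forall hF))
  rw [integral_const_mul] at this
  exact this.trans (by gcongr)

lemma Nf_diff (d : ℕ) {α μ Cm : ℝ} (hα : α ∈ Ico (1:ℝ) 2) (hμ : μ ∈ Ioo (0:ℝ) 1) (hCm : 0 ≤ Cm) {K : ℝ} (hK : 0 ≤ K) :
    ∃ Λ : ℝ, 0 ≤ Λ ∧ ∀ P : Measure (Euc d), Levy α Cm P → ∀ σ r, 0 < σ → σ ≤ r → r ≤ 1 →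
    ∀ (A A' : Euc d →L[ℝ] Euc d) (b b' : Euc d) (D : ℝ), ‖A‖ ≤ K → ‖A'‖ ≤ K → ‖b‖ ≤ K → ‖b'‖ ≤ K →
    ‖A - A'‖ ≤ D → ‖A - A'‖ ^ μ ≤ D → ‖b - b'‖ ≤ D → ∀ (u : XX d) (a : ℝ), SmN 2 a r u → ∀ z,
    |Nf P α σ A b u z - Nf P α σ A' b' u z| ≤ Λ * D * a * r ^ (-α) := by
  have hα2 : 0 < 2 - α := by linarith [hα.2]
  have hαμ : 0 < α - μ := by linarith [hα.1, hμ.2]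
  refine ⟨2 * K * (Cm / (2 - α)) + 2 * (Cm / (α - μ)) + (1 + Cm) + 2 * ((1 + Cm) * K) * (1 + Cm), by positivity, ?_⟩
  intro P h σ r hσ hσr hr1 A A' b b' D hA hA' hb hb' hAD hAμ hbD u a hu z
  have hr : 0 < r := hσ.trans_le hσr
  have hσ1 := hσr.trans hr1
  have ha : 0 ≤ a := (abs_nonneg _).trans (hu.abs_le 0)
  have hD : 0 ≤ D := (norm_nonneg _).trans hbD
  set g := fderiv ℝ u z with hg
  have hgn : ‖g‖ ≤ a / r := by
    have := hu.2 1 (by omega) z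
    rwa [← norm_iteratedFDeriv_fderiv, norm_iteratedFDeriv_zero, pow_one] at this
  set R : Set (Euc d) := Sx d σ \ Sx d r with hR
  have hRm : MeasurableSet R := (Sx_meas σ).diff (Sx_meas r)
  have hsub : Sx d r ⊆ Sx d σ := fun y hy => lt_of_le_of_lt hσr hy
  have hRc : R ⊆ (Sx d r)ᶜ := fun y hy => hy.2
  have hRs : R ⊆ Sx d σ := fun y hy => hy.1
  let F : Euc d → ℝ := fun y => u (z + A y) - u (z + A' y)
  have hFi : IntegrableOn F (Sx d σ) P := (h.int_comp hσ u z A).sub (h.int_comp hσ u z A')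
  have hyi := h.int_id hσ
  have hgi : IntegrableOn (fun y => g ((A - A') y)) (Sx d σ) P := (g.comp (A - A')).integrable_comp hyi
  have hcsub : ∫ y in R, g ((A - A') y) ∂P = g ((A - A') (cc P σ)) - g ((A - A') (cc P r)) := by
    rw [setIntegral_sdiff (Sx_meas r) hgi hsub]
    have e : ∀ s, 0 < s → ∫ y in Sx d s, g ((A - A') y) ∂P = g ((A - A') (cc P s)) := fun s hs =>
      (g.comp (A - A')).integral_comp_comm (h.int_id hs)
    rw [e σ hσ, e r hr]
  have hsplit : ∫ y in Sx d σ, F y ∂P = (∫ y in R, (F y - g ((A - A') y)) ∂P + (g ((A - A') (cc P σ)) - g ((A - A') (cc P r))))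
      + ∫ y in Sx d r, F y ∂P := by
    rw [← hcsub, integral_sub (hFi.mono_set hRs) (hgi.mono_set hRs), setIntegral_sdiff (Sx_meas r) hFi hsub]; ring
  set B := Bf P σ A b with hB
  set B' := Bf P σ A' b' with hB'
  have hBB : B - B' = b - b' - (A - A') (cc P σ) := by
    rw [hB, hB', Bf_sub]; rfl
  have hσα : σ ^ (-α) * σ ^ α = 1 := by rw [← Real.rpow_add hσ]; simp
  set J3 := u (z + σ ^ α • B) - u (z + σ ^ α • B') - g (σ ^ α • B - σ ^ α • B') with hJ3
  have htot : Nf P α σ A b u z - Nf P α σ A' b' u z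
      = ∫ y in R, (F y - g ((A - A') y)) ∂P + ∫ y in Sx d r, F y ∂P + (g (b - b') - g ((A - A') (cc P r))) + σ ^ (-α) * J3 := by
    have e1 : Nf P α σ A b u z - Nf P α σ A' b' u z = ∫ y in Sx d σ, F y ∂P + σ ^ (-α) * (u (z + σ ^ α • B) - u (z + σ ^ α • B')) := by
      rw [integral_sub (h.int_comp hσ u z A) (h.int_comp hσ u z A')]
      simp only [Nf, ← hB, ← hB']; ring
    have e2 : σ ^ (-α) * g (σ ^ α • B - σ ^ α • B') = g (b - b') - g ((A - A') (cc P σ)) := by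
      rw [← smul_sub, map_smul, hBB, map_sub, smul_eq_mul, ← mul_assoc, hσα, one_mul]
    rw [e1, hsplit, hJ3, mul_sub (σ ^ (-α)) (_ - _), e2]; ring
  -- bounds
  have hrα : r ^ (-α) = r ^ (-(2:ℝ)) * r ^ (2 - α) := by rw [← Real.rpow_add hr]; ring_nf
  have hr2 : a / r ^ 2 = a * r ^ (-(2:ℝ)) := by
    rw [Real.rpow_neg hr.le, div_eq_mul_inv]; norm_cast
  have hr1' : a / r = a * r ^ (-(1:ℝ)) := by
    rw [Real.rpow_neg_one, div_eq_mul_inv]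
  have b1 : |∫ y in R, (F y - g ((A - A') y)) ∂P| ≤ (a / r ^ 2 * (2 * K) * D) * (Cm / (2 - α) * r ^ (2 - α)) := by
    obtain ⟨i1, i2⟩ := h.sml 2 hα.2 r hr hr1
    refine norm_int_le hRm (s := 2) (by positivity) (fun y hy => ?_) (i1.mono_set hRc) (le_trans ?_ i2)
    · have := hu.taylor2 hr z (A y) (A' y)
      have e : A y - A' y = (A - A') y := rfl
      rw [e] at this
      refine this.trans ?_
      have h1 := A.le_of_opNorm_le hA y
      have h2 := A'.le_of_opNorm_le hA' y
      have h3 := (A - A').le_of_opNorm_le hAD y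
      calc _ ≤ a / r ^ 2 * (K * ‖y‖ + K * ‖y‖) * (D * ‖y‖) := by gcongr
        _ = a / r ^ 2 * (2 * K) * D * ‖y‖ ^ (2:ℝ) := by rw [Real.rpow_two]; ring
    · exact setIntegral_mono_set i1 (Filter.Eventually.of_forall fun y => by positivity) hRc.eventuallyLE
  have b2 : |∫ y in Sx d r, F y ∂P| ≤ (2 * a * r ^ (-μ) * D) * (Cm / (α - μ) * r ^ (μ - α)) := by
    refine norm_int_le (Sx_meas r) (by positivity) (fun y hy => ?_) (h.int_pow hr hμ.1.le)
      (h.big μ hμ.1.le (by linarith) r hr hr1)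
    have h1 := (hu.blk hμ hr).1 (z + A' y) ((A - A') y)
    have e : z + A' y + (A - A') y = z + A y := by simp
    rw [e] at h1
    refine h1.trans ?_
    have h3 := (A - A').le_opNorm y
    calc 2 * a * (‖(A - A') y‖ / r) ^ μ ≤ 2 * a * ((‖A - A'‖ * ‖y‖) / r) ^ μ := by
          have := hμ.1.le
          gcongr
      _ = 2 * a * (‖A - A'‖ ^ μ * ‖y‖ ^ μ * r ^ (-μ)) := by
          rw [Real.div_rpow (by positivity) hr.le, Real.mul_rpow (by positivity) (by positivity), Real.rpow_neg hr.le]; ring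
      _ ≤ 2 * a * (D * ‖y‖ ^ μ * r ^ (-μ)) := by gcongr
      _ = _ := by ring
  have b3 : |g (b - b') - g ((A - A') (cc P r))| ≤ a / r * ((1 + Cm) * D * r ^ (1 - α)) := by
    rw [← map_sub]
    have := h.Bf_le hα.1 hr hr1 hAD hbD
    exact (g.le_of_opNorm_le hgn _).trans (mul_le_mul_of_nonneg_left this (by positivity))
  have b4 : |σ ^ (-α) * J3| ≤ a / r ^ 2 * (2 * ((1 + Cm) * K)) * ((1 + Cm) * D) * σ ^ (2 - α) := by
    have h1 := hu.taylor2 hr z (σ ^ α • B) (σ ^ α • B')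
    have h2 := h.Bf_le hα.1 hσ hσ1 hA hb
    have h2' := h.Bf_le hα.1 hσ hσ1 hA' hb'
    have h3 := h.Bf_le hα.1 hσ hσ1 hAD hbD
    rw [← Bf_sub] at h3
    rw [← hg, ← hJ3, ← smul_sub] at h1
    simp only [norm_smul, Real.norm_of_nonneg (Real.rpow_nonneg hσ.le α)] at h1
    rw [abs_mul, abs_of_nonneg (Real.rpow_nonneg hσ.le _)]
    have e : σ ^ (-α) * (σ ^ α * σ ^ (1 - α)) * (σ ^ α * σ ^ (1 - α)) = σ ^ (2 - α) := by
      rw [← Real.rpow_add hσ, ← Real.rpow_add hσ, ← Real.rpow_add hσ]; ring_nf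
    calc _ ≤ σ ^ (-α) * (a / r ^ 2 * (σ ^ α * ((1 + Cm) * K * σ ^ (1 - α)) + σ ^ α * ((1 + Cm) * K * σ ^ (1 - α))) *
          (σ ^ α * ((1 + Cm) * D * σ ^ (1 - α)))) := by
            refine mul_le_mul_of_nonneg_left (h1.trans ?_) (by positivity)
            gcongr
      _ = a / r ^ 2 * (2 * ((1 + Cm) * K)) * ((1 + Cm) * D) * (σ ^ (-α) * (σ ^ α * σ ^ (1 - α)) * (σ ^ α * σ ^ (1 - α))) := by ring
      _ = _ := by rw [e]
  have b4' : a / r ^ 2 * (2 * ((1 + Cm) * K)) * ((1 + Cm) * D) * σ ^ (2 - α) ≤ a / r ^ 2 * (2 * ((1 + Cm) * K)) * ((1 + Cm) * D) * r ^ (2 - α) := by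
    gcongr
  have hrμ : r ^ (-α) = r ^ (-μ) * r ^ (μ - α) := by rw [← Real.rpow_add hr]; ring_nf
  have hr1'' : r ^ (-α) = r ^ (-(1:ℝ)) * r ^ (1 - α) := by rw [← Real.rpow_add hr]; ring_nf
  have c1 : (a / r ^ 2 * (2 * K) * D) * (Cm / (2 - α) * r ^ (2 - α)) = 2 * K * (Cm / (2 - α)) * D * a * r ^ (-α) := by
    rw [hr2, hrα]; ring
  have c2 : (2 * a * r ^ (-μ) * D) * (Cm / (α - μ) * r ^ (μ - α)) = 2 * (Cm / (α - μ)) * D * a * r ^ (-α) := by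
    rw [hrμ]; ring
  have c3 : a / r * ((1 + Cm) * D * r ^ (1 - α)) = (1 + Cm) * D * a * r ^ (-α) := by
    rw [hr1', hr1'']; ring
  have c4 : a / r ^ 2 * (2 * ((1 + Cm) * K)) * ((1 + Cm) * D) * r ^ (2 - α) = 2 * ((1 + Cm) * K) * (1 + Cm) * D * a * r ^ (-α) := by
    rw [hr2, hrα]; ring
  rw [htot]
  refine (abs_add_le _ _).trans ?_
  have t1 := abs_add_le (∫ y in R, (F y - g ((A - A') y)) ∂P + ∫ y in Sx d r, F y ∂P) (g (b - b') - g ((A - A') (cc P r)))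
  have t2 := abs_add_le (∫ y in R, (F y - g ((A - A') y)) ∂P) (∫ y in Sx d r, F y ∂P)
  rw [c1] at b1; rw [c2] at b2; rw [c3] at b3; rw [c4] at b4'
  calc _ ≤ 2 * K * (Cm / (2 - α)) * D * a * r ^ (-α) + 2 * (Cm / (α - μ)) * D * a * r ^ (-α) + (1 + Cm) * D * a * r ^ (-α)
      + 2 * ((1 + Cm) * K) * (1 + Cm) * D * a * r ^ (-α) := by linarith
    _ = _ := by ring

end levy

/-! ## Part 10 -/
open scoped BoundedContinuousFunction ContDiff
set_option linter.unusedSectionVars false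
set_option linter.unusedVariables false

section concrete
variable {d : ℕ}

def nuM (P : Measure (Euc d)) (α σ : ℝ) (A : Euc d →L[ℝ] Euc d) (b : Euc d) : Measure (Euc d) :=
  (P.restrict (Sx d σ)).map A + (σ ^ (-α)).toNNReal • Measure.dirac (σ ^ α • Bf P σ A b)

def nuMass (P : Measure (Euc d)) (α σ : ℝ) : ℝ := P.real (Sx d σ) + σ ^ (-α)

lemma Levy.nuFin {α Cm : ℝ} {P : Measure (Euc d)} (h : Levy α Cm P) {σ : ℝ} (hσ : 0 < σ) (A : Euc d →L[ℝ] Euc d) (b : Euc d) :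
    IsFiniteMeasure (nuM P α σ A b) := by
  have := h.finM hσ
  unfold nuM; infer_instance

lemma Levy.nu_mass {α Cm : ℝ} {P : Measure (Euc d)} (h : Levy α Cm P) {σ : ℝ} (hσ : 0 < σ) (A : Euc d →L[ℝ] Euc d) (b : Euc d) :
    (nuM P α σ A b).real univ = nuMass P α σ := by
  have := h.finM hσ
  unfold nuM nuMass
  rw [measureReal_add_apply, map_measureReal_apply A.continuous.measurable MeasurableSet.univ, preimage_univ,
    measureReal_restrict_apply_univ, measureReal_nnreal_smul_apply]
  simp [Real.rpow_nonneg hσ.le]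

lemma Levy.nu_apply {α Cm : ℝ} {P : Measure (Euc d)} (h : Levy α Cm P) {σ : ℝ} (hσ : 0 < σ) (A : Euc d →L[ℝ] Euc d) (b : Euc d)
    (u : XX d) (z : Euc d) : ∫ y, u (z + y) ∂(nuM P α σ A b) = Nf P α σ A b u z := by
  have := h.finM hσ
  unfold nuM Nf
  rw [integral_add_measure (XX.integrable_comp _ u z) (XX.integrable_comp _ u z), integral_map (f := fun y => u (z + y)) A.continuous.aemeasurable
    (u.continuous.comp (by fun_prop : Continuous fun y => z + y)).aestronglyMeasurable, integral_smul_nnreal_measure, integral_dirac]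
  congr 1
  rw [NNReal.smul_def, smul_eq_mul, Real.coe_toNNReal _ (Real.rpow_nonneg hσ.le _)]

/-- coefficient data -/
structure Coef (μ K : ℝ) (A : Euc d → (Euc d →L[ℝ] Euc d)) (b : Euc d → Euc d) : Prop where
  nA : ∀ x, ‖A x‖ ≤ K
  nb : ∀ x, ‖b x‖ ≤ K
  rA : ∀ x x', ‖A x - A x'‖ ≤ K * wf μ (x - x')
  rAμ : ∀ x x', ‖A x - A x'‖ ^ μ ≤ K * wf μ (x - x')
  rb : ∀ x x', ‖b x - b x'‖ ≤ K * wf μ (x - x')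

variable [NeZero d]

def LowB (α κ r0 C1 : ℝ) (P : Measure (Euc d)) (A : Euc d → (Euc d →L[ℝ] Euc d)) : Prop :=
  ∀ x σ r, 0 < σ → C1 * σ ≤ r → r ≤ 2 →
    (κ * r ^ (-α)).toNNReal • etaR d (r0 * r) ≤ (P.restrict (Sx d σ)).map (A x)

/-- assembling the variable-coefficient operator -/
lemma exists_var {m c μ : ℝ} (hμ : 0 < μ) {𝓛 : Euc d → Op d} (hg : ∀ x, IsGen (𝓛 x) m)
    (hr : ∀ x x' (u : XX d), ‖𝓛 x u - 𝓛 x' u‖ ≤ c * wf μ (x - x') * ‖u‖) :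
    ∃ L : Op d, IsGen L m ∧ ∀ u x, L u x = 𝓛 x u x := by
  let L : Op d := XX.mkOp (fun u x => 𝓛 x u x) (2 * m)
    (fun u => by
      rw [continuous_iff_continuousAt]
      intro x0
      rw [ContinuousAt, tendsto_iff_norm_sub_tendsto_zero]
      have h1 : Filter.Tendsto (fun x => c * wf μ (x - x0) * ‖u‖ + ‖𝓛 x0 u x - 𝓛 x0 u x0‖) (nhds x0) (nhds 0) := by
        have hc : Continuous (fun x => c * wf μ (x - x0) * ‖u‖ + ‖𝓛 x0 u x - 𝓛 x0 u x0‖) := by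
          have := (wf_cont (d := d) hμ).comp (by fun_prop : Continuous fun x : Euc d => x - x0)
          have h2 := (𝓛 x0 u).continuous
          exact ((continuous_const.mul this).mul continuous_const).add (h2.sub continuous_const).norm
        have := hc.tendsto x0
        simpa [wf_zero hμ] using this
      refine squeeze_zero (fun _ => norm_nonneg _) (fun x => ?_) h1
      have e : 𝓛 x u x - 𝓛 x0 u x0 = (𝓛 x u - 𝓛 x0 u) x + (𝓛 x0 u x - 𝓛 x0 u x0) := by
        change _ = 𝓛 x u x - 𝓛 x0 u x + _; ring
      rw [e]
      exact (norm_add_le _ _).trans (add_le_add ((XX.abs_le _ _).trans (hr x x0 u)) le_rfl))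
    (fun f g x => by rw [map_add]; rfl)
    (fun k f x => by rw [map_smul]; rfl)
    (fun f x => (XX.abs_le _ _).trans ((hg x).norm_apply_le f))
  have hL : ∀ u x, L u x = 𝓛 x u x := fun u x => rfl
  refine ⟨L, ⟨?_, ?_⟩, hL⟩
  · ext x; rw [hL, (hg x).1]
  · refine XX.clm_norm_le (hg 0).nonneg fun f x => ?_
    have e : (L + m • (1 : Op d)) f x = (𝓛 x + m • (1 : Op d)) f x := rfl
    rw [e]
    refine (XX.abs_le _ _).trans ?_
    exact (𝓛 x + m • (1 : Op d)).le_of_opNorm_le (hg x).2 f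

lemma exists_fam (d : ℕ) [NeZero d] {α μ Cm K κ r0 C1 : ℝ} (hα : α ∈ Ico (1:ℝ) 2) (hμ : μ ∈ Ioo (0:ℝ) 1) (hCm : 0 ≤ Cm) (hK : 0 ≤ K)
    (hκ : 0 < κ) (hC1 : 1 ≤ C1) :
    ∃ Λ : ℝ, 1 ≤ Λ ∧ ∀ (P : Measure (Euc d)) (A : Euc d → (Euc d →L[ℝ] Euc d)) (b : Euc d → Euc d), Levy α Cm P → Coef μ K A b → LowB α κ r0 C1 P A →
    ∀ σ, 0 < σ → C1 * σ ≤ 1/4 → ∃ (𝓛 : Euc d → Op d) (L : Op d), Fam μ α Λ κ r0 (C1 * σ) (nuMass P α σ) 𝓛 L ∧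
      ∀ u x, L u x = Nf P α σ (A x) (b x) (J σ u) x - nuMass P α σ * u x := by
  obtain ⟨Λ0, hΛ0, hN⟩ := Nf_diff d hα hμ hCm hK
  obtain ⟨CJ, hCJ, hJ⟩ := exists_J_smooth d
  have hC1' : 0 < C1 := by linarith
  set D0 := max K (K ^ μ) with hD0
  have hD00 : 0 ≤ D0 := hK.trans (le_max_left _ _)
  have hC1α : 1 ≤ C1 ^ α := Real.one_le_rpow hC1 (by linarith [hα.1])
  refine ⟨1 + Λ0 * D0 + (Cm + 1) * C1 ^ α + Λ0 * K * CJ * C1 ^ α, ?_, ?_⟩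
  · have : 0 ≤ Λ0 * D0 := by positivity
    have : 0 ≤ (Cm + 1) * C1 ^ α := by positivity
    have : 0 ≤ Λ0 * K * CJ * C1 ^ α := by positivity
    linarith
  intro P A b hP hco hlow σ hσ hσ4
  set Λ := 1 + Λ0 * D0 + (Cm + 1) * C1 ^ α + Λ0 * K * CJ * C1 ^ α with hΛ
  have hfin : ∀ x, IsFiniteMeasure (nuM P α σ (A x) (b x)) := fun x => hP.nuFin hσ _ _
  have hσϱ : σ ≤ C1 * σ := by nlinarith
  have hσ1 : σ ≤ 1 := by linarith
  set m := nuMass P α σ with hm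
  have hmle : m ≤ (Cm + 1) * σ ^ (-α) := by
    have := hP.mass σ hσ hσ1
    rw [hm, nuMass]; linarith
  have hm0 : 0 ≤ m := by rw [hm, nuMass]; positivity
  have hϱα : σ ^ (-α) = C1 ^ α * (C1 * σ) ^ (-α) := by
    rw [Real.mul_rpow hC1'.le hσ.le, ← mul_assoc, ← Real.rpow_add hC1']; simp
  let 𝓛 : Euc d → Op d := fun x => conv (nuM P α σ (A x) (b x)) * J σ - m • (1 : Op d)
  have hLap : ∀ x u z, 𝓛 x u z = Nf P α σ (A x) (b x) (J σ u) z - m * u z := by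
    intro x u z
    change conv (nuM P α σ (A x) (b x)) (J σ u) z - m * u z = _
    rw [conv_apply, hP.nu_apply hσ]
  have hgen : ∀ x, IsGen (𝓛 x) m := by
    intro x
    constructor
    · change conv (nuM P α σ (A x) (b x)) (J σ 1) - m • (1 : XX d) = 0
      rw [J_one, conv_one, hP.nu_mass hσ, sub_self]
    · have e : 𝓛 x + m • (1 : Op d) = conv (nuM P α σ (A x) (b x)) * J σ := sub_add_cancel _ _
      rw [e]
      refine (norm_mul_le _ _).trans ?_
      have h1 := norm_conv_le (nuM P α σ (A x) (b x))
      rw [hP.nu_mass hσ] at h1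
      calc _ ≤ m * 1 := mul_le_mul h1 (norm_J_le σ) (ContinuousLinearMap.opNorm_nonneg _) hm0
        _ = m := mul_one m
  have hdiffN : ∀ x x' (u : XX d), 𝓛 x u - 𝓛 x' u = conv (nuM P α σ (A x) (b x)) (J σ u) - conv (nuM P α σ (A x') (b x')) (J σ u) := by
    intro x x' u
    change (conv (nuM P α σ (A x) (b x)) (J σ u) - m • u) - (conv (nuM P α σ (A x') (b x')) (J σ u) - m • u) = _
    abel
  have hreg0 : ∀ x x' r, σ ≤ r → r ≤ 1 → ∀ (u : XX d) (a : ℝ), SmN 2 a r u →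
      ‖conv (nuM P α σ (A x) (b x)) u - conv (nuM P α σ (A x') (b x')) u‖ ≤ Λ0 * (K * wf μ (x - x')) * a * r ^ (-α) := by
    intro x x' r hr hr1 u a hu
    refine XX.norm_le_of fun z => ?_
    change |conv (nuM P α σ (A x) (b x)) u z - conv (nuM P α σ (A x') (b x')) u z| ≤ _
    rw [conv_apply, conv_apply, hP.nu_apply hσ, hP.nu_apply hσ]
    exact hN P hP σ r hσ hr hr1 _ _ _ _ _ (hco.nA x) (hco.nA x') (hco.nb x) (hco.nb x') (hco.rA x x') (hco.rAμ x x') (hco.rb x x') u a hu z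
  have hcJ : ∀ x s, Commute (𝓛 x) (J s) := fun x s =>
    ((conv_comm _ _).mul_left (conv_comm _ _)).sub_left ((Commute.one_left _).smul_left _)
  have hreg : ∀ x x' r, C1 * σ ≤ r → r ≤ 1 → ∀ (u : XX d) (a : ℝ), SmN 2 a r u →
      ‖𝓛 x u - 𝓛 x' u‖ ≤ Λ * wf μ (x - x') * a * r ^ (-α) := by
    intro x x' r hr hr1 u a hu
    have ha : 0 ≤ a := (abs_nonneg _).trans (hu.abs_le 0)
    have hr0 : 0 < r := by linarith
    have e : 𝓛 x u - 𝓛 x' u = J σ (conv (nuM P α σ (A x) (b x)) u - conv (nuM P α σ (A x') (b x')) u) := by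
      rw [hdiffN, map_sub]
      congr 1
      · exact congrArg (fun T : Op d => T u) (conv_comm _ _).eq
      · exact congrArg (fun T : Op d => T u) (conv_comm _ _).eq
    rw [e]
    refine (J_norm_apply_le _ _).trans ((hreg0 x x' r (hσϱ.trans hr) hr1 u a hu).trans ?_)
    have hw := wf_nonneg (μ := μ) (x - x')
    have : Λ0 * K ≤ Λ := by
      have h1 : Λ0 * K ≤ Λ0 * D0 := mul_le_mul_of_nonneg_left (le_max_left _ _) hΛ0
      have : 0 ≤ (Cm + 1) * C1 ^ α := by positivity
      have : 0 ≤ Λ0 * K * CJ * C1 ^ α := by positivity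
      linarith
    rw [← mul_assoc]
    gcongr
  have hreg' : ∀ x x' (u : XX d), ‖𝓛 x u - 𝓛 x' u‖ ≤ Λ * wf μ (x - x') * (C1 * σ) ^ (-α) * ‖u‖ := by
    intro x x' u
    rw [hdiffN]
    have hsm := (hJ σ hσ u).mono (show 2 ≤ 3 by norm_num) le_rfl hσ
    refine (hreg0 x x' σ le_rfl hσ1 _ _ hsm).trans ?_
    have hw := wf_nonneg (μ := μ) (x - x')
    rw [hϱα]
    have : Λ0 * K * CJ * C1 ^ α ≤ Λ := by
      have : 0 ≤ Λ0 * D0 := by positivity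
      have : 0 ≤ (Cm + 1) * C1 ^ α := by positivity
      linarith
    calc _ = (Λ0 * K * CJ * C1 ^ α) * wf μ (x - x') * (C1 * σ) ^ (-α) * ‖u‖ := by ring
      _ ≤ _ := by gcongr
  obtain ⟨L, hLg, hLe⟩ := exists_var (c := Λ * (C1 * σ) ^ (-α)) hμ.1 hgen (fun x x' u => (hreg' x x' u).trans (le_of_eq (by ring)))
  refine ⟨𝓛, L, ⟨by positivity, hσ4, fun x => ⟨⟨m, hgen x⟩, ?_, hcJ x, ?_, ?_⟩, hgen, hLg, hLe, ?_, hreg, hreg'⟩, ?_⟩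
  · intro h
    exact ((conv_tr _ _).mul_left (conv_tr _ _)).sub_left ((Commute.one_left _).smul_left _)
  · -- blk
    intro r hr hr1 u a hu
    have ha : 0 ≤ a := (abs_nonneg _).trans (hu.abs_le 0)
    have hr0 : 0 < r := by linarith
    have e : 𝓛 x u = J σ (conv (nuM P α σ (A x) (b x)) u - m • u) + m • (J σ u - u) := by
      have e1 : conv (nuM P α σ (A x) (b x)) (J σ u) = J σ (conv (nuM P α σ (A x) (b x)) u) :=
        congrArg (fun T : Op d => T u) (conv_comm _ _).eq
      change conv (nuM P α σ (A x) (b x)) (J σ u) - m • u = _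
      rw [e1, map_sub, map_smul]; module
    have h1 : ‖conv (nuM P α σ (A x) (b x)) u - m • u‖ ≤ Λ0 * D0 * a * r ^ (-α) := by
      refine XX.norm_le_of fun z => ?_
      change |conv (nuM P α σ (A x) (b x)) u z - m * u z| ≤ _
      rw [conv_apply, hP.nu_apply hσ]
      have e0 : m * u z = Nf P α σ 0 0 u z := by
        unfold Nf Bf
        simp only [_root_.zero_apply, sub_self, smul_zero, add_zero, integral_const, measureReal_restrict_apply_univ, smul_eq_mul]
        rw [hm, nuMass]; ring
      rw [e0]
      refine hN P hP σ r hσ (hσϱ.trans hr) hr1 _ _ _ _ D0 (hco.nA x) (by simpa using hK) (hco.nb x) (by simpa using hK) ?_ ?_ ?_ u a hu z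
      · rw [sub_zero]; exact (hco.nA x).trans (le_max_left _ _)
      · rw [sub_zero]; exact (Real.rpow_le_rpow (norm_nonneg _) (hco.nA x) hμ.1.le).trans (le_max_right _ _)
      · rw [sub_zero]; exact (hco.nb x).trans (le_max_left _ _)
    have h2 := J_sub_one_le hr0 hσ.le hu
    have h3 : m * ‖J σ u - u‖ ≤ (Cm + 1) * C1 ^ α * a * r ^ (-α) := by
      calc m * ‖J σ u - u‖ ≤ (Cm + 1) * σ ^ (-α) * (a * σ ^ 2 / r ^ 2) := by gcongr
        _ = (Cm + 1) * a * (σ ^ (2 - α)) * (r ^ 2)⁻¹ := by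
            rw [show (2:ℝ) - α = -α + 2 by ring, Real.rpow_add hσ, Real.rpow_two]; ring
        _ ≤ (Cm + 1) * a * (r ^ (2 - α)) * (r ^ 2)⁻¹ := by
            have h5 : σ ≤ r := hσϱ.trans hr
            have h6 : 0 ≤ 2 - α := by linarith [hα.2]
            gcongr
        _ = (Cm + 1) * 1 * a * r ^ (-α) := by
            rw [show (2:ℝ) - α = -α + 2 by ring, Real.rpow_add hr0, Real.rpow_two]
            field_simp
        _ ≤ _ := by gcongr
    rw [e]
    refine (norm_add_le _ _).trans ?_
    have h4 := (J_norm_apply_le σ (conv (nuM P α σ (A x) (b x)) u - m • u)).trans h1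
    rw [norm_smul, Real.norm_of_nonneg hm0]
    have h5 : 0 ≤ a * r ^ (-α) := by positivity
    have h6 : 0 ≤ Λ0 * K * CJ * C1 ^ α := by positivity
    calc _ ≤ Λ0 * D0 * a * r ^ (-α) + (Cm + 1) * C1 ^ α * a * r ^ (-α) := add_le_add h4 h3
      _ = (Λ0 * D0 + (Cm + 1) * C1 ^ α) * (a * r ^ (-α)) := by ring
      _ ≤ Λ * (a * r ^ (-α)) := by
          refine mul_le_mul_of_nonneg_right ?_ h5
          linarith
      _ = _ := by ring
  · -- low
    intro r hr hr2
    have hr0 : 0 < r := lt_of_lt_of_le (by positivity) hr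
    refine ⟨σ, hσ.le, hσϱ, ?_⟩
    set k := κ * r ^ (-α) with hk
    have hk0 : 0 ≤ k := by positivity
    have hle : k.toNNReal • etaR d (r0 * r) ≤ nuM P α σ (A x) (b x) :=
      (hlow x σ r hσ hr hr2).trans (Measure.le_add_right le_rfl)
    set ν' := nuM P α σ (A x) (b x) - k.toNNReal • etaR d (r0 * r) with hν'
    have hfν : IsFiniteMeasure ν' := by rw [hν']; infer_instance
    have hsum : ν' + k.toNNReal • etaR d (r0 * r) = nuM P α σ (A x) (b x) := Measure.sub_add_cancel_of_le hle
    have hcs : conv (nuM P α σ (A x) (b x)) = conv ν' + k • J (r0 * r) := by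
      have h1 : conv (nuM P α σ (A x) (b x)) = conv (ν' + k.toNNReal • etaR d (r0 * r)) := by
        congr 1; exact hsum.symm
      rw [h1, conv_add, conv_smul, Real.coe_toNNReal _ hk0]; rfl
    have hmass : ν'.real univ = m - k := by
      have h1 := hP.nu_mass hσ (A x) (b x)
      rw [← hsum, measureReal_add_apply, measureReal_nnreal_smul_apply] at h1
      simp [hk0] at h1
      linarith
    have hop : 𝓛 x - k • (J (r0 * r) * J σ - 1) + (m - k) • (1 : Op d) = conv ν' * J σ := by
      change conv (nuM P α σ (A x) (b x)) * J σ - m • (1 : Op d) - k • (J (r0 * r) * J σ - 1) + (m - k) • (1 : Op d) = _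
      rw [hcs, add_mul, smul_mul_assoc]; module
    refine ⟨m - k, ?_, ?_⟩
    · change 𝓛 x 1 - k • (J (r0 * r) (J σ 1) - 1) = 0
      rw [(hgen x).1, J_one, J_one, sub_self, smul_zero, sub_self]
    · rw [hop]
      refine (norm_mul_le _ _).trans ?_
      have h1 := norm_conv_le ν'
      rw [hmass] at h1
      have h0 : 0 ≤ m - k := (ContinuousLinearMap.opNorm_nonneg _).trans h1
      calc _ ≤ (m - k) * 1 := mul_le_mul h1 (norm_J_le σ) (ContinuousLinearMap.opNorm_nonneg _) h0
        _ = m - k := mul_one _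
  · refine hmle.trans ?_
    rw [hϱα, ← mul_assoc]
    refine mul_le_mul_of_nonneg_right ?_ (by positivity)
    have : 0 ≤ Λ0 * D0 := by positivity
    have : 0 ≤ Λ0 * K * CJ * C1 ^ α := by positivity
    linarith
  · intro u x
    rw [hLe, hLap]

end concrete

/-! ## Part 11 -/
open scoped BoundedContinuousFunction ContDiff
set_option linter.unusedSectionVars false
set_option linter.unusedVariables false

section polar
variable {d : ℕ}

def vd (d : ℕ) : ℝ := d * (volume : Measure (Euc d)).real (Metric.ball 0 1)
lemma vd_nonneg (d : ℕ) : 0 ≤ vd d := by unfold vd; positivity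

lemma polar [NeZero d] {I : Set ℝ} (hI : MeasurableSet I) {e q : ℝ} (hq : q = d - 1 + e)
    (hIntg : IntegrableOn (fun t : ℝ => t ^ q) (I ∩ Ioi 0)) :
    IntegrableOn (fun y : Euc d => ‖y‖ ^ e) {y | ‖y‖ ∈ I} ∧
    ∫ y in {y : Euc d | ‖y‖ ∈ I}, ‖y‖ ^ e = vd d * ∫ t in I ∩ Ioi 0, t ^ q := by
  have hfr : Module.finrank ℝ (Euc d) = d := by simp
  have hd1 : 1 ≤ d := NeZero.one_le
  have : Nontrivial (Euc d) := Module.nontrivial_of_finrank_pos (R := ℝ) (by rw [hfr]; omega)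
  have hm : MeasurableSet {y : Euc d | ‖y‖ ∈ I} := measurable_norm hI
  have e1 : ({y : Euc d | ‖y‖ ∈ I}).indicator (fun y : Euc d => ‖y‖ ^ e) = fun y => (I.indicator (fun t => t ^ e)) ‖y‖ := by
    ext y; by_cases h : ‖y‖ ∈ I <;> simp [indicator, h]
  have e2 : ∀ t ∈ Ioi (0:ℝ), t ^ (d - 1) • I.indicator (fun t => t ^ e) t = I.indicator (fun t => t ^ q) t := by
    intro t ht
    by_cases h : t ∈ I
    · simp only [indicator, h, if_true, smul_eq_mul]
      rw [hq, Real.rpow_add ht, ← Real.rpow_natCast, Nat.cast_sub hd1]; simp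
    · simp [indicator, h]
  rw [← integrableOn_indicator_iff] at hIntg
  · constructor
    · rw [← integrable_indicator_iff hm, e1, integrable_fun_norm_addHaar, hfr]
      exact hIntg.congr_fun (fun t ht => (e2 t ht).symm) measurableSet_Ioi
    · rw [← integral_indicator hm, e1, integral_fun_norm_addHaar, hfr, setIntegral_congr_fun measurableSet_Ioi e2,
        setIntegral_indicator hI, inter_comm, nsmul_eq_mul, smul_eq_mul, vd, mul_assoc]
  · exact hI

/-- reference measure -/
def Qm (d : ℕ) (α : ℝ) : Measure (Euc d) := volume.withDensity (fun y => ENNReal.ofReal (‖y‖ ^ (-((d:ℝ) + α))))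

lemma Qm_meas (α : ℝ) : Measurable (fun y : Euc d => ‖y‖ ^ (-((d:ℝ) + α))) := measurable_norm.pow_const _

lemma Qm_set {α : ℝ} {S : Set (Euc d)} (hS : MeasurableSet S) {s : ℝ}
    (hi : IntegrableOn (fun y : Euc d => ‖y‖ ^ (-((d:ℝ) + α)) * ‖y‖ ^ s) S) :
    IntegrableOn (fun y => ‖y‖ ^ s) S (Qm d α) ∧
    ∫ y in S, ‖y‖ ^ s ∂(Qm d α) = ∫ y in S, ‖y‖ ^ (-((d:ℝ) + α)) * ‖y‖ ^ s := by
  have hm := (Qm_meas (d := d) α).ennreal_ofReal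
  have hr : (Qm d α).restrict S = (volume.restrict S).withDensity (fun y => ENNReal.ofReal (‖y‖ ^ (-((d:ℝ) + α)))) :=
    restrict_withDensity hS _
  have ht : ∀ y : Euc d, (ENNReal.ofReal (‖y‖ ^ (-((d:ℝ) + α)))).toReal = ‖y‖ ^ (-((d:ℝ) + α)) := fun y =>
    ENNReal.toReal_ofReal (by positivity)
  constructor
  · rw [IntegrableOn, hr, integrable_withDensity_iff_integrable_smul' hm (by simp)]
    simp only [ht, smul_eq_mul]; exact hi
  · rw [hr, integral_withDensity_eq_integral_toReal_smul hm (by simp)]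
    simp only [ht, smul_eq_mul]

lemma rpow_mul_norm [NeZero d] (a b : ℝ) : (fun y : Euc d => ‖y‖ ^ a * ‖y‖ ^ b) =ᵐ[volume] fun y => ‖y‖ ^ (a + b) := by
  have hfr : Module.finrank ℝ (Euc d) = d := by simp
  have : Nontrivial (Euc d) := Module.nontrivial_of_finrank_pos (R := ℝ) (by rw [hfr]; exact Nat.pos_of_ne_zero (NeZero.ne d))
  have : ∀ᵐ y : Euc d, y ≠ 0 := by
    rw [ae_iff]; simp
  filter_upwards [this] with y hy
  rw [Real.rpow_add (norm_pos_iff.2 hy)]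

lemma Qm_big [NeZero d] {α s r : ℝ} (hs : s < α) (hr : 0 < r) :
    IntegrableOn (fun y => ‖y‖ ^ s) (Sx d r) (Qm d α) ∧ ∫ y in Sx d r, ‖y‖ ^ s ∂(Qm d α) = vd d / (α - s) * r ^ (s - α) := by
  have hII : Ioi r ∩ Ioi (0:ℝ) = Ioi r := inter_eq_left.2 (Ioi_subset_Ioi hr.le)
  have hp := polar (d := d) (I := Ioi r) measurableSet_Ioi (e := -((d:ℝ) + α) + s) (q := s - α - 1) (by ring)
    (by rw [hII]; exact integrableOn_Ioi_rpow_of_lt (by linarith) hr)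
  rw [hII, integral_Ioi_rpow_of_lt (by linarith) hr] at hp
  have hae : (fun y : Euc d => ‖y‖ ^ (-((d:ℝ) + α)) * ‖y‖ ^ s) =ᵐ[volume.restrict (Sx d r)] _ := ae_restrict_of_ae (rpow_mul_norm _ _)
  obtain ⟨h1, h2⟩ := Qm_set (α := α) (s := s) (Sx_meas r) (Integrable.congr hp.1 hae.symm)
  refine ⟨h1, h2.trans ?_⟩
  rw [integral_congr_ae hae]
  refine hp.2.trans ?_
  rw [show s - α - 1 + 1 = -(α - s) by ring, show s - α = -(α - s) by ring]
  have : α - s ≠ 0 := by linarith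
  field_simp

lemma Qm_sml [NeZero d] {α γ r : ℝ} (hs : α < γ) (hr : 0 < r) :
    IntegrableOn (fun y => ‖y‖ ^ γ) (Sx d r)ᶜ (Qm d α) ∧ ∫ y in (Sx d r)ᶜ, ‖y‖ ^ γ ∂(Qm d α) = vd d / (γ - α) * r ^ (γ - α) := by
  have hII : Iic r ∩ Ioi (0:ℝ) = Ioc 0 r := by ext; simp [and_comm]
  have hii := (intervalIntegrable_iff_integrableOn_Ioc_of_le hr.le).1
      (intervalIntegral.intervalIntegrable_rpow' (r := γ - α - 1) (a := 0) (b := r) (by linarith))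
  have hp := polar (d := d) (I := Iic r) measurableSet_Iic (e := -((d:ℝ) + α) + γ) (q := γ - α - 1) (by ring)
    (by rw [hII]; exact hii)
  have hSx : {y : Euc d | ‖y‖ ∈ Iic r} = (Sx d r)ᶜ := by ext; simp [Sx]
  rw [hII, ← intervalIntegral.integral_of_le hr.le, integral_rpow (Or.inl (by linarith)), hSx] at hp
  have hae : (fun y : Euc d => ‖y‖ ^ (-((d:ℝ) + α)) * ‖y‖ ^ γ) =ᵐ[volume.restrict (Sx d r)ᶜ] _ := ae_restrict_of_ae (rpow_mul_norm _ _)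
  obtain ⟨h1, h2⟩ := Qm_set (α := α) (s := γ) (Sx_meas r).compl (Integrable.congr hp.1 hae.symm)
  refine ⟨h1, h2.trans ?_⟩
  rw [integral_congr_ae hae]
  refine hp.2.trans ?_
  rw [show γ - α - 1 + 1 = γ - α by ring, Real.zero_rpow (by linarith)]
  have : γ - α ≠ 0 := by linarith
  field_simp
  simp

/-- the Lévy measure -/
def Pm (d : ℕ) (α : ℝ) (ρ : Euc d → ℝ) : Measure (Euc d) :=
  (volume.restrict {y : Euc d | ‖y‖ ≤ 1}).withDensity (fun y => ENNReal.ofReal (ρ y * ‖y‖ ^ (-((d:ℝ) + α))))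

lemma rho_meas {c0 K μ α : ℝ} (hμ : 0 < μ) {ρ : Euc d → ℝ} (hS : AssumpS d α c0 ρ)
    (hρ : ∀ y z : Euc d, ‖y‖ = 1 → ‖z‖ = 1 → |ρ y - ρ z| ≤ K * ‖y - z‖ ^ μ) : Measurable ρ := by
  refine measurable_of_continuousOn_compl_singleton 0 ?_
  have h1 : ContinuousOn ρ (Metric.sphere 0 1) := by
    intro z hz
    rw [ContinuousWithinAt, tendsto_iff_norm_sub_tendsto_zero]
    have ht : Filter.Tendsto (fun y => K * ‖y - z‖ ^ μ) (nhdsWithin z (Metric.sphere 0 1)) (nhds 0) := by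
      have hc : Continuous (fun y : Euc d => K * ‖y - z‖ ^ μ) :=
        continuous_const.mul ((by fun_prop : Continuous fun y : Euc d => ‖y - z‖).rpow_const (fun _ => Or.inr hμ.le))
      have := (hc.tendsto z).mono_left (nhdsWithin_le_nhds (s := Metric.sphere 0 1))
      simpa [Real.zero_rpow hμ.ne'] using this
    refine squeeze_zero' (Filter.Eventually.of_forall fun _ => norm_nonneg _) ?_ ht
    filter_upwards [self_mem_nhdsWithin] with y hy
    exact hρ y z (by simpa using hy) (by simpa using hz)
  have h2 : ContinuousOn (fun y : Euc d => ρ (‖y‖⁻¹ • y)) {0}ᶜ := by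
    refine h1.comp (t := Metric.sphere 0 1) (f := fun y : Euc d => ‖y‖⁻¹ • y) ?_ ?_
    · refine ContinuousOn.smul (ContinuousOn.inv₀ continuous_norm.continuousOn ?_) continuousOn_id
      intro y hy; simpa using hy
    · intro y hy
      have : y ≠ 0 := hy
      simp [norm_smul, this]
  refine h2.congr fun y hy => ?_
  have : y ≠ 0 := hy
  exact (hS.2.1 _ (by positivity) y this).symm

lemma Pm_le {α K : ℝ} (hK : 0 ≤ K) {ρ : Euc d → ℝ} [NeZero d] (hρK : ∀ y : Euc d, y ≠ 0 → ρ y ≤ K) :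
    Pm d α ρ ≤ K.toNNReal • Qm d α := by
  have hfr : Module.finrank ℝ (Euc d) = d := by simp
  have : Nontrivial (Euc d) := Module.nontrivial_of_finrank_pos (R := ℝ) (by rw [hfr]; exact Nat.pos_of_ne_zero (NeZero.ne d))
  have hne : ∀ᵐ y : Euc d, y ≠ 0 := by
    rw [ae_iff]; simp
  have hm := (Qm_meas (d := d) α).ennreal_ofReal
  calc Pm d α ρ ≤ (volume.restrict {y : Euc d | ‖y‖ ≤ 1}).withDensity (fun y => K.toNNReal • ENNReal.ofReal (‖y‖ ^ (-((d:ℝ) + α)))) := by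
        refine withDensity_mono (ae_restrict_of_ae (hne.mono fun y hy => ?_))
        change ENNReal.ofReal (ρ y * ‖y‖ ^ (-((d:ℝ) + α))) ≤ ENNReal.ofReal K * ENNReal.ofReal (‖y‖ ^ (-((d:ℝ) + α)))
        rw [← ENNReal.ofReal_mul hK]
        exact ENNReal.ofReal_le_ofReal (mul_le_mul_of_nonneg_right (hρK y hy) (by positivity))
    _ = K.toNNReal • (volume.restrict {y : Euc d | ‖y‖ ≤ 1}).withDensity (fun y => ENNReal.ofReal (‖y‖ ^ (-((d:ℝ) + α)))) := by
        exact withDensity_smul (K.toNNReal : ℝ≥0∞) hm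
    _ ≤ K.toNNReal • Qm d α := by
        rw [← restrict_withDensity (measurableSet_le measurable_norm measurable_const)]
        have := Measure.restrict_le_self (μ := Qm d α) (s := {y : Euc d | ‖y‖ ≤ 1})
        intro S
        exact mul_le_mul_right (this S) _

lemma Pm_levy (d : ℕ) [NeZero d] {α K : ℝ} (hα : α ∈ Ico (1:ℝ) 2) (hK : 0 ≤ K) : ∃ Cm : ℝ, 0 ≤ Cm ∧
    ∀ (ρ : Euc d → ℝ), Measurable ρ → (∀ y : Euc d, y ≠ 0 → ρ y ≤ K) → (α = 1 → ∀ y : Euc d, y ≠ 0 → ρ (-y) = ρ y) →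
    Levy α Cm (Pm d α ρ) := by
  have hfr : Module.finrank ℝ (Euc d) = d := by simp
  have : Nontrivial (Euc d) := Module.nontrivial_of_finrank_pos (R := ℝ) (by rw [hfr]; exact Nat.pos_of_ne_zero (NeZero.ne d))
  have hne : ∀ᵐ y : Euc d, y ≠ 0 := by
    rw [ae_iff]; simp
  have hv := vd_nonneg d
  have hα1 : 0 ≤ (α - 1)⁻¹ := inv_nonneg.2 (by linarith [hα.1])
  refine ⟨K * vd d * (1 + (α - 1)⁻¹), by positivity, fun ρ hρm hρK hev => ?_⟩
  set Cm := K * vd d * (1 + (α - 1)⁻¹) with hCm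
  have hC0 : 0 ≤ Cm := by positivity
  have hKv : K * vd d ≤ Cm := by rw [hCm]; nlinarith [mul_nonneg (mul_nonneg hK hv) hα1]
  have hle := Pm_le (d := d) (α := α) hK hρK
  have key : ∀ (S : Set (Euc d)) (s : ℝ), IntegrableOn (fun y => ‖y‖ ^ s) S (Qm d α) →
      IntegrableOn (fun y => ‖y‖ ^ s) S (Pm d α ρ) ∧ ∫ y in S, ‖y‖ ^ s ∂(Pm d α ρ) ≤ K * ∫ y in S, ‖y‖ ^ s ∂(Qm d α) := by
    intro S s hi
    have h1 : (Pm d α ρ).restrict S ≤ K.toNNReal • (Qm d α).restrict S := by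
      rw [← Measure.restrict_smul]; exact Measure.restrict_mono_measure hle S
    have h2 : Integrable (fun y => ‖y‖ ^ s) (K.toNNReal • (Qm d α).restrict S) := hi.smul_measure_nnreal
    refine ⟨h2.mono_measure h1, ?_⟩
    refine (integral_mono_measure h1 (Filter.Eventually.of_forall fun y => by positivity) h2).trans ?_
    rw [integral_smul_nnreal_measure, NNReal.smul_def, Real.coe_toNNReal _ hK, smul_eq_mul]
  have hbig : ∀ s, s < α → ∀ r, 0 < r → IntegrableOn (fun y => ‖y‖ ^ s) (Sx d r) (Pm d α ρ) ∧
      ∫ y in Sx d r, ‖y‖ ^ s ∂(Pm d α ρ) ≤ K * vd d / (α - s) * r ^ (s - α) := by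
    intro s hs r hr
    obtain ⟨h1, h2⟩ := Qm_big (d := d) hs hr
    obtain ⟨h3, h4⟩ := key _ s h1
    refine ⟨h3, h4.trans (le_of_eq ?_)⟩
    rw [h2]; ring
  have hdm : Measurable (fun y => ENNReal.ofReal (ρ y * ‖y‖ ^ (-((d:ℝ) + α)))) := (hρm.mul (Qm_meas α)).ennreal_ofReal
  have hm1 : MeasurableSet {y : Euc d | ‖y‖ ≤ 1} := measurableSet_le measurable_norm measurable_const
  have hfin : ∀ r, 0 < r → Pm d α ρ (Sx d r) < ⊤ := by
    intro r hr
    have := (hbig 0 (by linarith [hα.1]) r hr).1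
    simpa [IntegrableOn, integrable_const_iff, isFiniteMeasure_iff] using this
  refine ⟨hC0, ?_, hfin, ?_, ?_, ?_, ?_⟩
  · refine (withDensity_absolutelyContinuous _ _).ae_le ?_
    exact ae_restrict_mem hm1
  · intro r hr hr1
    have := (hbig 0 (by linarith [hα.1]) r hr).2
    simp only [Real.rpow_zero, integral_const, measureReal_restrict_apply_univ, smul_eq_mul, mul_one, sub_zero, zero_sub] at this
    refine this.trans ?_
    gcongr
    exact (div_le_self (by positivity) hα.1).trans hKv
  · intro s hs0 hs r hr hr1
    refine (hbig s hs r hr).2.trans ?_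
    have : 0 < α - s := by linarith
    gcongr
  · intro γ hγ r hr hr1
    obtain ⟨h1, h2⟩ := Qm_sml (d := d) hγ hr
    obtain ⟨h3, h4⟩ := key _ γ h1
    refine ⟨h3, h4.trans ?_⟩
    have : 0 < γ - α := by linarith
    rw [h2]
    calc _ = (K * vd d) / (γ - α) * r ^ (γ - α) := by ring
      _ ≤ _ := by gcongr
  · intro r hr hr1
    rcases eq_or_lt_of_le hα.1 with h1 | h1
    · have hz : ∫ y in Sx d r, y ∂(Pm d α ρ) = 0 := by
        rw [← integral_indicator (Sx_meas r), Pm, integral_withDensity_eq_integral_toReal_smul hdm (by simp), ← integral_indicator hm1]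
        set f : Euc d → Euc d := _ with hf
        change ∫ x, f x = 0
        have hodd : ∫ x, f (-x) = - ∫ x, f x := by
          rw [← integral_neg]
          refine integral_congr_ae (hne.mono fun y hy => ?_)
          have hev' := hev h1.symm y hy
          by_cases hy1 : ‖y‖ ≤ 1 <;> by_cases hyr : r < ‖y‖ <;> simp [hf, indicator, Sx, hy1, hyr, hev']
        rw [integral_neg_eq_self] at hodd
        have h2 : (2:ℝ) • ∫ x, f x = 0 := by rw [two_smul]; nth_rewrite 1 [hodd]; exact neg_add_cancel _
        exact (smul_eq_zero.1 h2).resolve_left two_ne_zero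
      rw [hz, norm_zero]; positivity
    · obtain ⟨h3, h4⟩ := hbig 1 h1 r hr
      refine (norm_integral_le_integral_norm _).trans ?_
      simp only [Real.rpow_one] at h4
      refine h4.trans ?_
      gcongr
      rw [hCm, div_eq_mul_inv]
      have : 0 ≤ K * vd d := by positivity
      nlinarith

end polar

/-! ## Part 12 -/
open scoped BoundedContinuousFunction ContDiff
set_option linter.unusedSectionVars false
set_option linter.unusedVariables false

section lowb
variable {d : ℕ}

lemma matCLM_det (M : Matrix (Fin d) (Fin d) ℝ) : (matCLM M).det = M.det := by
  rw [ContinuousLinearMap.det]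
  have : ((matCLM M : Euc d →L[ℝ] Euc d) : Euc d →ₗ[ℝ] Euc d) = Matrix.toEuclideanLin M := rfl
  rw [this, Matrix.toEuclideanLin_eq_toLin_orthonormal, LinearMap.det_toLin]

lemma exists_inv (d : ℕ) {K c0 : ℝ} (hc0 : 0 < c0) : ∃ Ci Dt : ℝ, 1 ≤ Ci ∧ 1 ≤ Dt ∧
    ∀ A : Euc d →L[ℝ] Euc d, ‖A‖ ≤ K → c0 ≤ |A.det| → (∀ y, ‖y‖ ≤ Ci * ‖A y‖) ∧ |A.det| ≤ Dt := by
  have : ProperSpace (Euc d →L[ℝ] Euc d) := FiniteDimensional.proper ℝ _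
  have hdc : Continuous fun A : Euc d →L[ℝ] Euc d => |A.det| := ContinuousLinearMap.continuous_det.abs
  set S : Set (Euc d →L[ℝ] Euc d) := Metric.closedBall 0 K ∩ {A | c0 ≤ |A.det|} with hS
  have hSc : IsCompact S := (isCompact_closedBall _ _).inter_right (isClosed_le continuous_const hdc)
  obtain ⟨Dt, hDt⟩ := hSc.bddAbove_image hdc.continuousOn
  have hcs : IsCompact (S ×ˢ (Metric.sphere (0 : Euc d) 1)) := hSc.prod (isCompact_sphere _ _)
  have hpos : ∀ p ∈ S ×ˢ (Metric.sphere (0 : Euc d) 1), 0 < ‖p.1 p.2‖ := by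
    rintro ⟨A, y⟩ ⟨hA, hy⟩
    rw [norm_pos_iff]
    intro h0
    have hdet : A.det ≠ 0 := by
      intro h; have := hA.2; simp only [mem_ofPred_eq, h, abs_zero] at this; linarith
    have hinj := LinearMap.ker_eq_bot'.1 (LinearMap.ker_eq_bot_of_injective
      ((LinearMap.equivOfDetNeZero (A : Euc d →ₗ[ℝ] Euc d) hdet).injective)) y h0
    simp [hinj] at hy
  have hfc : ContinuousOn (fun p : (Euc d →L[ℝ] Euc d) × Euc d => ‖p.1 p.2‖⁻¹) (S ×ˢ (Metric.sphere (0 : Euc d) 1)) :=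
    ContinuousOn.inv₀ (by fun_prop) (fun p hp => (hpos p hp).ne')
  obtain ⟨Ci, hCi⟩ := hcs.bddAbove_image hfc
  refine ⟨max Ci 1, max Dt 1, le_max_right _ _, le_max_right _ _, fun A hA hdet => ?_⟩
  have hAS : A ∈ S := ⟨by simpa using hA, hdet⟩
  refine ⟨fun y => ?_, (hDt (mem_image_of_mem _ hAS)).trans (le_max_left _ _)⟩
  rcases eq_or_ne y 0 with rfl | hy
  · simp
  have hy' : 0 < ‖y‖ := norm_pos_iff.2 hy
  have hmem : (A, ‖y‖⁻¹ • y) ∈ S ×ˢ (Metric.sphere (0 : Euc d) 1) := ⟨hAS, by simp [norm_smul, hy]⟩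
  have h1 := (hCi (mem_image_of_mem _ hmem)).trans (le_max_left Ci 1)
  have h2 := hpos _ hmem
  simp only [map_smul, norm_smul, norm_inv, norm_norm, mul_inv, inv_inv] at h1 h2
  have h3 : 0 < ‖A y‖ := by
    by_contra h; have : ‖A y‖ = 0 := le_antisymm (not_lt.1 h) (norm_nonneg _); simp [this] at h2
  rw [mul_inv_le_iff₀ h3] at h1
  exact h1

lemma eta_bdd (d : ℕ) : ∃ E : ℝ, 1 ≤ E ∧ ∀ z : Euc d, eta z ≤ E := by
  obtain ⟨C, hC⟩ := eta_cont.bounded_above_of_compact_support (eta_compact (d := d))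
  exact ⟨max C 1, le_max_right _ _, fun z => (le_abs_self _).trans ((hC z).trans (le_max_left _ _))⟩

lemma etaR_le {E : ℝ} (hE : ∀ z : Euc d, eta z ≤ E) {s : ℝ} (hs : 0 < s) {S : Set (Euc d)} (hS : MeasurableSet S) :
    etaR d s S ≤ ENNReal.ofReal (E * (s ^ d)⁻¹) * volume (S ∩ {w | s/2 < ‖w‖ ∧ ‖w‖ < s}) := by
  have hann : MeasurableSet {w : Euc d | s/2 < ‖w‖ ∧ ‖w‖ < s} :=
    (measurableSet_lt measurable_const measurable_norm).inter (measurableSet_lt measurable_norm measurable_const)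
  have hE0 : 0 ≤ E := (eta_nonneg 0).trans (hE 0)
  have hms : Measurable fun z : Euc d => s • z := by fun_prop
  have h1 : etaM d ((fun z => s • z) ⁻¹' S) ≤ ENNReal.ofReal E * volume ((fun z : Euc d => s • z) ⁻¹' (S ∩ {w | s/2 < ‖w‖ ∧ ‖w‖ < s})) := by
    rw [etaM, withDensity_apply _ (hms hS), ← lintegral_indicator (hms hS), ← setLIntegral_const, ← lintegral_indicator (hms (hS.inter hann))]
    refine lintegral_mono fun z => ?_
    by_cases hz : eta z = 0
    · simp [indicator, hz]
    · have := eta_supp hz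
      by_cases hzS : s • z ∈ S
      · have h2 : z ∈ (fun z : Euc d => s • z) ⁻¹' (S ∩ {w | s/2 < ‖w‖ ∧ ‖w‖ < s}) := by
          refine ⟨hzS, ?_, ?_⟩ <;> simp only [norm_smul, Real.norm_of_nonneg hs.le] <;> nlinarith
        rw [indicator_of_mem (by exact hzS), indicator_of_mem h2]
        exact ENNReal.ofReal_le_ofReal (hE z)
      · rw [indicator_of_notMem (by exact hzS)]; exact zero_le
  rw [etaR, Measure.map_apply hms hS]
  refine h1.trans (le_of_eq ?_)
  rw [Measure.addHaar_preimage_smul _ hs.ne', ← mul_assoc, ENNReal.ofReal_mul hE0]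
  simp [abs_of_pos hs]

lemma Pm_low {α c0 Ci Dt s σ : ℝ} (hα : 0 ≤ α) (hc0 : 0 < c0) (hs : 0 < s) {ρ : Euc d → ℝ} (hρm : Measurable ρ)
    (hρ : ∀ y : Euc d, y ≠ 0 → c0 ≤ ρ y) {A : Euc d →L[ℝ] Euc d} (hCi : 1 ≤ Ci) (hdet : A.det ≠ 0)
    (hDt : |A.det| ≤ Dt) (hinv : ∀ y, ‖y‖ ≤ Ci * ‖A y‖) (hsσ : ‖A‖ * (2 * σ) ≤ s) (hσ : 0 < σ) (hCs : Ci * s ≤ 1)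
    {S : Set (Euc d)} (hS : MeasurableSet S) :
    ENNReal.ofReal (c0 * (Ci * s) ^ (-((d:ℝ) + α)) * Dt⁻¹) * volume (S ∩ {w | s/2 < ‖w‖ ∧ ‖w‖ < s}) ≤
      ((Pm d α ρ).restrict (Sx d σ)).map A S := by
  have hann : MeasurableSet {w : Euc d | s/2 < ‖w‖ ∧ ‖w‖ < s} :=
    (measurableSet_lt measurable_const measurable_norm).inter (measurableSet_lt measurable_norm measurable_const)
  have hm1 : MeasurableSet {y : Euc d | ‖y‖ ≤ 1} := measurableSet_le measurable_norm measurable_const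
  have hAm : Measurable A := A.continuous.measurable
  set S' := S ∩ {w : Euc d | s/2 < ‖w‖ ∧ ‖w‖ < s} with hS'
  have hS'm : MeasurableSet S' := hS.inter hann
  have hsub : A ⁻¹' S' ⊆ A ⁻¹' S ∩ Sx d σ := by
    rintro y ⟨hy1, hy2, hy3⟩
    refine ⟨hy1, ?_⟩
    change σ < ‖y‖
    by_contra h
    have := A.le_opNorm y
    have h3 : ‖A‖ * ‖y‖ ≤ ‖A‖ * σ := by gcongr; exact not_lt.1 h
    linarith
  have hsub2 : ∀ y ∈ A ⁻¹' S', y ≠ 0 ∧ ‖y‖ ≤ Ci * s := by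
    rintro y ⟨hy1, hy2, hy3⟩
    refine ⟨?_, (hinv y).trans (by gcongr)⟩
    rintro rfl; simp at hy2; linarith
  have hdpos : 0 < |A.det| := abs_pos.2 hdet
  rw [Measure.map_apply hAm hS, Measure.restrict_apply (hAm hS)]
  refine le_trans ?_ (measure_mono hsub)
  rw [Pm, withDensity_apply _ (hAm hS'm), Measure.restrict_restrict (hAm hS'm)]
  have hIntg : A ⁻¹' S' ∩ {y : Euc d | ‖y‖ ≤ 1} = A ⁻¹' S' :=
    inter_eq_left.2 fun y hy => ((hsub2 y hy).2.trans hCs : ‖y‖ ≤ 1)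
  rw [hIntg]
  calc ENNReal.ofReal (c0 * (Ci * s) ^ (-((d:ℝ) + α)) * Dt⁻¹) * volume S'
      ≤ ENNReal.ofReal (c0 * (Ci * s) ^ (-((d:ℝ) + α))) * volume (A ⁻¹' S') := by
        rw [Measure.addHaar_preimage_continuousLinearMap _ hdet, ← mul_assoc, ← ENNReal.ofReal_mul (by positivity), abs_inv]
        gcongr
    _ = ∫⁻ y in A ⁻¹' S', ENNReal.ofReal (c0 * (Ci * s) ^ (-((d:ℝ) + α))) := by rw [setLIntegral_const]
    _ ≤ _ := by
        refine setLIntegral_mono' (hAm hS'm) fun y hy => ENNReal.ofReal_le_ofReal ?_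
        obtain ⟨h1, h2⟩ := hsub2 y hy
        have h3 : 0 < ‖y‖ := norm_pos_iff.2 h1
        have h4 : (Ci * s) ^ (-((d:ℝ) + α)) ≤ ‖y‖ ^ (-((d:ℝ) + α)) :=
          Real.rpow_le_rpow_of_nonpos h3 h2 (by have : (0:ℝ) ≤ d := by positivity
                                                linarith)
        have := hρ y h1
        have h5 : 0 ≤ ρ y := hc0.le.trans this
        gcongr

lemma exists_lowB (d : ℕ) [NeZero d] {α c0 K : ℝ} (hα : α ∈ Ico (1:ℝ) 2) (hc0 : 0 < c0) (hK : 0 < K) :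
    ∃ κ r0 C1 : ℝ, 0 < κ ∧ 0 < r0 ∧ r0 ≤ 1 ∧ 1 ≤ C1 ∧ ∀ (ρ : Euc d → ℝ) (A : Euc d → (Euc d →L[ℝ] Euc d)),
      Measurable ρ → (∀ y : Euc d, y ≠ 0 → c0 ≤ ρ y) → (∀ x, ‖A x‖ ≤ K) → (∀ x, c0 ≤ |(A x).det|) →
      LowB α κ r0 C1 (Pm d α ρ) A := by
  obtain ⟨Ci, Dt, hCi, hDt, hinv⟩ := exists_inv d (K := K) hc0
  obtain ⟨E, hE1, hE⟩ := eta_bdd d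
  have hr0 : (2 * Ci)⁻¹ ≤ 1 := inv_le_one_of_one_le₀ (by linarith)
  refine ⟨c0 / (Dt * E * (2 * Ci) ^ d), (2 * Ci)⁻¹, 4 * K * Ci + 1, by positivity, by positivity, hr0, by nlinarith [mul_pos hK (by linarith : 0 < Ci)], ?_⟩
  intro ρ A hρm hρ hAK hAd x σ r hσ hC1 hr2
  have hCi0 : 0 < Ci := by linarith
  have hKC : 0 < K * Ci := mul_pos hK hCi0
  have hr : 0 < r := lt_of_lt_of_le (by positivity) hC1
  obtain ⟨h1, h2⟩ := hinv (A x) (hAK x) (hAd x)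
  have hs : 0 < (2 * Ci)⁻¹ * r := by positivity
  have hCs : Ci * ((2 * Ci)⁻¹ * r) = r / 2 := by field_simp
  have hdet : (A x).det ≠ 0 := by
    intro h; have := hAd x; simp only [h, abs_zero] at this; linarith
  rw [Measure.le_iff]
  intro S hS
  have hlow := Pm_low (α := α) (by linarith [hα.1]) hc0 hs hρm hρ (A := A x) hCi hdet h2 h1 (σ := σ) (by
    rw [inv_mul_eq_div, le_div_iff₀ (by positivity)]
    have h5 : ‖A x‖ * (2 * σ) * (2 * Ci) ≤ K * (2 * σ) * (2 * Ci) := by gcongr; exact hAK x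
    nlinarith) hσ (by rw [hCs]; linarith) hS
  refine le_trans ?_ hlow
  have hup := etaR_le hE hs hS
  rw [Measure.smul_apply]
  change ENNReal.ofReal _ * etaR d ((2 * Ci)⁻¹ * r) S ≤ _
  refine (mul_le_mul_right hup _).trans ?_
  rw [← mul_assoc, ← ENNReal.ofReal_mul (by positivity)]
  refine mul_le_mul_left (ENNReal.ofReal_le_ofReal ?_) _
  rw [hCs]
  have e1 : r ^ (-((d:ℝ) + α)) ≤ (r / 2) ^ (-((d:ℝ) + α)) :=
    Real.rpow_le_rpow_of_nonpos (by positivity) (by linarith) (by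
      have : (0:ℝ) ≤ d := by positivity
      linarith [hα.1])
  have e2 : r ^ (-((d:ℝ) + α)) = r ^ (-α) * (r ^ d)⁻¹ := by
    rw [neg_add, add_comm, Real.rpow_add hr, Real.rpow_neg hr.le (d:ℝ), Real.rpow_natCast]
  have hDt0 : 0 < Dt := by linarith
  have hE0 : 0 < E := by linarith
  calc c0 / (Dt * E * (2 * Ci) ^ d) * r ^ (-α) * (E * (((2 * Ci)⁻¹ * r) ^ d)⁻¹)
      = c0 * (r ^ (-α) * (r ^ d)⁻¹) * Dt⁻¹ := by
        have e3 : ((2 * Ci)⁻¹ * r) ^ d = ((2 * Ci) ^ d)⁻¹ * r ^ d := by rw [mul_pow _ r, inv_pow]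
        have e4 : 0 < (2 * Ci) ^ d := by positivity
        rw [e3]
        generalize (2 * Ci) ^ d = q at e4
        have e5 : 0 < r ^ d := by positivity
        field_simp
    _ ≤ c0 * (r / 2) ^ (-((d:ℝ) + α)) * Dt⁻¹ := by rw [← e2]; gcongr

end lowb

/-! ## Part 13 -/
open scoped BoundedContinuousFunction ContDiff
set_option linter.unusedSectionVars false
set_option linter.unusedVariables false

section hread
variable {d : ℕ}

lemma hNorm_deriv {β M : ℝ} (hM : 0 ≤ M) {u : Euc d → ℝ} (hu : hNorm d β u ≤ ENNReal.ofReal M) {n : ℕ} (hn : n ≤ ⌊β⌋₊) (x : Euc d) :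
    ‖iteratedFDeriv ℝ n u x‖ ≤ M := by
  have h1 : (‖iteratedFDeriv ℝ n u x‖₊ : ℝ≥0∞) ≤ ENNReal.ofReal M := by
    refine le_trans ?_ hu
    unfold hNorm
    refine le_trans ?_ le_self_add
    refine le_trans (le_iSup (fun x : Euc d => (‖iteratedFDeriv ℝ n u x‖₊ : ℝ≥0∞)) x) ?_
    exact Finset.single_le_sum (f := fun n => ⨆ x : Euc d, (‖iteratedFDeriv ℝ n u x‖₊ : ℝ≥0∞)) (fun _ _ => zero_le) (Finset.mem_range.2 (by omega))
  rw [ENNReal.ofReal, ENNReal.coe_le_coe] at h1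
  have h2 : (‖iteratedFDeriv ℝ n u x‖₊ : ℝ) ≤ (M.toNNReal : ℝ) := h1
  rwa [Real.coe_toNNReal _ hM] at h2

lemma hNorm_hol {β M : ℝ} (hβ : 0 ≤ β) (hM : 0 ≤ M) {u : Euc d → ℝ} (hu : hNorm d β u ≤ ENNReal.ofReal M) (x y : Euc d) :
    ‖iteratedFDeriv ℝ ⌊β⌋₊ u x - iteratedFDeriv ℝ ⌊β⌋₊ u y‖ ≤ M * ‖x - y‖ ^ (β - (⌊β⌋₊:ℝ)) := by
  rcases eq_or_ne x y with rfl | hxy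
  · simp only [sub_self, norm_zero]; positivity
  have hxy' : 0 < ‖x - y‖ := norm_pos_iff.2 (sub_ne_zero.2 hxy)
  have hp : 0 ≤ β - (⌊β⌋₊:ℝ) := sub_nonneg.2 (Nat.floor_le hβ)
  have h1 : (‖iteratedFDeriv ℝ ⌊β⌋₊ u x - iteratedFDeriv ℝ ⌊β⌋₊ u y‖₊ : ℝ≥0∞) / (‖x - y‖₊ : ℝ≥0∞) ^ (β - (⌊β⌋₊ : ℝ)) ≤ ENNReal.ofReal M := by
    refine le_trans ?_ hu
    unfold hNorm
    refine le_trans ?_ le_add_self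
    exact le_iSup₂ (f := fun x y : Euc d => (‖iteratedFDeriv ℝ ⌊β⌋₊ u x - iteratedFDeriv ℝ ⌊β⌋₊ u y‖₊ : ℝ≥0∞) / (‖x - y‖₊ : ℝ≥0∞) ^ (β - (⌊β⌋₊ : ℝ))) x y
  have h0 : ‖x - y‖₊ ≠ 0 := by intro h; rw [← coe_nnnorm, h] at hxy'; simp at hxy'
  rw [← ENNReal.coe_rpow_of_ne_zero h0, ← ENNReal.coe_div (by simp [NNReal.rpow_eq_zero_iff, h0]), ENNReal.ofReal, ENNReal.coe_le_coe] at h1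
  have h2 : ((‖iteratedFDeriv ℝ ⌊β⌋₊ u x - iteratedFDeriv ℝ ⌊β⌋₊ u y‖₊ / ‖x - y‖₊ ^ (β - (⌊β⌋₊ : ℝ)) : ℝ≥0) : ℝ) ≤ (M.toNNReal : ℝ) := h1
  rw [Real.coe_toNNReal _ hM, NNReal.coe_div, NNReal.coe_rpow, coe_nnnorm, coe_nnnorm, div_le_iff₀ (by positivity)] at h2
  exact h2

lemma hNorm_zero {μ M : ℝ} (hμ : μ ∈ Ioo (0:ℝ) 1) (hM : 0 ≤ M) {u : Euc d → ℝ} (hu : hNorm d μ u ≤ ENNReal.ofReal M) :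
    (∀ x, |u x| ≤ M) ∧ ∀ x y, |u x - u y| ≤ M * ‖x - y‖ ^ μ := by
  have hf : ⌊μ⌋₊ = 0 := Nat.floor_eq_zero.2 hμ.2
  constructor
  · intro x
    have := hNorm_deriv hM hu (n := 0) (by omega) x
    rwa [norm_iteratedFDeriv_zero] at this
  · intro x y
    have := hNorm_hol hμ.1.le hM hu x y
    rw [hf, Nat.cast_zero, sub_zero] at this
    refine le_trans ?_ this
    have h2 := (iteratedFDeriv ℝ 0 u x - iteratedFDeriv ℝ 0 u y).le_opNorm (fun _ => 0)
    simpa using h2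

lemma hNorm_fderiv {β M : ℝ} (hβ1 : 1 < β) (hβ3 : β < 3) (hM : 0 ≤ M) {u : Euc d → ℝ} (hc : ContDiff ℝ (⌊β⌋₊:ℕ∞) u)
    (hu : hNorm d β u ≤ ENNReal.ofReal M) (x y : Euc d) :
    ‖fderiv ℝ u x - fderiv ℝ u y‖ ≤ M * ‖x - y‖ ^ (min β 2 - 1) := by
  rcases lt_or_ge β 2 with h2 | h2
  · have hf : ⌊β⌋₊ = 1 := (Nat.floor_eq_iff (by linarith)).2 ⟨by simpa using hβ1.le, by norm_num; linarith⟩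
    have h := hNorm_hol (by linarith) hM hu x y
    rw [hf, Nat.cast_one] at h
    rw [min_eq_left h2.le]
    refine le_trans (ContinuousLinearMap.opNorm_le_bound _ (norm_nonneg _) fun v => ?_) h
    have h3 := (iteratedFDeriv ℝ 1 u x - iteratedFDeriv ℝ 1 u y).le_opNorm (fun _ => v)
    simpa using h3
  · have hf : ⌊β⌋₊ = 2 := (Nat.floor_eq_iff (by linarith)).2 ⟨by simpa using h2, by norm_num; linarith⟩
    rw [hf] at hc
    have hcd : ContDiff ℝ 1 (fderiv ℝ u) := hc.fderiv_right (m := 1) (by norm_num)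
    rw [min_eq_right h2]
    norm_num
    refine convex_univ.norm_image_sub_le_of_norm_fderiv_le (𝕜 := ℝ) (f := fderiv ℝ u) (C := M) (fun z _ => (hcd.differentiable (by norm_num)) z) (fun z _ => ?_) (mem_univ y) (mem_univ x)
    have := hNorm_deriv hM hu (n := 2) (by omega) z
    rwa [← norm_iteratedFDeriv_fderiv, norm_iteratedFDeriv_one] at this

lemma hNorm_taylor {β M : ℝ} (hβ1 : 1 < β) (hβ3 : β < 3) (hM : 0 ≤ M) {u : Euc d → ℝ} (hc : ContDiff ℝ (⌊β⌋₊:ℕ∞) u)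
    (hu : hNorm d β u ≤ ENNReal.ofReal M) (x p : Euc d) :
    |u (x + p) - u x - fderiv ℝ u x p| ≤ M * ‖p‖ ^ (min β 2) := by
  have h1n : 1 ≤ ⌊β⌋₊ := Nat.le_floor (by simpa using hβ1.le)
  have hd : Differentiable ℝ u := hc.differentiable (by
    have : (⌊β⌋₊:ℕ∞) ≠ 0 := by exact_mod_cast (by omega : ⌊β⌋₊ ≠ 0)
    exact_mod_cast this)
  have hg : 0 ≤ min β 2 - 1 := by have := le_min hβ1.le (by norm_num : (1:ℝ) ≤ 2); linarith
  have h := (convex_closedBall x ‖p‖).norm_image_sub_le_of_norm_fderiv_le' (𝕜 := ℝ) (f := u) (φ := fderiv ℝ u x)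
    (C := M * ‖p‖ ^ (min β 2 - 1)) (fun z _ => hd z) (fun z hz => by
      refine (hNorm_fderiv hβ1 hβ3 hM hc hu z x).trans ?_
      have : ‖z - x‖ ≤ ‖p‖ := by simpa [dist_eq_norm] using hz
      gcongr) (x := x) (y := x + p) (by simp) (by simp)
  rw [add_sub_cancel_left] at h
  refine h.trans (le_of_eq ?_)
  rcases eq_or_ne p 0 with rfl | hp
  · have : min β 2 ≠ 0 := by linarith
    simp [Real.zero_rpow this]
  · have hp' : 0 < ‖p‖ := norm_pos_iff.2 hp
    rw [mul_assoc, ← Real.rpow_add_one hp'.ne']; ring_nf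

lemma euc_norm_le_sum (v : Euc d) : ‖v‖ ≤ ∑ k, |v k| := by
  have h : v = ∑ k, (v k) • (EuclideanSpace.single k (1:ℝ)) := by
    ext i; simp [Finset.sum_apply, Pi.single_apply]
  calc ‖v‖ = ‖∑ k, (v k) • (EuclideanSpace.single k (1:ℝ) : Euc d)‖ := by rw [← h]
    _ ≤ ∑ k, ‖(v k) • (EuclideanSpace.single k (1:ℝ) : Euc d)‖ := norm_sum_le _ _
    _ = _ := by simp [norm_smul]

lemma coef_mk {μ K : ℝ} (hμ : μ ∈ Ioo (0:ℝ) 1) (hK : 0 < K) {G : Euc d → Matrix (Fin d) (Fin d) ℝ} {btil : Euc d → Euc d}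
    (h1 : ∀ x, ‖matCLM (G x)‖ ≤ K) (h2 : ∀ x x' : Euc d, ‖matCLM (G x) - matCLM (G x')‖ ≤ K * ‖x - x'‖)
    (hb : ∀ k, hNorm d μ (fun x => btil x k) ≤ ENNReal.ofReal K) :
    Coef μ (2 * K + (2 * K) ^ μ + 2 * K * d) (fun x => matCLM (G x)) btil := by
  have hp1 : 0 ≤ (2 * K) ^ μ := by positivity
  have hp2 : 0 ≤ 2 * K * (d:ℝ) := by positivity
  have hw : ∀ x x' : Euc d, ‖matCLM (G x) - matCLM (G x')‖ ≤ 2 * K * min ‖x - x'‖ 1 := by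
    intro x x'
    rw [mul_min_of_nonneg _ _ (by positivity), mul_one]
    refine le_min ((h2 x x').trans ?_) ((norm_sub_le _ _).trans (by linarith [h1 x, h1 x']))
    nlinarith [mul_nonneg hK.le (norm_nonneg (x - x'))]
  have hmw : ∀ x : Euc d, (min ‖x‖ 1) ^ μ ≤ wf μ x := fun x => by
    have hm0 : 0 ≤ min ‖x‖ 1 := le_min (norm_nonneg _) zero_le_one
    exact le_min (Real.rpow_le_rpow hm0 (min_le_left _ _) hμ.1.le) (Real.rpow_le_one hm0 (min_le_right _ _) hμ.1.le)
  have hmw' : ∀ x : Euc d, min ‖x‖ 1 ≤ wf μ x := fun x => by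
    have hm0 : 0 ≤ min ‖x‖ 1 := le_min (norm_nonneg _) zero_le_one
    refine le_trans ?_ (hmw x)
    rcases eq_or_lt_of_le hm0 with h | h
    · rw [← h]; exact Real.rpow_nonneg le_rfl _
    · calc min ‖x‖ 1 = (min ‖x‖ 1) ^ (1:ℝ) := (Real.rpow_one _).symm
        _ ≤ _ := Real.rpow_le_rpow_of_exponent_ge h (min_le_right _ _) hμ.2.le
  have hbb := fun k => hNorm_zero hμ hK.le (hb k)
  have hsum : ∀ (v : Euc d) (c : ℝ), (∀ k, |v k| ≤ c) → ‖v‖ ≤ d * c := by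
    intro v c hc
    refine (euc_norm_le_sum v).trans ((Finset.sum_le_sum fun k _ => hc k).trans (by simp))
  refine ⟨fun x => (h1 x).trans (by linarith), fun x => ?_, fun x x' => ?_, fun x x' => ?_, fun x x' => ?_⟩
  · refine (hsum _ K fun k => (hbb k).1 x).trans ?_
    nlinarith
  · have h3 := wf_nonneg (μ := μ) (x - x')
    calc _ ≤ 2 * K * wf μ (x - x') := (hw x x').trans (by gcongr; exact hmw' _)
      _ ≤ _ := by gcongr; linarith
  · have h3 := wf_nonneg (μ := μ) (x - x')
    have hm0 : 0 ≤ min ‖x - x'‖ 1 := le_min (norm_nonneg _) zero_le_one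
    calc _ ≤ (2 * K * min ‖x - x'‖ 1) ^ μ := Real.rpow_le_rpow (norm_nonneg _) (hw x x') hμ.1.le
      _ = (2 * K) ^ μ * (min ‖x - x'‖ 1) ^ μ := Real.mul_rpow (by positivity) hm0
      _ ≤ (2 * K) ^ μ * wf μ (x - x') := by gcongr; exact hmw _
      _ ≤ _ := by gcongr; linarith
  · have h3 := wf_nonneg (μ := μ) (x - x')
    calc _ ≤ d * (2 * K * wf μ (x - x')) := by
          refine hsum _ _ fun k => ?_
          rw [wf, mul_min_of_nonneg _ _ (by positivity), mul_one]
          have e1 := (hbb k).2 x x'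
          have e2 := (hbb k).1 x
          have e3 := (hbb k).1 x'
          have e4 : 0 ≤ K * ‖x - x'‖ ^ μ := by positivity
          change |btil x k - btil x' k| ≤ _
          exact le_min (by linarith) ((abs_sub _ _).trans (by linarith))
      _ = 2 * K * d * wf μ (x - x') := by ring
      _ ≤ _ := by gcongr; linarith

end hread

/-! ## Part 14 -/
open scoped BoundedContinuousFunction ContDiff
set_option linter.unusedSectionVars false
set_option linter.unusedVariables false

section cons
variable {d : ℕ}

/-- Taylor remainder -/
def TR (w : Euc d → ℝ) (g : Euc d →L[ℝ] ℝ) (x : Euc d) (A : Euc d →L[ℝ] Euc d) (y : Euc d) : ℝ := w (x + A y) - w x - g (A y)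

/-- limit operator -/
def LL (P : Measure (Euc d)) (A : Euc d →L[ℝ] Euc d) (b : Euc d) (w : Euc d → ℝ) (g : Euc d →L[ℝ] ℝ) (x : Euc d) : ℝ :=
  ∫ y, TR w g x A y ∂P + g b

lemma TR_bd {γ M K : ℝ} (hγ : 0 ≤ γ) (hM : 0 ≤ M) {w : Euc d → ℝ} {g : Euc d →L[ℝ] ℝ} {x : Euc d}
    (hw : ∀ p, |w (x + p) - w x - g p| ≤ M * ‖p‖ ^ γ) {A : Euc d →L[ℝ] Euc d} (hA : ‖A‖ ≤ K) (y : Euc d) :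
    |TR w g x A y| ≤ M * K ^ γ * ‖y‖ ^ γ := by
  have hK : 0 ≤ K := (norm_nonneg _).trans hA
  calc _ ≤ M * ‖A y‖ ^ γ := hw _
    _ ≤ M * (K * ‖y‖) ^ γ := by gcongr; exact A.le_of_opNorm_le hA y
    _ = _ := by rw [Real.mul_rpow hK (norm_nonneg _)]; ring

lemma TR_int {α Cm γ M K : ℝ} (hα : 1 ≤ α) (hγ : α < γ) (hM : 0 ≤ M) {P : Measure (Euc d)} (h : Levy α Cm P) {w : XX d} {g : Euc d →L[ℝ] ℝ} {x : Euc d}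
    (hw : ∀ p, |w (x + p) - w x - g p| ≤ M * ‖p‖ ^ γ) {A : Euc d →L[ℝ] Euc d} (hA : ‖A‖ ≤ K) {σ : ℝ} (hσ : 0 < σ) (hσ1 : σ ≤ 1) :
    IntegrableOn (TR w g x A) (Sx d σ) P ∧ IntegrableOn (TR w g x A) (Sx d σ)ᶜ P := by
  have := h.finM hσ
  have hcont : Continuous (TR w g x A) := by
    unfold TR
    have := w.continuous
    fun_prop
  constructor
  · refine ((h.int_comp hσ w x A).sub (integrable_const _)).sub ?_
    exact (g.comp A).integrable_comp (h.int_id hσ)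
  · refine Integrable.mono' (((h.sml γ hγ σ hσ hσ1).1).const_mul (M * K ^ γ)) hcont.aestronglyMeasurable (Filter.Eventually.of_forall fun y => ?_)
    exact TR_bd (by linarith) hM hw hA y

lemma cons {α Cm γ K : ℝ} (hα : α ∈ Ico (1:ℝ) 2) (hγ : α < γ) (hCm : 0 ≤ Cm) (hK : 0 ≤ K) [NeZero d] :
    ∃ C : ℝ, 0 ≤ C ∧ ∀ (P : Measure (Euc d)), Levy α Cm P → ∀ (A : Euc d →L[ℝ] Euc d) (b : Euc d), ‖A‖ ≤ K → ‖b‖ ≤ K →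
      ∀ σ, 0 < σ → σ ≤ 1 → ∀ (w : XX d) (g : Euc d → (Euc d →L[ℝ] ℝ)) (M : ℝ), 0 ≤ M →
      (∀ x p, |w (x + p) - w x - g x p| ≤ M * ‖p‖ ^ γ) → ∀ x,
      |Nf P α σ A b (J σ w) x - nuMass P α σ * w x - LL P A b w (g x) x| ≤ C * M * σ ^ (γ - α) := by
  have hγα : 0 < γ - α := by linarith
  have hγ0 : 0 ≤ γ := by linarith [hα.1]
  refine ⟨(Cm + 1) + K ^ γ * (Cm / (γ - α)) + ((1 + Cm) * K) ^ γ, by positivity, ?_⟩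
  intro P h A b hA hb σ hσ hσ1 w g M hM hw x
  have hfin := h.finM hσ
  obtain ⟨hi1, hi2⟩ := TR_int hα.1 hγ hM h (hw x) hA hσ hσ1
  -- J part
  have hJ : ∀ z, |J σ w z - w z| ≤ M * σ ^ γ := by
    intro z
    have e1 : J σ w z - w z = ∫ y, (w (z + σ • y) - w z - g z (σ • y)) ∂(etaM d) := by
      have e2 : ∀ y : Euc d, g z (σ • y) = (σ • g z) y := fun y => by simp
      simp only [e2]
      have e3 : Integrable (fun y => w (z + σ • y) - w z) (etaM d) := (J_int σ w z).sub (integrable_const _)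
      rw [integral_sub e3 (etaM_integrable_clm _), integral_sub (J_int σ w z) (integrable_const _), etaM_integral_clm, J_apply]
      simp
    rw [e1]
    have := norm_integral_le_of_norm_le_const (μ := etaM d) (f := fun y => w (z + σ • y) - w z - g z (σ • y)) (C := M * σ ^ γ) (by
      filter_upwards [etaM_ae] with y hy
      refine (hw z (σ • y)).trans ?_
      rw [norm_smul, Real.norm_of_nonneg hσ.le]
      have : σ * ‖y‖ ≤ σ := by nlinarith [hy.2]
      gcongr)
    simpa using this
  have hmass : nuMass P α σ ≤ (Cm + 1) * σ ^ (-α) := by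
    have := h.mass σ hσ hσ1
    unfold nuMass; linarith
  have hsp : 0 < σ ^ (-α) := by positivity
  have hN1 : |Nf P α σ A b (J σ w) x - Nf P α σ A b w x| ≤ nuMass P α σ * (M * σ ^ γ) := by
    have e : Nf P α σ A b (J σ w) x - Nf P α σ A b w x = ∫ y in Sx d σ, (J σ w (x + A y) - w (x + A y)) ∂P
        + σ ^ (-α) * (J σ w (x + σ ^ α • Bf P σ A b) - w (x + σ ^ α • Bf P σ A b)) := by
      unfold Nf
      rw [integral_sub (h.int_comp hσ _ x A) (h.int_comp hσ _ x A)]; ring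
    rw [e, nuMass, add_mul]
    refine (abs_add_le _ _).trans (add_le_add ?_ ?_)
    · have := norm_integral_le_of_norm_le_const (μ := P.restrict (Sx d σ)) (f := fun y => J σ w (x + A y) - w (x + A y)) (C := M * σ ^ γ) (Filter.Eventually.of_forall fun y => hJ _)
      rw [measureReal_restrict_apply_univ] at this
      rw [mul_comm]; exact this
    · rw [abs_mul, abs_of_pos hsp]; gcongr; exact hJ _
  have hs1 : σ ^ (-α) * σ ^ γ = σ ^ (γ - α) := by rw [← Real.rpow_add hσ]; ring_nf
  have hN1' : |Nf P α σ A b (J σ w) x - Nf P α σ A b w x| ≤ (Cm + 1) * M * σ ^ (γ - α) := by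
    refine hN1.trans ?_
    calc _ ≤ (Cm + 1) * σ ^ (-α) * (M * σ ^ γ) := by gcongr
      _ = (Cm + 1) * M * (σ ^ (-α) * σ ^ γ) := by ring
      _ = _ := by rw [hs1]
  -- main part
  have hσα : σ ^ (-α) * σ ^ α = 1 := by rw [← Real.rpow_add hσ]; simp
  have hN2 : Nf P α σ A b w x - nuMass P α σ * w x - LL P A b w (g x) x =
      σ ^ (-α) * (w (x + σ ^ α • Bf P σ A b) - w x - g x (σ ^ α • Bf P σ A b)) - ∫ y in (Sx d σ)ᶜ, TR w (g x) x A y ∂P := by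
    have e1 : ∫ y in Sx d σ, TR w (g x) x A y ∂P = ∫ y in Sx d σ, w (x + A y) ∂P - P.real (Sx d σ) * w x - g x (A (cc P σ)) := by
      unfold TR
      have e2 : ∫ y in Sx d σ, g x (A y) ∂P = g x (A (cc P σ)) := (g x |>.comp A).integral_comp_comm (h.int_id hσ)
      have e5 : IntegrableOn (fun y => w (x + A y) - w x) (Sx d σ) P := (h.int_comp hσ w x A).sub (integrable_const _)
      have e6 : IntegrableOn (fun y => g x (A y)) (Sx d σ) P := (g x |>.comp A).integrable_comp (h.int_id hσ)
      rw [integral_sub e5 e6, integral_sub (h.int_comp hσ w x A) (integrable_const _), e2]; simp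
    have e3 : ∫ y, TR w (g x) x A y ∂P = ∫ y in Sx d σ, TR w (g x) x A y ∂P + ∫ y in (Sx d σ)ᶜ, TR w (g x) x A y ∂P :=
      (integral_add_compl (Sx_meas σ) (by
        have := hi1.union hi2
        rwa [union_compl_self, integrableOn_univ] at this)).symm
    have e4 : g x (Bf P σ A b) = g x b - g x (A (cc P σ)) := by rw [Bf, map_sub]
    rw [LL, e3, e1, Nf, nuMass, map_smul, smul_eq_mul, e4]
    linear_combination (g x b - g x (A (cc P σ))) * hσα
  have hB := h.Bf_le hα.1 hσ hσ1 hA hb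
  have hN3 : |σ ^ (-α) * (w (x + σ ^ α • Bf P σ A b) - w x - g x (σ ^ α • Bf P σ A b))| ≤ ((1 + Cm) * K) ^ γ * M * σ ^ (γ - α) := by
    rw [abs_mul, abs_of_pos hsp]
    have hn : ‖σ ^ α • Bf P σ A b‖ ≤ (1 + Cm) * K * σ := by
      rw [norm_smul, Real.norm_of_nonneg (by positivity)]
      calc _ ≤ σ ^ α * ((1 + Cm) * K * σ ^ (1 - α)) := by gcongr
        _ = (1 + Cm) * K * (σ ^ α * σ ^ (1 - α)) := by ring
        _ = _ := by rw [← Real.rpow_add hσ]; simp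
    calc _ ≤ σ ^ (-α) * (M * ((1 + Cm) * K * σ) ^ γ) := by
          gcongr
          refine (hw x _).trans ?_
          gcongr
      _ = ((1 + Cm) * K) ^ γ * M * (σ ^ (-α) * σ ^ γ) := by rw [Real.mul_rpow (by positivity) hσ.le]; ring
      _ = _ := by rw [hs1]
  have hN4 : |∫ y in (Sx d σ)ᶜ, TR w (g x) x A y ∂P| ≤ M * K ^ γ * (Cm / (γ - α) * σ ^ (γ - α)) :=
    norm_int_le (Sx_meas σ).compl (by positivity) (fun y _ => TR_bd hγ0 hM (hw x) hA y) (h.sml γ hγ σ hσ hσ1).1 (h.sml γ hγ σ hσ hσ1).2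
  have e : Nf P α σ A b (J σ w) x - nuMass P α σ * w x - LL P A b w (g x) x =
    (Nf P α σ A b (J σ w) x - Nf P α σ A b w x) + (Nf P α σ A b w x - nuMass P α σ * w x - LL P A b w (g x) x) := by ring
  rw [e, hN2]
  refine (abs_add_le _ _).trans ?_
  refine (add_le_add hN1' ((abs_sub _ _).trans (add_le_add hN3 hN4))).trans (le_of_eq ?_)
  ring

/-- Relation with `Lop`. -/
lemma Lop_eq {α : ℝ} {ρ : Euc d → ℝ} [NeZero d] (hρm : Measurable ρ) (hρ : ∀ y : Euc d, y ≠ 0 → 0 ≤ ρ y) {G : Euc d → Matrix (Fin d) (Fin d) ℝ}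
    {v : Euc d → ℝ} {x : Euc d} (hv : DifferentiableAt ℝ v x) :
    Lop d α ρ G v x = ∫ y, TR v (fderiv ℝ v x) x (matCLM (G x)) y ∂(Pm d α ρ) ∧
    (Integrable (TR v (fderiv ℝ v x) x (matCLM (G x))) (Pm d α ρ) → IntegrableOn
      (fun y => (v (x + matCLM (G x) y) - v x -
          ⟪gradient v x, matCLM (G x) y⟫) * ρ y * ‖y‖ ^ (-((d : ℝ) + α)))
      {y : Euc d | ‖y‖ ≤ 1}) := by
  have hfr : Module.finrank ℝ (Euc d) = d := by simp
  have : Nontrivial (Euc d) := Module.nontrivial_of_finrank_pos (R := ℝ) (by rw [hfr]; exact Nat.pos_of_ne_zero (NeZero.ne d))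
  have hne : ∀ᵐ y : Euc d, y ≠ 0 := by
    rw [ae_iff]; simp
  have hdm : Measurable (fun y => ENNReal.ofReal (ρ y * ‖y‖ ^ (-((d:ℝ) + α)))) := (hρm.mul (Qm_meas α)).ennreal_ofReal
  have hgr : ∀ p, ⟪gradient v x, p⟫ = fderiv ℝ v x p := fun p => by
    rw [gradient, InnerProductSpace.toDual_symm_apply]
  have hae : (fun y => (ENNReal.ofReal (ρ y * ‖y‖ ^ (-((d:ℝ) + α)))).toReal • TR v (fderiv ℝ v x) x (matCLM (G x)) y) =ᵐ[volume.restrict {y : Euc d | ‖y‖ ≤ 1}]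
      (fun y => (v (x + matCLM (G x) y) - v x - ⟪gradient v x, matCLM (G x) y⟫) * ρ y * ‖y‖ ^ (-((d : ℝ) + α))) := by
    refine ae_restrict_of_ae (hne.mono fun y hy => ?_)
    simp only [hgr]
    rw [ENNReal.toReal_ofReal (mul_nonneg (hρ y hy) (by positivity)), TR, smul_eq_mul]
    ring
  constructor
  · rw [Pm, integral_withDensity_eq_integral_toReal_smul hdm (by simp), Lop]
    exact (integral_congr_ae hae).symm
  · intro hi
    rw [Pm, integrable_withDensity_iff_integrable_smul' hdm (by simp)] at hi
    exact hi.congr hae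

end cons

/-! ## Part 15 -/
open scoped BoundedContinuousFunction ContDiff
set_option linter.unusedSectionVars false
set_option linter.unusedVariables false

section limtools
variable {d : ℕ}

lemma TT_tr (s : ℝ) (h : Euc d) [NeZero d] : Commute (TT s : Op d) (tr h) := by
  unfold TT
  exact (((J_tr s h).smul_left _).sub_left ((J_tr _ h).smul_left _)).add_left (J_tr _ h)

lemma TT_D3 (s : ℝ) (h : Euc d) [NeZero d] : Commute (TT s : Op d) (D3 h) := by
  unfold D3
  exact ((TT_tr s h).sub_right (Commute.one_right _)).pow_right 3

lemma SmN.D3_le {a r : ℝ} {u : XX d} (hr : 0 < r) (hu : SmN 3 a r u) (h : Euc d) : ‖D3 h u‖ ≤ a * (‖h‖ / r) ^ 3 := by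
  refine XX.norm_le_of fun x => ?_
  have h1 := ((hu.diff hr h).diff hr h).diff hr h
  have h2 := h1.abs_le x
  refine le_of_eq_of_le ?_ (h2.trans (le_of_eq ?_))
  · rw [D3_apply]
    congr 1
    have e1 : x + h + h = x + (2:ℝ) • h := by rw [two_smul]; abel
    have e2 : x + h + h + h = x + (3:ℝ) • h := by
      rw [show (3:ℝ) = 1 + 1 + 1 by norm_num, add_smul, add_smul, one_smul]; abel
    rw [e2, e1]
    ring
  · field_simp

lemma sum_rj_neg {s : ℝ} (hs : 0 < s) : ∃ C : ℝ, 1 ≤ C ∧ ∀ k, ∑ j ∈ Finset.range (k+1), rj j ^ (-s) ≤ C * rj k ^ (-s) := by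
  set q := (2⁻¹:ℝ) ^ s with hq
  have hq0 : 0 < q := by positivity
  have hq1 : q < 1 := Real.rpow_lt_one (by norm_num) (by norm_num) hs
  refine ⟨1 / (1 - q), by rw [le_div_iff₀ (by linarith)]; linarith, fun k => ?_⟩
  have hrk := rj_pos k
  have e : ∀ j ∈ Finset.range (k+1), rj j ^ (-s) = rj k ^ (-s) * q ^ (k + 1 - 1 - j) := fun j hj => by
    have hj : j ≤ k := by have := Finset.mem_range.1 hj; omega
    rw [Nat.add_sub_cancel, ← rj_rpow]
    have : rj k = rj j * rj (k - j) := by rw [← rj_add]; congr 1; omega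
    rw [this, Real.mul_rpow (rj_pos _).le (rj_pos _).le, mul_assoc, ← Real.rpow_add (rj_pos _)]
    simp
  rw [Finset.sum_congr rfl e, ← Finset.mul_sum, Finset.sum_range_reflect (fun i => q ^ i), mul_comm]
  gcongr
  rw [← tsum_geometric_of_lt_one hq0.le hq1 |>.trans (one_div _).symm]
  exact (summable_geometric_of_lt_one hq0.le hq1).sum_le_tsum _ (fun i _ => by positivity)

lemma zyg_moll (d : ℕ) [NeZero d] {β : ℝ} (hβ : β ∈ Ioo (0:ℝ) 3) : ∃ C : ℝ, 1 ≤ C ∧ ∀ ϱ M k, ∀ w : XX d, 0 < ϱ → Zyg β ϱ M w →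
    2 * ϱ ≤ rj k → Zyg β 0 (C * M) (TT (rj k) (TT (rj k) w)) := by
  obtain ⟨C, hC, hb⟩ := exists_blocks d
  obtain ⟨S, hS, hs⟩ := sum_rj_neg (s := 3 - β) (by linarith [hβ.2])
  refine ⟨49 + C * S, by nlinarith, fun ϱ M k w hϱ hw hk => ?_⟩
  have hM := hw.nonneg
  have hCS : 0 ≤ C * S := by positivity
  constructor
  · have h1 := TT_norm_le (rj k) w
    have h2 := TT_norm_le (rj k) (TT (rj k) w)
    have := hw.1
    have : 0 ≤ C * S * M := by positivity
    linarith
  · intro h _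
    have hrk := rj_pos k
    by_cases hh : ϱ ≤ ‖h‖
    · have e : D3 h (TT (rj k) (TT (rj k) w)) = TT (rj k) (TT (rj k) (D3 h w)) := by
        have h1 := fun u => DFunLike.congr_fun (TT_D3 (rj k) h).eq u
        have h2 : ∀ u, TT (rj k) (D3 h u) = D3 h (TT (rj k) u) := h1
        rw [h2, h2]
      rw [e]
      have h1 := TT_norm_le (rj k) (D3 h w)
      have h2 := TT_norm_le (rj k) (TT (rj k) (D3 h w))
      have h3 := hw.2 h hh
      have : 0 ≤ C * S * (M * ‖h‖ ^ β) := by positivity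
      linarith
    · push Not at hh
      rcases (norm_nonneg h).eq_or_lt with h0 | h0
      · have : h = 0 := norm_eq_zero.1 h0.symm
        subst this
        have e : D3 (0 : Euc d) (TT (rj k) (TT (rj k) w)) = 0 := by
          ext x
          rw [D3_apply]; simp
        rw [e, norm_zero]; positivity
      have e : TT (rj k) (TT (rj k) w) = ∑ j ∈ Finset.range (k+1), Qb j w := by
        have := DFunLike.congr_fun (sum_Qb (d := d) k) w
        rw [_root_.sum_apply] at this
        exact this.symm
      rw [e, map_sum]
      refine (norm_sum_le _ _).trans ?_
      have hj : ∀ j ∈ Finset.range (k+1), ‖D3 h (Qb j w)‖ ≤ C * M * ‖h‖ ^ (3:ℝ) * rj j ^ (-(3 - β)) := fun j hj => by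
        have hj' : 2 * ϱ ≤ rj j := hk.trans (rj_anti (by have := Finset.mem_range.1 hj; omega))
        have h1 := ((hb β ϱ M hβ w hw j hj').1).D3_le (rj_pos j) h
        have hr := rj_pos j
        refine h1.trans ?_
        calc _ ≤ C * (M * rj j ^ β) * (‖h‖ / rj j) ^ 3 := by gcongr; exact min_le_right _ _
          _ = _ := by
            rw [show -(3 - β) = β - 3 by ring, Real.rpow_sub hr, show (3:ℝ) = ((3:ℕ):ℝ) by norm_num, Real.rpow_natCast, Real.rpow_natCast]
            field_simp
      refine (Finset.sum_le_sum hj).trans ?_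
      rw [← Finset.mul_sum]
      have h5 : rj k ^ (-(3 - β)) ≤ ‖h‖ ^ (-(3 - β)) := Real.rpow_le_rpow_of_nonpos h0 (by linarith) (by linarith [hβ.2])
      calc _ ≤ C * M * ‖h‖ ^ (3:ℝ) * (S * rj k ^ (-(3 - β))) := by gcongr; exact hs k
        _ ≤ C * M * ‖h‖ ^ (3:ℝ) * (S * ‖h‖ ^ (-(3 - β))) := by gcongr
        _ = C * S * M * (‖h‖ ^ (3:ℝ) * ‖h‖ ^ (-(3 - β))) := by ring
        _ = C * S * M * ‖h‖ ^ β := by rw [← Real.rpow_add h0]; congr 2; ring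
        _ ≤ _ := by
          have : 0 ≤ 49 * (M * ‖h‖ ^ β) := by positivity
          linarith

lemma exists_LVt (d : ℕ) [NeZero d] {μ α Λ : ℝ} (hμ : μ ∈ Ioo (0:ℝ) 1) (hα : α ∈ Ico (1:ℝ) 2) (hΛ : 0 ≤ Λ) (θ : ℝ) (hθ : 0 < θ) :
    ∃ C : ℝ, 0 ≤ C ∧ ∀ κ r0 ϱ m (𝓛 : Euc d → Op d) (L : Op d), Fam μ α Λ κ r0 ϱ m 𝓛 L →
    ∀ (M : ℝ) (w : XX d), Zyg (α + μ) ϱ M w → ‖L w‖ ≤ C * ‖w‖ + θ * M := by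
  obtain ⟨C, hC, hop⟩ := exists_opbound d
  have hp : 0 < C * (2 * Λ) + 1 := by positivity
  obtain ⟨Cs, hCs, hs⟩ := split_sum (α := α) hμ.1 (θ / (C * (2 * Λ) + 1)) (by positivity)
  refine ⟨C * (2 * Λ) * Cs, by positivity, fun κ r0 ϱ m 𝓛 L h M w hw => ?_⟩
  have hM := hw.nonneg
  have hβ : α + μ ∈ Ioo (0:ℝ) 3 := ⟨by linarith [hα.1, hμ.1], by linarith [hα.2, hμ.2]⟩
  have hα2 : α ∈ Icc (0:ℝ) 2 := ⟨by linarith [hα.1], hα.2.le⟩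
  have hϱ := h.pos
  have hϱα : 0 < ϱ ^ (-α) := by positivity
  have hsup : ∀ x, ∀ u : XX d, ‖𝓛 x u‖ ≤ 2 * Λ * ϱ ^ (-α) * ‖u‖ := fun x u => by
    refine ((h.gen x).norm_apply_le u).trans ?_
    have := h.mle
    have := norm_nonneg u
    nlinarith
  refine XX.norm_le_of fun x => ?_
  rw [h.Leq]
  refine (XX.abs_le _ _).trans ?_
  obtain ⟨n, hn⟩ := hop α (α + μ) ϱ hα2 hβ h.pos h.small
  have h1 := hn (𝓛 x) (2 * Λ) (by positivity) (fun r hr hr1 u a hu => by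
    refine ((h.frz x).blk r hr hr1 u a hu).trans ?_
    have ha : 0 ≤ a := (abs_nonneg _).trans (hu.abs_le 0)
    have hr0 : 0 < r := hϱ.trans_le hr
    have : 0 ≤ r ^ (-α) := by positivity
    gcongr
    linarith) (hsup x) M w hw
  have h2 := hs ‖w‖ M (norm_nonneg _) hM n
  have h3 : C * (2 * Λ) * (θ / (C * (2 * Λ) + 1)) ≤ θ := by
    rw [← mul_div_assoc, div_le_iff₀ hp]; nlinarith
  calc _ ≤ _ := h1
    _ ≤ C * (2 * Λ) * (Cs * ‖w‖ + (θ / (C * (2 * Λ) + 1)) * M) := by gcongr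
    _ = C * (2 * Λ) * Cs * ‖w‖ + (C * (2 * Λ) * (θ / (C * (2 * Λ) + 1))) * M := by ring
    _ ≤ _ := by gcongr

lemma Zyg.sub {β ϱ M M' : ℝ} {u w : XX d} (hu : Zyg β ϱ M u) (hw : Zyg β ϱ M' w) : Zyg β ϱ (M + M') (u - w) := by
  refine ⟨(norm_sub_le _ _).trans (add_le_add hu.1 hw.1), fun h hh => ?_⟩
  rw [map_sub, add_mul]
  exact (norm_sub_le _ _).trans (add_le_add (hu.2 h hh) (hw.2 h hh))

lemma Zyg.mono_rho {β ϱ ϱ' M : ℝ} {w : XX d} (h : Zyg β ϱ M w) (hr : ϱ ≤ ϱ') : Zyg β ϱ' M w :=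
  ⟨h.1, fun k hk => h.2 k (hr.trans hk)⟩

lemma Zyg.lim {β M : ℝ} (hβ : 0 < β) {r : ℕ → ℝ} {w : ℕ → XX d} {v : XX d} (hr : Filter.Tendsto r Filter.atTop (nhds 0))
    (h : ∀ n, Zyg β (r n) M (w n)) (hw : Filter.Tendsto w Filter.atTop (nhds v)) : Zyg β 0 M v := by
  refine ⟨le_of_tendsto hw.norm (Filter.Eventually.of_forall fun n => (h n).1), fun k _ => ?_⟩
  rcases (norm_nonneg k).eq_or_lt with h0 | h0
  · have : k = 0 := norm_eq_zero.1 h0.symm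
    subst this
    have e : D3 (0 : Euc d) v = 0 := by
      ext x
      rw [D3_apply]; simp
    have := (h 0).nonneg
    rw [e, norm_zero]; positivity
  · refine le_of_tendsto (((D3 k).continuous.tendsto v).comp hw).norm ?_
    filter_upwards [hr.eventually (gt_mem_nhds h0)] with n hn
    exact (h n).2 k hn.le

lemma deriv_limit {φ : ℕ → ℝ → ℝ} {φ' : ℕ → ℝ → ℝ} {ψ ψ' : ℝ → ℝ} {T : ℝ}
    (h : ∀ n, ∀ s ∈ Icc 0 T, HasDerivWithinAt (φ n) (φ' n s) (Icc 0 T) s)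
    (hφ : ∀ s ∈ Icc 0 T, Filter.Tendsto (fun n => φ n s) Filter.atTop (nhds (ψ s)))
    (hd : ∀ ε : ℝ, 0 < ε → ∀ᶠ n in Filter.atTop, ∀ s ∈ Icc 0 T, |φ' n s - ψ' s| ≤ ε) :
    ∀ s ∈ Icc 0 T, HasDerivWithinAt ψ (ψ' s) (Icc 0 T) s := by
  intro s hs
  have key : ∀ ε : ℝ, 0 < ε → ∀ n, (∀ s ∈ Icc 0 T, |φ' n s - ψ' s| ≤ ε) → ∀ t ∈ Icc 0 T,
      |(ψ t - φ n t) - (ψ s - φ n s)| ≤ (ε + ε) * |t - s| := by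
    intro ε hε n hn t ht
    have h2 : Filter.Tendsto (fun m => |(φ m t - φ n t) - (φ m s - φ n s)|) Filter.atTop (nhds |(ψ t - φ n t) - (ψ s - φ n s)|) :=
      (((hφ t ht).sub_const _).sub ((hφ s hs).sub_const _)).abs
    refine le_of_tendsto h2 ?_
    filter_upwards [hd ε hε] with m hm
    have := Convex.norm_image_sub_le_of_norm_hasDerivWithin_le (𝕜 := ℝ) (f := fun u => φ m u - φ n u)
      (f' := fun u => φ' m u - φ' n u) (C := ε + ε) (s := Icc 0 T) (fun u hu => (h m u hu).sub (h n u hu))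
      (fun u hu => by
        have a1 := hm u hu
        have a2 := hn u hu
        rw [Real.norm_eq_abs, show φ' m u - φ' n u = (φ' m u - ψ' u) - (φ' n u - ψ' u) by ring]
        exact (abs_sub _ _).trans (add_le_add a1 a2)) (convex_Icc _ _) hs ht
    simpa [Real.norm_eq_abs] using this
  rw [hasDerivWithinAt_iff_isLittleO, Asymptotics.isLittleO_iff]
  intro c hc
  have hc4 : (0:ℝ) < c / 4 := by linarith
  obtain ⟨n, hn⟩ := (hd (c/4) hc4).exists
  have h4 := (hasDerivWithinAt_iff_isLittleO.1 (h n s hs))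
  rw [Asymptotics.isLittleO_iff] at h4
  filter_upwards [h4 hc4, self_mem_nhdsWithin] with t ht hts
  have k1 := key _ hc4 n hn t hts
  have k2 := hn s hs
  simp only [Real.norm_eq_abs, smul_eq_mul] at ht ⊢
  have e1 : ψ t - ψ s - (t - s) * ψ' s = ((ψ t - φ n t) - (ψ s - φ n s)) + (φ n t - φ n s - (t - s) * φ' n s) + (t - s) * (φ' n s - ψ' s) := by ring
  rw [e1]
  refine (abs_add_three _ _ _).trans ?_
  rw [abs_mul (t - s)]
  have := abs_nonneg (t - s)
  have k3 : |t - s| * |φ' n s - ψ' s| ≤ |t - s| * (c/4) := by gcongr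
  nlinarith

end limtools

/-! ## Part 16 -/
open scoped BoundedContinuousFunction ContDiff
set_option linter.unusedSectionVars false
set_option linter.unusedVariables false

section limitthm
variable {d : ℕ}

/-- The Cauchy estimate for two approximations. -/
lemma cauchy_step (d : ℕ) [NeZero d] {μ α Λ Cc δ M : ℝ} (hμ : μ ∈ Ioo (0:ℝ) 1) (hα : α ∈ Ico (1:ℝ) 2) (hΛ : 0 ≤ Λ)
    (hCc : 0 ≤ Cc) (hδ : 0 < δ) (hM : 0 ≤ M) : ∃ E : ℝ, 0 ≤ E ∧ ∀ κ r0 (m : ℕ → ℝ) (𝓛 : ℕ → Euc d → Op d) (L : ℕ → Op d)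
      (𝔏 : XX d → Euc d → ℝ), (∀ n, Fam μ α Λ κ r0 (rj n / 4) (m n) (𝓛 n) (L n)) →
      (∀ M w, Zyg (α + μ) 0 M w → ∀ n x, |L n w x - 𝔏 w x| ≤ Cc * M * rj n ^ δ) →
      ∀ i j, i ≤ j → ∀ w, Zyg (α + μ) (rj j / 4) M w → ∀ x, |L i w x - L j w x| ≤ E * (rj i ^ δ + rj i ^ μ) := by
  have hβ : α + μ ∈ Ioo (0:ℝ) 3 := ⟨by linarith [hα.1, hμ.1], by linarith [hα.2, hμ.2]⟩
  have hα2 : α ∈ Icc (0:ℝ) 2 := ⟨by linarith [hα.1], hα.2.le⟩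
  obtain ⟨Cz, hCz, hz⟩ := zyg_moll d hβ
  obtain ⟨Cb, hCb, hb⟩ := exists_blocks d
  refine ⟨2 * (Cc * (Cz * M)) + 64 * Λ * Cb * M, by positivity, fun κ r0 m 𝓛 L 𝔏 hF hcons i j hij w hw x => ?_⟩
  have hri := rj_pos i
  have hrj := rj_pos j
  have hrij := rj_anti hij
  set v := TT (rj j) (TT (rj j) w) with hv
  have hvZ : Zyg (α + μ) 0 (Cz * M) v := hz _ M j w (by linarith) hw (by linarith)
  have hwv : ‖w - v‖ ≤ Cb * (M * rj j ^ (α + μ)) :=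
    ((hb (α+μ) _ M hβ w hw j (by linarith)).2.1).trans (by gcongr; exact min_le_right _ _)
  have hop : ∀ n, n ≤ j → ‖L n (w - v)‖ ≤ 32 * Λ * Cb * M * rj n ^ μ := fun n hn => by
    have hrn := rj_pos n
    have hrnj := rj_anti hn
    have h1 := (hF n).Lgen.norm_apply_le (w - v)
    have h2 := (hF n).mle
    have h3 := rho_pow_le hα2 (hF n).pos hrn (by linarith)
    have h4 : m n ≤ Λ * (16 * rj n ^ (-α)) := h2.trans (by gcongr)
    have h5 : rj j ^ (α + μ) ≤ rj n ^ (α + μ) := Real.rpow_le_rpow hrj.le hrnj hβ.1.le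
    calc _ ≤ _ := h1
      _ ≤ 2 * (Λ * (16 * rj n ^ (-α))) * (Cb * (M * rj n ^ (α + μ))) := by
          gcongr
          exact hwv.trans (by gcongr)
      _ = 32 * Λ * Cb * M * (rj n ^ (-α) * rj n ^ (α + μ)) := by ring
      _ = _ := by rw [← Real.rpow_add hrn]; congr 2; ring
  have e : L i w x - L j w x = (L i v x - 𝔏 v x) - (L j v x - 𝔏 v x) + L i (w - v) x - L j (w - v) x := by
    rw [map_sub, map_sub]
    change _ = (L i v x - 𝔏 v x) - (L j v x - 𝔏 v x) + (L i w x - L i v x) - (L j w x - L j v x)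
    ring
  have a1 := hcons _ v hvZ i x
  have a2 := hcons _ v hvZ j x
  have a3 := (XX.abs_le (L i (w - v)) x).trans (hop i hij)
  have a4 := (XX.abs_le (L j (w - v)) x).trans (hop j le_rfl)
  have a5 : rj j ^ δ ≤ rj i ^ δ := Real.rpow_le_rpow hrj.le hrij hδ.le
  have a6 : rj j ^ μ ≤ rj i ^ μ := Real.rpow_le_rpow hrj.le hrij hμ.1.le
  have a7 : Cc * (Cz * M) * rj j ^ δ ≤ Cc * (Cz * M) * rj i ^ δ := by gcongr
  have a8 : 32 * Λ * Cb * M * rj j ^ μ ≤ 32 * Λ * Cb * M * rj i ^ μ := by gcongr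
  rw [e]
  have t1 := abs_sub ((L i v x - 𝔏 v x) - (L j v x - 𝔏 v x) + L i (w - v) x) (L j (w - v) x)
  have t2 := abs_add_le ((L i v x - 𝔏 v x) - (L j v x - 𝔏 v x)) (L i (w - v) x)
  have t3 := abs_sub (L i v x - 𝔏 v x) (L j v x - 𝔏 v x)
  have p1 : 0 ≤ Cc * (Cz * M) * rj i ^ μ := by positivity
  have p2 : 0 ≤ 64 * Λ * Cb * M * rj i ^ δ := by positivity
  linarith

lemma limit_thm (d : ℕ) [NeZero d] {μ α Λ κ r0 : ℝ} (hμ : μ ∈ Ioo (0:ℝ) 1) (hα : α ∈ Ico (1:ℝ) 2) (hΛ : 0 ≤ Λ)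
    (hκ : 0 < κ) (hr0 : 0 < r0) (hr01 : r0 ≤ 1) : ∃ C : ℝ, 1 ≤ C ∧
    ∀ (Cc δ : ℝ) (m : ℕ → ℝ) (𝓛 : ℕ → Euc d → Op d) (L : ℕ → Op d) (𝔏 : XX d → Euc d → ℝ), 0 ≤ Cc → 0 < δ →
      (∀ n, Fam μ α Λ κ r0 (rj n / 4) (m n) (𝓛 n) (L n)) →
      (∀ M w, Zyg (α + μ) 0 M w → ∀ n x, |L n w x - 𝔏 w x| ≤ Cc * M * rj n ^ δ) →
      ∀ A (f : XX d), HolX μ A f → ∃ V : ℝ → XX d, V 0 = 0 ∧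
        (∀ s ∈ Icc (0:ℝ) 1, Zyg (α + μ) 0 (C * A) (V s)) ∧
        (∀ s ∈ Icc (0:ℝ) 1, ∀ s' ∈ Icc (0:ℝ) 1, Zyg (α / 2 + μ) 0 (C * A * |s - s'| ^ (1/2:ℝ)) (V s - V s')) ∧
        (∀ x, ∀ s ∈ Icc (0:ℝ) 1, HasDerivWithinAt (fun s => V s x) (𝔏 (V s) x + f x) (Icc 0 1) s) ∧
        ∀ (T E B : ℝ) (W : ℝ → XX d), T ≤ 1 → W 0 = 0 → (∀ s ∈ Icc (0:ℝ) T, ‖W s‖ ≤ B) →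
          (∀ s ∈ Icc (0:ℝ) T, ∀ n x, |L n (W s) x - 𝔏 (W s) x| ≤ E * rj n ^ δ) →
          (∀ x, ∀ s ∈ Icc (0:ℝ) T, HasDerivWithinAt (fun s => W s x) (𝔏 (W s) x + f x) (Icc 0 T) s) →
          ∀ s ∈ Icc (0:ℝ) T, W s = V s := by
  obtain ⟨C, hC, hap⟩ := exists_apriori_full d hμ hα hΛ hκ hr0 hr01
  refine ⟨C, hC, fun Cc δ m 𝓛 L 𝔏 hCc hδ hF hcons A f hf => ?_⟩
  have hA : 0 ≤ A := (norm_nonneg _).trans hf.1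
  set M := C * A with hM
  have hM0 : 0 ≤ M := by positivity
  obtain ⟨E, hE, hcs⟩ := cauchy_step d hμ hα hΛ hCc hδ hM0
  set Vn : ℕ → ℝ → XX d := fun n => solV (L n) f with hVn
  have hZ : ∀ n, ∀ s ∈ Icc (0:ℝ) 1, Zyg (α + μ) (rj n / 4) M (Vn n s) := fun n =>
    (hap _ _ _ _ (hF n) A f hf).1
  set ε : ℕ → ℝ := fun n => E * (rj n ^ δ + rj n ^ μ) with hε
  have hε0 : ∀ n, 0 ≤ ε n := fun n => by have := rj_pos n; simp only [hε]; positivity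
  have hεt : Filter.Tendsto ε Filter.atTop (nhds 0) := by
    have := ((rj_tendsto δ hδ).add (rj_tendsto μ hμ.1)).const_mul E
    simpa using this
  have hder : ∀ n s x T, HasDerivWithinAt (fun s => Vn n s x) (L n (Vn n s) x + f x) (Icc 0 T) s := fun n s x T =>
    (apply_deriv (solV_deriv (L n) f s) x).hasDerivWithinAt
  have hcau : ∀ i j, i ≤ j → ∀ s ∈ Icc (0:ℝ) 1, ‖Vn i s - Vn j s‖ ≤ ε i := by
    intro i j hij s hs
    have := (hF i).Lgen.maxPrin (T := 1) (Λ := 2 * ‖f‖) (ε := ε i) (w := fun s => Vn i s - Vn j s) (by positivity)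
      (by simp [hVn, solV_zero]) (fun s hs s' hs' => by
        have h1 := (hF i).Lgen.solV_lip f hs.1 hs'.1
        have h2 := (hF j).Lgen.solV_lip f hs.1 hs'.1
        have e : (Vn i s - Vn j s) - (Vn i s' - Vn j s') = (Vn i s - Vn i s') - (Vn j s - Vn j s') := by abel
        rw [e]
        refine (norm_sub_le _ _).trans ?_
        linarith)
      (fun s hs x => ⟨_, (hder i s x 1).sub (hder j s x 1), by
        have e : L i (Vn i s) x + f x - (L j (Vn j s) x + f x) - L i (Vn i s - Vn j s) x = L i (Vn j s) x - L j (Vn j s) x := by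
          rw [map_sub]
          change L i (Vn i s) x + f x - (L j (Vn j s) x + f x) - (L i (Vn i s) x - L i (Vn j s) x) = _
          ring
        rw [e]
        exact hcs κ r0 m 𝓛 L 𝔏 hF hcons i j hij _ (hZ j s hs) x⟩) hs
    refine this.trans ?_
    have := hε0 i
    nlinarith [hs.2]
  have hlim : ∀ s, ∃ v : XX d, s ∈ Icc (0:ℝ) 1 → Filter.Tendsto (fun n => Vn n s) Filter.atTop (nhds v) := by
    intro s
    by_cases hs : s ∈ Icc (0:ℝ) 1
    · obtain ⟨v, hv⟩ := cauchySeq_tendsto_of_complete (cauchySeq_of_le_tendsto_0' (s := fun n => Vn n s) ε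
        (fun i j hij => by rw [dist_eq_norm]; exact hcau i j hij s hs) hεt)
      exact ⟨v, fun _ => hv⟩
    · exact ⟨0, fun h => absurd h hs⟩
  choose V hV using hlim
  have hVε : ∀ n, ∀ s ∈ Icc (0:ℝ) 1, ‖Vn n s - V s‖ ≤ ε n := fun n s hs =>
    le_of_tendsto ((tendsto_const_nhds.sub (hV s hs)).norm) (by
      filter_upwards [Filter.eventually_ge_atTop n] with j hj
      exact hcau n j hj s hs)
  have hϱt : Filter.Tendsto (fun n => rj n / 4) Filter.atTop (nhds 0) := by
    have := (rj_tendsto 1 one_pos).div_const 4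
    simpa using this
  have hVZ : ∀ s ∈ Icc (0:ℝ) 1, Zyg (α + μ) 0 M (V s) := fun s hs =>
    Zyg.lim (by linarith [hα.1, hμ.1]) hϱt (fun n => hZ n s hs) (hV s hs)
  refine ⟨V, ?_, hVZ, fun s hs s' hs' => ?_, fun x => ?_, fun T E' B W hT hW0 hB hWc hWd s hs => ?_⟩
  · refine tendsto_nhds_unique (hV 0 (by simp)) ?_
    simp only [hVn, solV_zero]
    exact tendsto_const_nhds
  · exact Zyg.lim (by linarith [hα.1, hμ.1]) hϱt (fun n => (hap _ _ _ _ (hF n) A f hf).2.2.2 s hs s' hs') ((hV s hs).sub (hV s' hs'))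
  · refine deriv_limit (φ := fun n s => Vn n s x) (φ' := fun n s => L n (Vn n s) x + f x) (fun n s hs => hder n s x 1)
      (fun s hs => ?_) ?_
    · exact ((BoundedContinuousFunction.evalCLM ℝ x : XX d →L[ℝ] ℝ).continuous.tendsto _).comp (hV s hs)
    · intro η hη
      obtain ⟨Cθ, hCθ, hθ⟩ := exists_LVt d hμ hα hΛ (η / 2 / (M + M + 1)) (by positivity)
      have ht : Filter.Tendsto (fun n => Cθ * ε n + Cc * M * rj n ^ δ) Filter.atTop (nhds 0) := by
        have := (hεt.const_mul Cθ).add ((rj_tendsto δ hδ).const_mul (Cc * M))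
        simpa using this
      filter_upwards [ht.eventually (gt_mem_nhds (show (0:ℝ) < η/2 by linarith))] with n hn s hs
      have hrn := rj_pos n
      have b1 := hθ κ r0 _ _ _ _ (hF n) _ _ ((hZ n s hs).sub ((hVZ s hs).mono_rho (show 0 ≤ rj n / 4 by positivity)))
      have b2 := hcons M _ (hVZ s hs) n x
      have b3 := hVε n s hs
      have b4 : (η / 2 / (M + M + 1)) * (M + M) ≤ η / 2 := by
        rw [div_mul_eq_mul_div, div_le_iff₀ (by positivity)]; nlinarith
      have b5 : Cθ * ‖Vn n s - V s‖ ≤ Cθ * ε n := by gcongr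
      have b6 := XX.abs_le (L n (Vn n s - V s)) x
      have e : L n (Vn n s) x + f x - (𝔏 (V s) x + f x) = L n (Vn n s - V s) x + (L n (V s) x - 𝔏 (V s) x) := by
        rw [map_sub]
        change _ = L n (Vn n s) x - L n (V s) x + (L n (V s) x - 𝔏 (V s) x)
        ring
      rw [e]
      refine (abs_add_le _ _).trans ?_
      linarith
  · have hs1 : s ∈ Icc (0:ℝ) 1 := ⟨hs.1, hs.2.trans hT⟩
    have hB0 : 0 ≤ B := (norm_nonneg _).trans (hB s hs)
    have hE0 : 0 ≤ E' := by
      have := (abs_nonneg _).trans (hWc s hs 0 0)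
      rwa [rj_zero, Real.one_rpow, mul_one] at this
    -- Lipschitz constant of `W`
    set Lw := 2 * m 0 * B + E' + ‖f‖ with hLw
    have hm0 := (hF 0).Lgen.nonneg
    have hLw0 : 0 ≤ Lw := by positivity
    have hbd : ∀ s ∈ Icc (0:ℝ) T, ∀ x, |𝔏 (W s) x + f x| ≤ Lw := fun s hs x => by
      have c1 := hWc s hs 0 x
      rw [rj_zero, Real.one_rpow, mul_one] at c1
      have c2 := (XX.abs_le (L 0 (W s)) x).trans ((hF 0).Lgen.norm_apply_le (W s))
      have c3 : 2 * m 0 * ‖W s‖ ≤ 2 * m 0 * B := by have := hB s hs; gcongr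
      have c4 := XX.abs_le f x
      have e : 𝔏 (W s) x + f x = L 0 (W s) x - (L 0 (W s) x - 𝔏 (W s) x) + f x := by ring
      rw [e]
      have t1 := abs_add_le (L 0 (W s) x - (L 0 (W s) x - 𝔏 (W s) x)) (f x)
      have t2 := abs_sub (L 0 (W s) x) (L 0 (W s) x - 𝔏 (W s) x)
      linarith
    have hWl : ∀ s ∈ Icc (0:ℝ) T, ∀ s' ∈ Icc (0:ℝ) T, ‖W s - W s'‖ ≤ Lw * |s - s'| := fun s hs s' hs' =>
      XX.norm_le_of fun x => by
        have := Convex.norm_image_sub_le_of_norm_hasDerivWithin_le (𝕜 := ℝ) (f := fun s => W s x) (C := Lw) (hWd x)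
          (fun u hu => hbd u hu x) (convex_Icc _ _) hs' hs
        exact this
    have key : ∀ n, ‖Vn n s - W s‖ ≤ E' * rj n ^ δ := fun n => by
      have hrn := rj_pos n
      have := (hF n).Lgen.maxPrin (T := T) (Λ := ‖f‖ + Lw) (ε := E' * rj n ^ δ) (w := fun s => Vn n s - W s) (by positivity)
        (by simp [hVn, solV_zero, hW0]) (fun s hs s' hs' => by
          have h1 := (hF n).Lgen.solV_lip f hs.1 hs'.1
          have h2 := hWl s hs s' hs'
          have e : (Vn n s - W s) - (Vn n s' - W s') = (Vn n s - Vn n s') - (W s - W s') := by abel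
          rw [e]
          refine (norm_sub_le _ _).trans ?_
          linarith)
        (fun s hs x => ⟨_, (hder n s x T).sub (hWd x s hs), by
          have e : L n (Vn n s) x + f x - (𝔏 (W s) x + f x) - L n (Vn n s - W s) x = L n (W s) x - 𝔏 (W s) x := by
            rw [map_sub]
            change L n (Vn n s) x + f x - (𝔏 (W s) x + f x) - (L n (Vn n s) x - L n (W s) x) = _
            ring
          rw [e]
          exact hWc s hs n x⟩) hs
      refine this.trans ?_
      have : 0 ≤ E' * rj n ^ δ := by positivity
      nlinarith [hs1.2]
    have h1 : Filter.Tendsto (fun n => Vn n s) Filter.atTop (nhds (W s)) := by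
      rw [tendsto_iff_norm_sub_tendsto_zero]
      refine squeeze_zero (fun _ => norm_nonneg _) key ?_
      simpa using (rj_tendsto δ hδ).const_mul E'
    exact tendsto_nhds_unique h1 (hV s hs1)

end limitthm

/-! ## Part 17 -/
open scoped BoundedContinuousFunction ContDiff
set_option linter.unusedSectionVars false
set_option linter.unusedVariables false

section final
variable {d : ℕ}

lemma rev_deriv {φ : ℝ → ℝ} {D D' T s : ℝ} (h : HasDerivWithinAt φ D (Icc 0 T) (T - s)) (hD : D' = -D) :
    HasDerivWithinAt (fun s => φ (T - s)) D' (Icc 0 T) s := by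
  have h1 : HasDerivWithinAt (fun s : ℝ => T - s) (-1) (Icc 0 T) s := by
    simpa using (hasDerivWithinAt_id s (Icc 0 T)).const_sub T
  have h2 := HasDerivWithinAt.comp s h h1 (fun u hu => ⟨by linarith [hu.2], by linarith [hu.1]⟩)
  refine HasDerivWithinAt.congr_deriv h2 ?_
  rw [hD]; ring

/-- the limit operator -/
def LLop (d : ℕ) (α : ℝ) (ρ : Euc d → ℝ) (G : Euc d → Matrix (Fin d) (Fin d) ℝ) (btil : Euc d → Euc d) (w : Euc d → ℝ) (x : Euc d) : ℝ :=
  LL (Pm d α ρ) (matCLM (G x)) (btil x) w (fderiv ℝ w x) x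

lemma LLop_eq [NeZero d] {α : ℝ} {ρ : Euc d → ℝ} (hρm : Measurable ρ) (hρ : ∀ y : Euc d, y ≠ 0 → 0 ≤ ρ y) {G : Euc d → Matrix (Fin d) (Fin d) ℝ}
    {btil : Euc d → Euc d} {v : Euc d → ℝ} {x : Euc d} (hv : DifferentiableAt ℝ v x) :
    LLop d α ρ G btil v x = ⟪btil x, gradient v x⟫ + Lop d α ρ G v x := by
  rw [LLop, LL, (Lop_eq hρm hρ hv).1, add_comm, real_inner_comm, gradient, InnerProductSpace.toDual_symm_apply]

/-- a bounded continuous function from a function with finite Hölder norm -/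
lemma exists_XX {β M : ℝ} (hM : 0 ≤ M) {u : Euc d → ℝ} (hc : Continuous u) (hu : hNorm d β u ≤ ENNReal.ofReal M) :
    ∃ w : XX d, (∀ x, w x = u x) ∧ ‖w‖ ≤ M := by
  have hb : ∀ x, ‖u x‖ ≤ M := fun x => by
    have := hNorm_deriv hM hu (n := 0) (by omega) x
    rwa [norm_iteratedFDeriv_zero] at this
  exact ⟨BoundedContinuousFunction.ofNormedAddCommGroup u hc M hb, fun x => rfl,
    BoundedContinuousFunction.norm_ofNormedAddCommGroup_le hc hM hb⟩

lemma contDiff_diff {β : ℝ} (hβ : 1 < β) {u : Euc d → ℝ} (hc : ContDiff ℝ (⌊β⌋₊ : ℕ∞) u) : Differentiable ℝ u := by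
  have h1n : 1 ≤ ⌊β⌋₊ := Nat.le_floor (by simpa using hβ.le)
  exact hc.differentiable (by
    have : (⌊β⌋₊:ℕ∞) ≠ 0 := by exact_mod_cast (by omega : ⌊β⌋₊ ≠ 0)
    exact_mod_cast this)

end final

theorem statement1 (d : ℕ) (hd : 1 ≤ d) (α μ c0 K : ℝ)
    (hα : α ∈ Ico (1 : ℝ) 2) (hμ : μ ∈ Ioo (0 : ℝ) 1)
    (hnotint1 : ∀ n : ℤ, α + μ ≠ (n : ℝ))
    (hnotint2 : ∀ n : ℤ, α / 2 + μ ≠ (n : ℝ))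
    (hc0 : 0 < c0) (hK : 0 < K) :
    ∃ C : ℝ≥0,
      ∀ (ρ : Euc d → ℝ) (G : Euc d → Matrix (Fin d) (Fin d) ℝ)
        (btil : Euc d → Euc d),
        AssumpS d α c0 ρ → AssumpA d α K c0 ρ G →
        (∀ k : Fin d, InHolder d μ (fun x => btil x k) ∧
          hNorm d μ (fun x => btil x k) ≤ ENNReal.ofReal K) →
        (∀ y z : Euc d, ‖y‖ = 1 → ‖z‖ = 1 → |ρ y - ρ z| ≤ K * ‖y - z‖ ^ μ) →
        ∀ f : Euc d → ℝ, InHolder d μ f →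
          ∀ T : ℝ, T ∈ Icc (0 : ℝ) 1 →
            ∃ v : ℝ → Euc d → ℝ,
              IsSolutionBwd d α (α + μ) T ρ G btil f v ∧
              hNormT d (α + μ) T v ≤ (C : ℝ≥0∞) * hNorm d μ f ∧
              (∀ s t : ℝ, 0 ≤ s → s ≤ t → t ≤ T →
                hNorm d (α / 2 + μ) (fun x => v t x - v s x) ≤
                  (C : ℝ≥0∞) * ENNReal.ofReal ((t - s) ^ ((1 : ℝ) / 2)) *
                    hNorm d μ f) ∧
              ∀ v' : ℝ → Euc d → ℝ, IsSolutionBwd d α (α + μ) T ρ G btil f v' →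
                ∀ t ∈ Icc (0 : ℝ) T, ∀ x : Euc d, v' t x = v t x := by
  have hd0 : NeZero d := ⟨by omega⟩
  have hβ : α + μ ∈ Ioo (0:ℝ) 3 := ⟨by linarith [hα.1, hμ.1], by linarith [hα.2, hμ.2]⟩
  have hβ1 : 1 < α + μ := by linarith [hα.1, hμ.1]
  have hβ' : α / 2 + μ ∈ Ioo (0:ℝ) 3 := ⟨by linarith [hα.1, hμ.1], by linarith [hα.2, hμ.2]⟩
  set K' := 2 * K + (2 * K) ^ μ + 2 * K * d with hK'
  have hK'0 : 0 ≤ K' := by positivity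
  obtain ⟨Cm, hCm, hlevy⟩ := Pm_levy d hα hK.le
  obtain ⟨κ, r0, C1, hκ, hr0, hr01, hC1, hlow⟩ := exists_lowB d hα hc0 hK
  obtain ⟨Λ, hΛ, hfam⟩ := exists_fam d (r0 := r0) hα hμ hCm hK'0 hκ hC1
  obtain ⟨C, hC, hlim⟩ := limit_thm d hμ hα (by linarith : 0 ≤ Λ) hκ hr0 hr01
  obtain ⟨Cz, hCz, hz⟩ := zyg_holder d hβ hnotint1
  obtain ⟨Cy, hCy, hy⟩ := zyg_holder d hβ' hnotint2
  set γ := min (α + μ) 2 with hγd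
  have hγ : α < γ := lt_min (by linarith [hμ.1]) hα.2
  obtain ⟨Cc, hCc, hcons⟩ := cons (d := d) hα hγ hCm hK'0
  have hCt0 : 0 ≤ (Cz + Cy) * C := by positivity
  refine ⟨((Cz + Cy) * C).toNNReal, fun ρ G btil hS hA hb hρ f hf T hT => ?_⟩
  obtain ⟨-, hdet, hGK, hGL, hρK⟩ := hA
  have hρm : Measurable ρ := rho_meas hμ.1 hS hρ
  have hρ0 : ∀ y : Euc d, y ≠ 0 → 0 ≤ ρ y := fun y hy => (hρK y hy).1
  have hL : Levy α Cm (Pm d α ρ) := hlevy ρ hρm (fun y hy => (hρK y hy).2) hS.2.2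
  have hco : Coef μ K' (fun x => matCLM (G x)) btil := coef_mk hμ hK hGK hGL (fun k => (hb k).2)
  have hlo : LowB α κ r0 C1 (Pm d α ρ) (fun x => matCLM (G x)) :=
    hlow ρ _ hρm hS.1 hGK (fun x => by rw [matCLM_det]; exact hdet x)
  have hC10 : 0 < C1 := by linarith
  -- the approximating sequence
  set σ : ℕ → ℝ := fun n => rj n / (4 * C1) with hσ
  have hσ0 : ∀ n, 0 < σ n := fun n => by have := rj_pos n; simp only [hσ]; positivity
  have hσr : ∀ n, σ n ≤ rj n := fun n => by
    have := rj_pos n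
    simp only [hσ]; exact div_le_self this.le (by linarith)
  have hCσ : ∀ n, C1 * σ n = rj n / 4 := fun n => by simp only [hσ]; field_simp
  have hex : ∀ n, ∃ (𝓛 : Euc d → Op d) (L : Op d), Fam μ α Λ κ r0 (rj n / 4) (nuMass (Pm d α ρ) α (σ n)) 𝓛 L ∧
      ∀ u x, L u x = Nf (Pm d α ρ) α (σ n) (matCLM (G x)) (btil x) (J (σ n) u) x - nuMass (Pm d α ρ) α (σ n) * u x := fun n => by
    rw [← hCσ]
    exact hfam _ _ _ hL hco hlo (σ n) (hσ0 n) (by rw [hCσ]; linarith [rj_le_one n])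
  choose 𝓛 L hF hLeq using hex
  -- consistency
  have hct : ∀ M, 0 ≤ M → ∀ w : XX d, ContDiff ℝ (⌊α + μ⌋₊ : ℕ∞) (w : Euc d → ℝ) → hNorm d (α + μ) w ≤ ENNReal.ofReal M →
      ∀ n x, |L n w x - LLop d α ρ G btil w x| ≤ Cc * M * rj n ^ (γ - α) := by
    intro M hM w hwc hwn n x
    rw [hLeq]
    have h1 := hcons _ hL (matCLM (G x)) (btil x) (hco.nA x) (hco.nb x) (σ n) (hσ0 n) ((hσr n).trans (rj_le_one n)) w
      (fun x => fderiv ℝ w x) M hM (fun x p => hNorm_taylor hβ1 hβ.2 hM hwc hwn x p) x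
    refine h1.trans ?_
    have : σ n ^ (γ - α) ≤ rj n ^ (γ - α) := Real.rpow_le_rpow (hσ0 n).le (hσr n) (by linarith)
    gcongr
  have hIntg : ∀ M, 0 ≤ M → ∀ w : XX d, ContDiff ℝ (⌊α + μ⌋₊ : ℕ∞) (w : Euc d → ℝ) → hNorm d (α + μ) w ≤ ENNReal.ofReal M →
      ∀ x, Integrable (TR w (fderiv ℝ w x) x (matCLM (G x))) (Pm d α ρ) := by
    intro M hM w hwc hwn x
    have h1 := TR_int hα.1 hγ hM hL (fun p => hNorm_taylor hβ1 hβ.2 hM hwc hwn x p) (hGK x) one_pos le_rfl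
    rw [← integrableOn_univ, ← union_compl_self (Sx d 1)]
    exact h1.1.union h1.2
  -- datum
  set A := (hNorm d μ f).toReal with hAd
  have hA0 : 0 ≤ A := ENNReal.toReal_nonneg
  have hAf : ENNReal.ofReal A = hNorm d μ f := ENNReal.ofReal_toReal hf.2
  obtain ⟨fX, hfX, hfXn⟩ := exists_XX hA0 hf.1.continuous hAf.ge
  have hHol : HolX μ A (-fX) := by
    refine ⟨by rw [norm_neg]; exact hfXn, fun x h => ?_⟩
    have := (hNorm_zero hμ hA0 hAf.ge).2 x (x + h)
    change |-(fX (x + h)) - -(fX x)| ≤ _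
    rw [hfX, hfX, show -(f (x + h)) - -(f x) = f x - f (x + h) by ring]
    refine this.trans (le_of_eq ?_)
    congr 2
    rw [← norm_neg]; congr 1; abel
  obtain ⟨V, hV0, hVZ, hVt, hVd, hVu⟩ := hlim (Cc * Cz) (γ - α) _ 𝓛 L (fun w x => LLop d α ρ G btil w x) (by positivity) (by linarith) hF
    (fun M w hw n x => by
      have hM := hw.nonneg
      obtain ⟨h1, h2⟩ := hz M w hw
      refine (hct (Cz * M) (by positivity) w h1 h2 n x).trans (le_of_eq (by ring))) A (-fX) hHol
  have hCA0 : 0 ≤ Cz * (C * A) := by positivity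
  have hrange : ∀ t ∈ Icc (0:ℝ) T, T - t ∈ Icc (0:ℝ) 1 := fun t ht => ⟨by linarith [ht.2], by linarith [ht.1, hT.2]⟩
  have hVr : ∀ t ∈ Icc (0:ℝ) T, ContDiff ℝ (⌊α + μ⌋₊ : ℕ∞) (V (T - t) : Euc d → ℝ) ∧ hNorm d (α + μ) (V (T - t)) ≤ ENNReal.ofReal (Cz * (C * A)) :=
    fun t ht => hz _ _ (hVZ _ (hrange t ht))
  have hbound : hNormT d (α + μ) T (fun t x => V (T - t) x) ≤ ENNReal.ofReal (Cz * (C * A)) :=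
    iSup₂_le fun t ht => (hVr t ht).2
  have hcoe : (((Cz + Cy) * C).toNNReal : ℝ≥0∞) = ENNReal.ofReal ((Cz + Cy) * C) := rfl
  refine ⟨fun t x => V (T - t) x, ⟨⟨fun t ht => (hVr t ht).1, ne_top_of_le_ne_top ENNReal.ofReal_ne_top hbound⟩, fun x => ?_, fun t ht x => ?_, fun t ht x => ?_⟩, ?_, fun s t hs hst ht => ?_, fun v' hv' => ?_⟩
  · simp only [sub_self, hV0]; rfl
  · obtain ⟨h1, h2⟩ := hVr t ht
    exact (Lop_eq hρm hρ0 ((contDiff_diff hβ1 h1) x)).2 (hIntg _ hCA0 _ h1 h2 x)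
  · obtain ⟨h1, h2⟩ := hVr t ht
    have h3 := (hVd x _ (hrange t ht)).mono (Icc_subset_Icc le_rfl hT.2)
    refine rev_deriv h3 ?_
    rw [LLop_eq hρm hρ0 ((contDiff_diff hβ1 h1) x)]
    change _ = -(⟪btil x, gradient (V (T - t)) x⟫ + Lop d α ρ G (V (T - t)) x + -(fX x))
    rw [hfX]
    ring
  · refine hbound.trans ?_
    rw [hcoe, ← hAf, ← ENNReal.ofReal_mul hCt0]
    refine ENNReal.ofReal_le_ofReal ?_
    have : 0 ≤ Cy * C * A := by positivity
    linarith
  · have h1 := (hy _ _ (hVt _ (hrange t ⟨hs.trans hst, ht⟩) _ (hrange s ⟨hs, hst.trans ht⟩))).2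
    have e : |T - t - (T - s)| = t - s := by rw [show T - t - (T - s) = -(t - s) by ring, abs_neg, abs_of_nonneg (by linarith)]
    rw [e] at h1
    refine le_trans h1 ?_
    have hp : 0 ≤ (t - s) ^ ((1:ℝ)/2) := Real.rpow_nonneg (by linarith) _
    rw [hcoe, ← hAf, ← ENNReal.ofReal_mul hCt0, ← ENNReal.ofReal_mul (by positivity)]
    refine ENNReal.ofReal_le_ofReal ?_
    have : 0 ≤ Cz * C * A * (t - s) ^ ((1:ℝ)/2) := by positivity
    linarith
  · obtain ⟨⟨hc', hn'⟩, hT', -, hd'⟩ := hv'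
    set M := (hNormT d (α + μ) T v').toReal with hM
    have hM0 : 0 ≤ M := ENNReal.toReal_nonneg
    have hMv : ∀ t ∈ Icc (0:ℝ) T, hNorm d (α + μ) (v' t) ≤ ENNReal.ofReal M := fun t ht => by
      rw [hM, ENNReal.ofReal_toReal hn']
      exact le_iSup₂ (f := fun t (_ : t ∈ Icc (0:ℝ) T) => hNorm d (α + μ) (v' t)) t ht
    have hex : ∀ s, ∃ w : XX d, s ∈ Icc (0:ℝ) T → (∀ x, w x = v' (T - s) x) ∧ ‖w‖ ≤ M := fun s => by
      by_cases hs : s ∈ Icc (0:ℝ) T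
      · have hs' : T - s ∈ Icc (0:ℝ) T := ⟨by linarith [hs.2], by linarith [hs.1]⟩
        obtain ⟨w, hw⟩ := exists_XX hM0 (hc' _ hs').continuous (hMv _ hs')
        exact ⟨w, fun _ => hw⟩
      · exact ⟨0, fun h => absurd h hs⟩
    choose W hW using hex
    have hWe : ∀ s ∈ Icc (0:ℝ) T, (W s : Euc d → ℝ) = v' (T - s) := fun s hs => funext (hW s hs).1
    have h0T : (0:ℝ) ∈ Icc (0:ℝ) T := ⟨le_rfl, hT.1⟩
    have key := hVu T (Cc * M) M W hT.2 (by
        ext x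
        rw [(hW 0 h0T).1, sub_zero, hT']; rfl)
      (fun s hs => (hW s hs).2)
      (fun s hs n x => by
        have hs' : T - s ∈ Icc (0:ℝ) T := ⟨by linarith [hs.2], by linarith [hs.1]⟩
        exact hct M hM0 (W s) (by rw [hWe s hs]; exact hc' _ hs') (by rw [hWe s hs]; exact hMv _ hs') n x)
      (fun x s hs => by
        have hs' : T - s ∈ Icc (0:ℝ) T := ⟨by linarith [hs.2], by linarith [hs.1]⟩
        have h1 := rev_deriv (hd' _ hs' x) rfl
        refine HasDerivWithinAt.congr_deriv (h1.congr (fun u hu => (hW u hu).1 x) ((hW s hs).1 x)) ?_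
        rw [hWe s hs, LLop_eq hρm hρ0 ((contDiff_diff hβ1 (hc' _ hs')) x)]
        change _ = _ + -(fX x)
        rw [hfX]
        ring)
    intro t ht x
    have ht' : T - t ∈ Icc (0:ℝ) T := ⟨by linarith [ht.2], by linarith [ht.1]⟩
    have h2 := (hW _ ht').1 x
    rw [key _ ht', sub_sub_cancel] at h2
    exact h2.symm
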